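/- The module J^{w,Co₀}_{*,Λ,2} of Conway invariant weak Jacobi forms of integral weight and index 2 is a free module over M_*(SL₂(ℤ)) = ℂ[E₄,E₆], generated by four forms of weights −4, −2, 0 and 0. -/

import Mathlib

open Complex Matrix UpperHalfPlane
open scoped Manifold MatrixGroups Real Topology BigOperators

noncomputable section

/-- Vectors of the rank-24 lattice (coordinates w.r.t. a fixed basis). -/
abbrev LV := Fin 24 → ℤ

/-- Complexified vectors. -/
abbrev CV := Fin 24 → ℂ

/-- The bilinear form attached to a Gram matrix `B`. -/
def pairZ (B : Matrix (Fin 24) (Fin 24) ℤ) (v u : LV) : ℤ := v ⬝ᵥ B.mulVec u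

/-- The complex bilinear extension of the form. -/
def pairC (B : Matrix (Fin 24) (Fin 24) ℤ) (z w : CV) : ℂ :=
  z ⬝ᵥ ((B.map (Int.cast : ℤ → ℂ)).mulVec w)

/-- Inclusion of lattice vectors into complexified vectors. -/
def liftC (v : LV) : CV := fun i => (v i : ℂ)

/-- `B` is a Gram matrix of the Leech lattice: even, unimodular, positive definite of
rank 24, with no vectors of norm 2 (no roots). -/
def IsLeech (B : Matrix (Fin 24) (Fin 24) ℤ) : Prop :=
  B.IsSymm ∧ B.det = 1 ∧ (∀ v : LV, v ≠ 0 → 0 < pairZ B v v) ∧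
    (∀ v : LV, Even (pairZ B v v)) ∧ (∀ v : LV, pairZ B v v ≠ 2)

/-- The automorphism group `Co₀ = Aut(Λ)` of the lattice, as a set of integral matrices. -/
def ConwayGroup (B : Matrix (Fin 24) (Fin 24) ℤ) : Set (Matrix (Fin 24) (Fin 24) ℤ) :=
  {σ | IsUnit σ.det ∧ σᵀ * B * σ = B}

/-- Action of an integral matrix on complexified vectors. -/
def actC (σ : Matrix (Fin 24) (Fin 24) ℤ) (z : CV) : CV :=
  (σ.map (Int.cast : ℤ → ℂ)).mulVec z

/-- `e(x) = exp(2πix)`. -/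
def eC (x : ℂ) : ℂ := Complex.exp (2 * (Real.pi : ℂ) * Complex.I * x)

/-- The Fourier term `qⁿ ζ^ℓ`. -/
def fterm (B : Matrix (Fin 24) (Fin 24) ℤ) (n : ℕ) (ℓ : LV) (τ : UpperHalfPlane) (z : CV) : ℂ :=
  eC ((n : ℂ) * (τ : ℂ)) * eC (pairC B (liftC ℓ) z)

/-- Lower-left entry of `A ∈ SL(2,ℤ)`, as a complex number. -/
def slc (A : SL(2, ℤ)) : ℂ := ((A : Matrix (Fin 2) (Fin 2) ℤ) 1 0 : ℤ)

/-- Lower-right entry of `A ∈ SL(2,ℤ)`, as a complex number. -/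
def sld (A : SL(2, ℤ)) : ℂ := ((A : Matrix (Fin 2) (Fin 2) ℤ) 1 1 : ℤ)

/-- The automorphy factor `cτ + d`. -/
def jfactor (A : SL(2, ℤ)) (τ : UpperHalfPlane) : ℂ := slc A * (τ : ℂ) + sld A

/-- `φ : ℍ × (Λ⊗ℂ) → ℂ` is a Conway invariant weak Jacobi form of weight `k` and index `t`
with Fourier coefficients `f`. -/
structure IsJacobiFormWith (B : Matrix (Fin 24) (Fin 24) ℤ) (k : ℤ) (t : ℕ)
    (φ : UpperHalfPlane → CV → ℂ) (f : ℕ → LV → ℂ) : Prop where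
  holo_tau : ∀ z : CV, MDifferentiable 𝓘(ℂ) 𝓘(ℂ) fun τ : UpperHalfPlane => φ τ z
  holo_z : ∀ τ : UpperHalfPlane, Differentiable ℂ (φ τ)
  conway_invar : ∀ σ ∈ ConwayGroup B, ∀ (τ : UpperHalfPlane) (z : CV), φ τ (actC σ z) = φ τ z
  quasi_periodic : ∀ (x y : LV) (τ : UpperHalfPlane) (z : CV),
    φ τ (z + (τ : ℂ) • liftC x + liftC y) =
      Complex.exp (-(t : ℂ) * (Real.pi : ℂ) * Complex.I * (pairZ B x x : ℂ) * (τ : ℂ)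
        - 2 * (t : ℂ) * (Real.pi : ℂ) * Complex.I * pairC B (liftC x) z) * φ τ z
  modular : ∀ (A : SL(2, ℤ)) (τ : UpperHalfPlane) (z : CV),
    φ (A • τ) ((jfactor A τ)⁻¹ • z) =
      (jfactor A τ) ^ k *
        Complex.exp ((t : ℂ) * (Real.pi : ℂ) * Complex.I * slc A * pairC B z z / jfactor A τ) *
        φ τ z
  expansion : ∀ (τ : UpperHalfPlane) (z : CV),
    HasSum (fun p : ℕ × LV => f p.1 p.2 * fterm B p.1 p.2 τ z) (φ τ z)

/-- Conway invariant weak Jacobi forms. -/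
def IsWeakJacobiForm (B : Matrix (Fin 24) (Fin 24) ℤ) (k : ℤ) (t : ℕ)
    (φ : UpperHalfPlane → CV → ℂ) : Prop :=
  ∃ f, IsJacobiFormWith B k t φ f

/-- Conway invariant holomorphic Jacobi forms. -/
def IsHolJacobiForm (B : Matrix (Fin 24) (Fin 24) ℤ) (k : ℤ) (t : ℕ)
    (φ : UpperHalfPlane → CV → ℂ) : Prop :=
  ∃ f, IsJacobiFormWith B k t φ f ∧
    ∀ (n : ℕ) (ℓ : LV), 2 * (n : ℤ) * t - pairZ B ℓ ℓ < 0 → f n ℓ = 0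

/-- Modular forms of weight `k` on `SL₂(ℤ)`; the ring of all of them is `ℂ[E₄,E₆]`. -/
abbrev MForm (k : ℤ) := ModularForm (CongruenceSubgroup.Gamma 1) k

/-- The family `φ i` (of weights `w i`) freely generates the module of all forms satisfying
`P` over the ring `M_*(SL₂(ℤ)) = ℂ[E₄,E₆]` of modular forms on `SL₂(ℤ)`. -/
def FreelyGenerates (P : ℤ → (UpperHalfPlane → CV → ℂ) → Prop) {n : ℕ}
    (w : Fin n → ℤ) (φ : Fin n → UpperHalfPlane → CV → ℂ) : Prop :=
  (∀ i, P (w i) (φ i)) ∧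
  ∀ (k : ℤ) (ψ : UpperHalfPlane → CV → ℂ), P k ψ →
    ∃! g : (i : Fin n) → MForm (k - w i),
      ∀ (τ : UpperHalfPlane) (z : CV), ψ τ z = ∑ i, (g i) τ * φ i τ z

/-- The point `(aτ+b)/d` of the upper half-plane (for `a, d > 0`). -/
def heckePt (a d b : ℕ) (τ : UpperHalfPlane) : UpperHalfPlane :=
  if h : 0 < ((((a : ℂ) * (τ : ℂ) + (b : ℂ)) / (d : ℂ)).im) then
    ⟨((a : ℂ) * (τ : ℂ) + (b : ℂ)) / (d : ℂ), h⟩ else τ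

/-- The Hecke operator `T₋(m)` on Jacobi forms of weight `k`. -/
def heckeOp (k : ℤ) (m : ℕ) (φ : UpperHalfPlane → CV → ℂ) : UpperHalfPlane → CV → ℂ :=
  fun τ z => (m : ℂ)⁻¹ * ∑ d ∈ m.divisors, ∑ b ∈ Finset.range d,
    ((m / d : ℕ) : ℂ) ^ k * φ (heckePt (m / d) d b τ) (((m / d : ℕ) : ℂ) • z)

/-- The Jacobi theta function `Θ_Λ = A₁` of the lattice. -/
def thetaLeech (B : Matrix (Fin 24) (Fin 24) ℤ) : UpperHalfPlane → CV → ℂ := fun τ z =>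
  ∑' ℓ : LV, Complex.exp ((Real.pi : ℂ) * Complex.I * (pairZ B ℓ ℓ : ℂ) * (τ : ℂ)
    + 2 * (Real.pi : ℂ) * Complex.I * pairC B (liftC ℓ) z)

/-- `σ_k(n) = Σ_{d ∣ n} d^k`. -/
def sigmaNat (k n : ℕ) : ℕ := ∑ d ∈ n.divisors, d ^ k

/-- `A_t = σ₁₁(t)⁻¹ (A₁ | T₋(t))`, a holomorphic Jacobi form of weight 12 and index `t`. -/
def Aform (B : Matrix (Fin 24) (Fin 24) ℤ) (t : ℕ) : UpperHalfPlane → CV → ℂ := fun τ z =>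
  ((sigmaNat 11 t : ℂ))⁻¹ * heckeOp 12 t (thetaLeech B) τ z

/-- The quasimodular Eisenstein series `E₂`. -/
def E2 : UpperHalfPlane → ℂ := fun τ =>
  1 - 24 * ∑' n : ℕ, (sigmaNat 1 (n + 1) : ℂ) * eC (((n : ℂ) + 1) * (τ : ℂ))

/-- The discriminant cusp form `Δ(τ) = q ∏ (1-qⁿ)^24`. -/
def DeltaForm : UpperHalfPlane → ℂ := fun τ =>
  eC (τ : ℂ) * ∏' n : ℕ, (1 - eC (((n : ℂ) + 1) * (τ : ℂ))) ^ 24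

/-- `aτ`. -/
def scaleH (a : ℕ) (τ : UpperHalfPlane) : UpperHalfPlane := heckePt a 1 0 τ

/-- `(τ+j)/t`. -/
def sliceH (t j : ℕ) (τ : UpperHalfPlane) : UpperHalfPlane := heckePt 1 t j τ

/-- `f₂(τ) = (tE₂(tτ) - E₂(τ))/(t-1)`, a modular form of weight 2 on `Γ₀(t)`. -/
def f2w (t : ℕ) (τ : UpperHalfPlane) : ℂ := ((t : ℂ) * E2 (scaleH t τ) - E2 τ) / ((t : ℂ) - 1)

/-- `B_t`, a holomorphic Jacobi form of weight 14 and index `t` (for `t` prime). -/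
def Bform (B : Matrix (Fin 24) (Fin 24) ℤ) (t : ℕ) : UpperHalfPlane → CV → ℂ := fun τ z =>
  ((t : ℂ) ^ 12 / ((t : ℂ) ^ 12 - 1)) *
    (f2w t τ * thetaLeech B (scaleH t τ) ((t : ℂ) • z)
      - (t : ℂ) ^ (-13 : ℤ) *
        ∑ j ∈ Finset.range t, f2w t (sliceH t j τ) * thetaLeech B (sliceH t j τ) z)

/-- Fourier coefficients of `E₂`. -/
def e2coeff : ℕ → ℂ := fun m => if m = 0 then 1 else -24 * (sigmaNat 1 m : ℂ)

/-- Fourier coefficients of the image `H_k(φ)` of the modified heat operator applied to a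
Jacobi form of weight `k` and index `t` with Fourier coefficients `f`:
`H_k(φ) = 𝓗(φ) + ((12-k)/12)E₂φ` where `𝓗` multiplies `f(n,ℓ)` by `n - (ℓ,ℓ)/(2t)`. -/
def heatCoeff (B : Matrix (Fin 24) (Fin 24) ℤ) (k : ℤ) (t : ℕ) (f : ℕ → LV → ℂ) :
    ℕ → LV → ℂ := fun n ℓ =>
  ((n : ℂ) - (pairZ B ℓ ℓ : ℂ) / (2 * (t : ℂ))) * f n ℓ +
    ((12 - k : ℤ) : ℂ) / 12 * ∑ m ∈ Finset.range (n + 1), e2coeff m * f (n - m) ℓ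

/-- The function with Fourier coefficients `f`. -/
def fourierSeries (B : Matrix (Fin 24) (Fin 24) ℤ) (f : ℕ → LV → ℂ) :
    UpperHalfPlane → CV → ℂ := fun τ z =>
  ∑' p : ℕ × LV, f p.1 p.2 * fterm B p.1 p.2 τ z

/-- The family `Φ m = Φ_{12,m}` of Fourier–Jacobi coefficients of the Borcherds form `Φ₁₂`
at the Leech cusp:
`Δ(τ)·exp(−Σ_{m≥1}((Δ⁻¹A₁)|T₋(m))(τ,𝔷)e^{2πimω}) = Σ_{m≥0} Φ_{12,m}(τ,𝔷)e^{2πimω}`. -/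
def IsFJExpansionOfPhi12 (B : Matrix (Fin 24) (Fin 24) ℤ)
    (Φ : ℕ → UpperHalfPlane → CV → ℂ) : Prop :=
  ∀ (τ ω : UpperHalfPlane) (z : CV),
    HasSum (fun m : ℕ => Φ m τ z * eC ((m : ℂ) * (ω : ℂ)))
      (DeltaForm τ * Complex.exp
        (- ∑' m : ℕ, heckeOp 0 (m + 1) (fun σ w => thetaLeech B σ w / DeltaForm σ) τ z *
            eC (((m : ℂ) + 1) * (ω : ℂ))))

/-- `S_t`: the set of lattice vectors of minimal norm in their coset modulo `tΛ`. -/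
def minimalSet (B : Matrix (Fin 24) (Fin 24) ℤ) (t : ℕ) : Set LV :=
  {v | ∀ u : LV, (∃ w : LV, u = v + (t : ℤ) • w) → pairZ B v v ≤ pairZ B u u}

/-- `v` and `u` are conjugate modulo `tΛ` up to the Conway group. -/
def conjModT (B : Matrix (Fin 24) (Fin 24) ℤ) (t : ℕ) (v u : LV) : Prop :=
  ∃ σ ∈ ConwayGroup B, ∃ w : LV, v - σ.mulVec u = (t : ℤ) • w

/-- `s(t) = |(S_t/Co₀)/tΛ|`. -/
def sRank (B : Matrix (Fin 24) (Fin 24) ℤ) (t : ℕ) : ℕ :=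
  Nat.card (Quot (fun v u : minimalSet B t => conjModT B t v.1 u.1))

/-- `R` is a system of representatives for `(S_t/Co₀)/tΛ` (of minimal length). -/
def IsRepSystem (B : Matrix (Fin 24) (Fin 24) ℤ) (t : ℕ) (R : Finset LV) : Prop :=
  (↑R ⊆ minimalSet B t) ∧ ∀ v ∈ minimalSet B t, ∃! r, r ∈ R ∧ conjModT B t v r

/-- The Conway orbit of a lattice vector. -/
def orbitOf (B : Matrix (Fin 24) (Fin 24) ℤ) (v : LV) : Set LV :=
  {u | ∃ σ ∈ ConwayGroup B, u = σ.mulVec v}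

/-- `O` is a Conway orbit of Leech vectors of type `x` (i.e. norm `2x`) with `c` elements. -/
def OrbitData (B : Matrix (Fin 24) (Fin 24) ℤ) (O : Set LV) (x c : ℕ) : Prop :=
  (∃ v : LV, O = orbitOf B v) ∧ (∀ v ∈ O, pairZ B v v = 2 * (x : ℤ)) ∧ Nat.card O = c

/-- `W` is a `d`-dimensional subspace of the space of functions `ℍ × (Λ⊗ℂ) → ℂ`. -/
def SpanDimIs (W : (UpperHalfPlane → CV → ℂ) → Prop) (d : ℕ) : Prop :=
  ∃ φ : Fin d → UpperHalfPlane → CV → ℂ, (∀ i, W (φ i)) ∧ LinearIndependent ℂ φ ∧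
    ∀ ψ, W ψ → ∃ c : Fin d → ℂ, ψ = ∑ i, c i • φ i


/- ### Lattice basics -/
section lat
variable {B : Matrix (Fin 24) (Fin 24) ℤ}

@[simp] lemma pz_add_left (x y z : LV) : pairZ B (x + y) z = pairZ B x z + pairZ B y z := by
  simp [pairZ, add_dotProduct]
@[simp] lemma pz_add_right (x y z : LV) : pairZ B x (y + z) = pairZ B x y + pairZ B x z := by
  simp [pairZ, mulVec_add, dotProduct_add]
@[simp] lemma pz_smul_left (n : ℤ) (x z : LV) : pairZ B (n • x) z = n * pairZ B x z := by
  simp only [pairZ, smul_dotProduct, smul_eq_mul]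
@[simp] lemma pz_smul_right (n : ℤ) (x z : LV) : pairZ B x (n • z) = n * pairZ B x z := by
  simp only [pairZ, mulVec_smul, dotProduct_smul, smul_eq_mul]
@[simp] lemma pz_neg_left (x z : LV) : pairZ B (-x) z = - pairZ B x z := by
  simp [pairZ]
@[simp] lemma pz_neg_right (x z : LV) : pairZ B x (-z) = - pairZ B x z := by
  simp [pairZ, mulVec_neg]
@[simp] lemma pz_sub_left (x y z : LV) : pairZ B (x - y) z = pairZ B x z - pairZ B y z := by
  simp [pairZ, sub_dotProduct]
@[simp] lemma pz_sub_right (x y z : LV) : pairZ B x (y - z) = pairZ B x y - pairZ B x z := by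
  simp [pairZ, mulVec_sub, dotProduct_sub]
@[simp] lemma pz_zero_left (z : LV) : pairZ B 0 z = 0 := by simp [pairZ]
@[simp] lemma pz_zero_right (z : LV) : pairZ B z 0 = 0 := by simp [pairZ]
lemma pz_sum_left {ι : Type*} (s : Finset ι) (g : ι → LV) (z : LV) :
    pairZ B (∑ i ∈ s, g i) z = ∑ i ∈ s, pairZ B (g i) z := by
  classical
  induction s using Finset.induction_on with
  | empty => simp
  | insert a s ha ih => simp [Finset.sum_insert ha, ih]

lemma pz_comm (hB : IsLeech B) (x y : LV) : pairZ B x y = pairZ B y x := by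
  have h : Bᵀ = B := hB.1
  unfold pairZ
  rw [dotProduct_comm, dotProduct_mulVec, ← mulVec_transpose, h]

lemma pz_sum_right (hB : IsLeech B) {ι : Type*} (s : Finset ι) (g : ι → LV) (z : LV) :
    pairZ B z (∑ i ∈ s, g i) = ∑ i ∈ s, pairZ B z (g i) := by
  rw [pz_comm hB, pz_sum_left]; exact Finset.sum_congr rfl fun i _ => pz_comm hB _ _

lemma pz_nonneg (hB : IsLeech B) (x : LV) : 0 ≤ pairZ B x x := by
  by_cases h : x = 0
  · simp [h]
  · exact (hB.2.2.1 x h).le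

lemma pz_eq_zero (hB : IsLeech B) {x : LV} (h : pairZ B x x = 0) : x = 0 := by
  by_contra hx
  have := hB.2.2.1 x hx
  omega

lemma pz_four (hB : IsLeech B) {x : LV} (hx : x ≠ 0) : 4 ≤ pairZ B x x := by
  have h1 := hB.2.2.1 x hx
  have h2 := hB.2.2.2.1 x
  have h3 := hB.2.2.2.2 x
  obtain ⟨r, hr⟩ := h2
  omega

lemma lt_four (hB : IsLeech B) {x : LV} (h : pairZ B x x < 4) : x = 0 := by
  by_contra hx
  have := pz_four hB hx
  omega

/-- unimodularity -/
lemma unimod (hB : IsLeech B) (n : ℤ) (v : LV) (h : ∀ w, n ∣ pairZ B v w) :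
    ∃ u : LV, v = n • u := by
  have hB' : Bᵀ = B := hB.1
  have h1 : ∀ i, n ∣ (B.mulVec v) i := by
    intro i
    have := h (Pi.single i 1)
    rw [pz_comm hB] at this
    simpa [pairZ] using this
  choose t ht using h1
  refine ⟨B.adjugate.mulVec t, ?_⟩
  have h2 : B.mulVec v = n • t := by ext i; simp [ht]
  have h3 : B.adjugate.mulVec (B.mulVec v) = v := by
    rw [mulVec_mulVec, adjugate_mul, hB.2.1]; simp
  rw [← h3, h2, mulVec_smul]

lemma exists_pair_one (hB : IsLeech B) (n : ℤ) (v : LV) (h : ¬ ∃ u : LV, v = n • u) :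
    ∃ w, ¬ n ∣ pairZ B v w := by
  by_contra hc; push Not at hc; exact h (unimod hB n v hc)

/-- congruent short vectors -/
lemma congr_short (hB : IsLeech B) {v w x : LV} (hv : pairZ B v v ≤ 8) (hw : pairZ B w w ≤ 8)
    (h : v = w + (2 : ℤ) • x) :
    v = w ∨ v = -w ∨ (pairZ B v v = 8 ∧ pairZ B w w = 8 ∧ pairZ B v w = 0) := by
  by_cases h1 : x = 0
  · left; simp [h, h1]
  by_cases h2 : w + x = 0
  · right; left
    rw [h, eq_neg_of_add_eq_zero_right h2]; ext i; simp; ring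
  right; right
  have h3 := pz_four hB h1
  have h4 := pz_four hB h2
  have h5 := pz_comm hB w x
  subst h
  simp only [pz_add_left, pz_add_right, pz_smul_left, pz_smul_right] at *
  rw [h5] at *
  refine ⟨?_, ?_, ?_⟩ <;> linarith

/-- A frame -/
structure IsFrame (B : Matrix (Fin 24) (Fin 24) ℤ) (f : Fin 24 → LV) : Prop where
  orth : ∀ i j, pairZ B (f i) (f j) = if i = j then 8 else 0
  cong : ∀ i j, ∃ w : LV, f i = f j + (2 : ℤ) • w

namespace IsFrame
variable {f : Fin 24 → LV}

lemma recon (hB : IsLeech B) (hf : IsFrame B f) (x : LV) :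
    (8 : ℤ) • x = ∑ i, pairZ B x (f i) • f i := by
  let M : Matrix (Fin 24) (Fin 24) ℤ := Matrix.of f
  have h1 : M * B * Mᵀ = (8 : ℤ) • (1 : Matrix (Fin 24) (Fin 24) ℤ) := by
    ext i j
    have := hf.orth i j
    simp only [pairZ] at this
    rw [Matrix.mul_assoc, Matrix.mul_apply']
    have e : (fun j_1 => (B * Mᵀ) j_1 j) = B.mulVec (f j) := by
      ext k; simp [Matrix.mul_apply, mulVec, dotProduct, M]
    rw [e]
    change f i ⬝ᵥ _ = _
    rw [this]; simp [Matrix.one_apply]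
  have h2 : Mᵀ * (M * B) = (8 : ℤ) • (1 : Matrix (Fin 24) (Fin 24) ℤ) := by
    let c : Matrix (Fin 24) (Fin 24) ℤ →+* Matrix (Fin 24) (Fin 24) ℚ := (Int.castRingHom ℚ).mapMatrix
    have hc : Function.Injective c := by
      intro a b hab
      ext i j
      have := congrFun (congrFun hab i) j
      simpa [c] using this
    apply hc
    have h3 : c (M * B) * ((1/8 : ℚ) • c Mᵀ) = 1 := by
      have := congrArg c h1
      rw [map_mul] at this
      rw [mul_smul_comm, this]
      ext i j; simp [c, Matrix.one_apply, Matrix.smul_apply, -zsmul_eq_mul, -zsmul_one]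
    have h4 := mul_eq_one_comm.mp h3
    rw [smul_mul_assoc, ← map_mul] at h4
    have : c (Mᵀ * (M * B)) = (8 : ℚ) • (1 : Matrix (Fin 24) (Fin 24) ℚ) := by
      rw [← h4, smul_smul]; norm_num
    rw [this]; ext i j; simp [c, Matrix.one_apply, Matrix.smul_apply, -zsmul_eq_mul, -zsmul_one]
  have h5 : (Mᵀ * (M * B)).mulVec x = (8 : ℤ) • x := by rw [h2]; ext i; simp [mulVec, dotProduct, Matrix.one_apply]
  rw [← h5, ← mulVec_mulVec, ← mulVec_mulVec]
  ext k
  simp only [mulVec, dotProduct, Finset.sum_apply, Pi.smul_apply, smul_eq_mul]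
  refine Finset.sum_congr rfl fun i _ => ?_
  rw [pz_comm hB x]
  simp only [pairZ, dotProduct, mulVec, M, Matrix.transpose_apply, Matrix.of_apply]
  ring

lemma inner (hB : IsLeech B) (hf : IsFrame B f) (x y : LV) :
    8 * pairZ B x y = ∑ i, pairZ B x (f i) * pairZ B y (f i) := by
  rw [← pz_smul_left, hf.recon hB x, pz_sum_left]
  refine Finset.sum_congr rfl fun i _ => ?_
  rw [pz_smul_left, pz_comm hB (f i)]

lemma half_add (hf : IsFrame B f) (i j : Fin 24) : ∃ w : LV, f i + f j = (2 : ℤ) • w := by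
  obtain ⟨w, hw⟩ := hf.cong i j
  exact ⟨f j + w, by rw [hw]; ext k; simp; ring⟩

lemma half_sub (hf : IsFrame B f) (i j : Fin 24) : ∃ w : LV, f i - f j = (2 : ℤ) • w := by
  obtain ⟨w, hw⟩ := hf.cong i j
  exact ⟨w, by rw [hw]; ext k; simp⟩

lemma parity (hf : IsFrame B f) (x : LV) (i j : Fin 24) :
    (2 : ℤ) ∣ pairZ B x (f i) - pairZ B x (f j) := by
  obtain ⟨w, hw⟩ := hf.cong i j
  exact ⟨pairZ B x w, by rw [hw]; simp only [pz_add_right, pz_smul_right]; ring⟩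

/-- negating some members -/
lemma flip (hf : IsFrame B f) (s : Fin 24 → ℤ) (hs : ∀ i, s i = 1 ∨ s i = -1) :
    IsFrame B (fun i => s i • f i) := by
  constructor
  · intro i j
    simp only [pz_smul_left, pz_smul_right, hf.orth]
    split_ifs with h
    · subst h; rcases hs i with h | h <;> simp [h]
    · simp
  · intro i j
    obtain ⟨w, hw⟩ := hf.cong i j
    obtain ⟨t, ht⟩ : ∃ t, f i = s i • f i + (2:ℤ) • t := by
      rcases hs i with h | h
      · exact ⟨0, by simp [h]⟩
      · exact ⟨f i, by rw [h]; ext k; simp; ring⟩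
    obtain ⟨t', ht'⟩ : ∃ t, f j = s j • f j + (2:ℤ) • t := by
      rcases hs j with h | h
      · exact ⟨0, by simp [h]⟩
      · exact ⟨f j, by rw [h]; ext k; simp; ring⟩
    refine ⟨t' + w - t, ?_⟩
    have : s i • f i = f i - (2:ℤ) • t := by rw [eq_sub_iff_add_eq, ← ht]
    show s i • f i = _
    rw [this, hw]; nth_rewrite 1 [ht']; ext k; simp; ring

/-- prescribe small vectors: `(s f_i + t f_j)/2`. -/
lemma pairvec (hf : IsFrame B f) {i j : Fin 24} (hij : i ≠ j) (s t : ℤ)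
    (hs : s = 1 ∨ s = -1) (ht : t = 1 ∨ t = -1) :
    ∃ w : LV, pairZ B w w = 4 ∧ (2:ℤ) • w = s • f i + t • f j ∧
      ∀ k, pairZ B w (f k) = 4 * ((if k = i then s else 0) + if k = j then t else 0) := by
  obtain ⟨w, hw⟩ : ∃ w : LV, s • f i + t • f j = (2:ℤ) • w := by
    obtain ⟨w1, h1⟩ := hf.half_add i j
    obtain ⟨w2, h2⟩ := hf.half_sub i j
    rcases hs with rfl | rfl <;> rcases ht with rfl | rfl
    · exact ⟨w1, by rw [← h1]; simp⟩
    · exact ⟨w2, by rw [← h2]; ext; simp; ring⟩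
    · exact ⟨-w2, by rw [smul_neg, ← h2]; ext; simp; ring⟩
    · exact ⟨-w1, by rw [smul_neg, ← h1]; ext; simp; ring⟩
  have hk : ∀ k, pairZ B w (f k) = 4 * ((if k = i then s else 0) + if k = j then t else 0) := by
    intro k
    have := congrArg (fun v => pairZ B v (f k)) hw
    simp only [pz_add_left, pz_smul_left, hf.orth] at this
    simp only [eq_comm (a := i), eq_comm (a := j)] at this
    split_ifs at * <;> linarith
  refine ⟨w, ?_, hw.symm, hk⟩
  have := congrArg (fun v => pairZ B w v) hw
  simp only [pz_add_right, pz_smul_right, hk] at this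
  simp [hij, hij.symm] at this
  rcases hs with rfl | rfl <;> rcases ht with rfl | rfl <;> linarith

end IsFrame
end lat

section lat2
variable {B : Matrix (Fin 24) (Fin 24) ℤ}

lemma conway_of_map (hB : IsLeech B) (L : LV →ₗ[ℤ] LV)
    (h : ∀ x y, pairZ B (L x) (L y) = pairZ B x y) :
    ∃ σ ∈ ConwayGroup B, ∀ x, σ.mulVec x = L x := by
  have h0 : ∀ x, (LinearMap.toMatrix' L).mulVec x = L x := fun x => by
    rw [← Matrix.toLin'_apply, Matrix.toLin'_toMatrix']
  have h1 : (LinearMap.toMatrix' L)ᵀ * B * LinearMap.toMatrix' L = B := by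
    ext i j
    have := h (Pi.single i 1) (Pi.single j 1)
    rw [← h0, ← h0] at this
    simp only [pairZ] at this
    rw [mulVec_mulVec, ← vecMul_transpose, ← dotProduct_mulVec, mulVec_mulVec, ← Matrix.mul_assoc] at this
    simpa using this
  refine ⟨_, ⟨?_, h1⟩, h0⟩
  have := congrArg Matrix.det h1
  rw [det_mul, det_mul, det_transpose, hB.2.1] at this
  exact IsUnit.of_mul_eq_one _ (by linarith)

/-- conjugacy, with a fixed vector -/
def CJ (B : Matrix (Fin 24) (Fin 24) ℤ) (a u v : LV) : Prop :=
  ∃ σ ∈ ConwayGroup B, σ.mulVec a = a ∧ σ.mulVec u = v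

lemma conway_pair {σ : Matrix (Fin 24) (Fin 24) ℤ} (h : σ ∈ ConwayGroup B) (x y : LV) :
    pairZ B (σ.mulVec x) (σ.mulVec y) = pairZ B x y := by
  conv_rhs => rw [← h.2]
  simp only [pairZ]
  rw [← mulVec_mulVec, ← mulVec_mulVec, dotProduct_mulVec x, vecMul_transpose]

lemma conway_mul {σ ρ : Matrix (Fin 24) (Fin 24) ℤ} (h : σ ∈ ConwayGroup B)
    (h' : ρ ∈ ConwayGroup B) : σ * ρ ∈ ConwayGroup B := by
  refine ⟨by rw [det_mul]; exact h.1.mul h'.1, ?_⟩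
  rw [transpose_mul]
  calc _ = ρᵀ * (σᵀ * B * σ) * ρ := by simp only [Matrix.mul_assoc]
    _ = B := by rw [h.2, h'.2]

lemma conway_inv {σ : Matrix (Fin 24) (Fin 24) ℤ} (h : σ ∈ ConwayGroup B) :
    σ⁻¹ ∈ ConwayGroup B := by
  have h1 : σ * σ⁻¹ = 1 := Matrix.mul_nonsing_inv _ h.1
  refine ⟨by rw [det_nonsing_inv]; exact h.1.ringInverse, ?_⟩
  conv_lhs => rw [← h.2]
  calc _ = (σ * σ⁻¹)ᵀ * B * (σ * σ⁻¹) := by rw [transpose_mul]; simp only [Matrix.mul_assoc]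
    _ = B := by rw [h1]; simp

lemma CJ.symm {a u v : LV} (h : CJ B a u v) : CJ B a v u := by
  obtain ⟨σ, hσ, h1, h2⟩ := h
  have h3 : ∀ x, σ⁻¹.mulVec (σ.mulVec x) = x := fun x => by
    rw [mulVec_mulVec, Matrix.nonsing_inv_mul _ hσ.1, one_mulVec]
  exact ⟨σ⁻¹, conway_inv hσ, by conv_lhs => rw [← h1, h3], by rw [← h2, h3]⟩

lemma CJ.trans {a u v w : LV} (h : CJ B a u v) (h' : CJ B a v w) : CJ B a u w := by
  obtain ⟨σ, hσ, h1, h2⟩ := h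
  obtain ⟨ρ, hρ, h3, h4⟩ := h'
  exact ⟨ρ * σ, conway_mul hρ hσ, by rw [← mulVec_mulVec, h1, h3], by rw [← mulVec_mulVec, h2, h4]⟩

lemma CJ.refl (a u : LV) : CJ B a u u :=
  ⟨1, ⟨by simp, by simp⟩, by simp, by simp⟩

namespace IsFrame
variable {f : Fin 24 → LV}

lemma eq_of_coords (hB : IsLeech B) (hf : IsFrame B f) {x y : LV}
    (h : ∀ i, pairZ B x (f i) = pairZ B y (f i)) : x = y := by
  have h1 := hf.recon hB x
  simp only [h] at h1
  rw [← hf.recon hB y] at h1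
  exact smul_right_injective _ (by norm_num : (8:ℤ) ≠ 0) h1

lemma eps (hB : IsLeech B) (hf : IsFrame B f) (c : Finset (Fin 24))
    (hc : ∀ x w : LV, (4:ℤ) ∣ ∑ i ∈ c, pairZ B x (f i) * pairZ B w (f i)) :
    ∃ σ ∈ ConwayGroup B, ∀ x i, pairZ B (σ.mulVec x) (f i) =
      if i ∈ c then - pairZ B x (f i) else pairZ B x (f i) := by
  have h1 : ∀ x, ∃ u : LV, ∑ i ∈ c, pairZ B x (f i) • f i = (4:ℤ) • u := by
    intro x
    refine unimod hB 4 _ fun w => ?_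
    rw [pz_sum_left]
    convert hc x w using 2 with i
    rw [pz_smul_left, pz_comm hB (f i)]
  choose u hu using h1
  have hinj := smul_right_injective LV (by norm_num : (4:ℤ) ≠ 0)
  have hco : ∀ x i, pairZ B (u x) (f i) = if i ∈ c then 2 * pairZ B x (f i) else 0 := by
    intro x i
    have := congrArg (fun v => pairZ B v (f i)) (hu x)
    simp only [pz_sum_left, pz_smul_left, hf.orth] at this
    simp at this
    split_ifs at * <;> linarith
  have hco2 : ∀ x i, pairZ B (x - u x) (f i) =
      if i ∈ c then - pairZ B x (f i) else pairZ B x (f i) := by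
    intro x i
    rw [pz_sub_left, hco]; split_ifs <;> ring
  let L : LV →ₗ[ℤ] LV :=
    { toFun := fun x => x - u x
      map_add' := fun x y => hf.eq_of_coords hB fun i => by
        rw [pz_add_left, hco2, hco2, hco2, pz_add_left]; split_ifs <;> ring
      map_smul' := fun n x => hf.eq_of_coords hB fun i => by
        simp only [RingHom.id_apply]
        rw [pz_smul_left, hco2, hco2, pz_smul_left]; split_ifs <;> ring }
  obtain ⟨σ, hσ, h2⟩ := conway_of_map hB L (fun x y => by
    have e1 := hf.inner hB (x - u x) (y - u y)
    have e2 := hf.inner hB x y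
    simp only [hco2] at e1
    have : ∑ i, ((if i ∈ c then - pairZ B x (f i) else pairZ B x (f i)) *
        if i ∈ c then - pairZ B y (f i) else pairZ B y (f i)) =
        ∑ i, pairZ B x (f i) * pairZ B y (f i) :=
      Finset.sum_congr rfl fun i _ => by split_ifs <;> ring
    rw [this] at e1
    change pairZ B (x - u x) (y - u y) = _
    linarith)
  refine ⟨σ, hσ, fun x i => ?_⟩
  rw [h2]; exact hco2 x i

lemma realize (hf : IsFrame B f) (y : LV) (m : Fin 24 → ℤ) (hm : Even (∑ i, m i)) :
    ∃ y' : LV, ∀ i, pairZ B y' (f i) = pairZ B y (f i) - 4 * m i := by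
  choose w hw using fun i => hf.cong i 0
  obtain ⟨r, hr⟩ := hm
  have h1 : ∑ i, m i • f i = (2:ℤ) • (r • f 0 + ∑ i, m i • w i) := by
    calc ∑ i, m i • f i = ∑ i, m i • (f 0 + (2:ℤ) • w i) :=
          Finset.sum_congr rfl fun i _ => by rw [← hw i]
      _ = (∑ i, m i) • f 0 + (2:ℤ) • ∑ i, m i • w i := by
          simp only [smul_add, Finset.sum_add_distrib, Finset.sum_smul, Finset.smul_sum]
          congr 1
          exact Finset.sum_congr rfl fun i _ => smul_comm _ _ _
      _ = _ := by rw [hr, smul_add, smul_smul]; congr 2; ring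
  refine ⟨y - (r • f 0 + ∑ i, m i • w i), fun i => ?_⟩
  have := congrArg (fun v => pairZ B v (f i)) h1
  simp only [pz_sum_left, pz_smul_left, hf.orth] at this
  simp only [mul_ite, mul_zero, Finset.sum_ite_eq', Finset.mem_univ, if_true] at this
  rw [pz_sub_left]; linarith

/-- the code word of an even vector -/
def cw (B : Matrix (Fin 24) (Fin 24) ℤ) (f : Fin 24 → LV) (y : LV) : Finset (Fin 24) :=
  Finset.univ.filter fun i => ¬ (4:ℤ) ∣ pairZ B y (f i)

def EvenC (B : Matrix (Fin 24) (Fin 24) ℤ) (f : Fin 24 → LV) (y : LV) : Prop :=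
  ∀ i, (2:ℤ) ∣ pairZ B y (f i)

lemma minwt (hB : IsLeech B) (hf : IsFrame B f) {y : LV} (hy : EvenC B f y)
    {j : Fin 24} (hj : j ∈ cw B f y) : 8 ≤ (cw B f y).card := by
  obtain ⟨y', h1⟩ : ∃ y' : LV, ∀ i, pairZ B y' (f i) ^ 2 = if i ∈ cw B f y then 4 else 0 := by
    have h2 : ∀ i, ∃ m : ℤ, pairZ B y (f i) = 4 * m + if i ∈ cw B f y then 2 else 0 := by
      intro i
      have := hy i
      simp only [cw, Finset.mem_filter, Finset.mem_univ, true_and]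
      split_ifs with h
      · exact ⟨pairZ B y (f i) / 4, by omega⟩
      · exact ⟨pairZ B y (f i) / 4, by omega⟩
    choose m hm using h2
    rcases Int.even_or_odd (∑ i, m i) with he | ho
    · obtain ⟨y', hy'⟩ := hf.realize y m he
      refine ⟨y', fun i => ?_⟩
      rw [hy', hm]; split_ifs <;> ring
    · obtain ⟨y', hy'⟩ := hf.realize y (m + Pi.single j 1) (by
        simp only [Pi.add_apply, Finset.sum_add_distrib, Finset.sum_pi_single', Finset.mem_univ, if_true]
        exact ho.add_one)
      refine ⟨y', fun i => ?_⟩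
      rw [hy', hm]
      by_cases h : i = j
      · subst h; simp [hj]
        ring
      · simp only [Pi.add_apply, Pi.single_eq_of_ne h]; split_ifs <;> ring
  have h2 := hf.inner hB y' y'
  simp only [← sq, h1] at h2
  simp at h2
  have h3 : y' ≠ 0 := by
    rintro rfl
    have := h1 j
    simp [hj] at this
  have := pz_four hB h3
  omega

lemma codeword (hB : IsLeech B) (hf : IsFrame B f) {y : LV} (hy : EvenC B f y) (x w : LV) :
    (4:ℤ) ∣ ∑ i ∈ cw B f y, pairZ B x (f i) * pairZ B w (f i) := by
  choose y' hy' using hy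
  have hmem : ∀ i, i ∈ cw B f y ↔ ¬ (2:ℤ) ∣ y' i := by
    intro i; simp only [cw, Finset.mem_filter, Finset.mem_univ, true_and, hy']; omega
  -- even times anything
  have key : ∀ x w : LV, EvenC B f x → (4:ℤ) ∣ ∑ i ∈ cw B f y, pairZ B x (f i) * pairZ B w (f i) := by
    intro x w hx
    choose x' hx' using hx
    by_cases hw : ∀ i, (2:ℤ) ∣ pairZ B w (f i)
    · refine Finset.dvd_sum fun i _ => ?_
      obtain ⟨t, ht⟩ := hw i
      exact ⟨x' i * t, by rw [hx', ht]; ring⟩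
    · have hw' : ∀ i, ∃ t, pairZ B w (f i) = 2 * t + 1 := by
        intro i
        push Not at hw
        obtain ⟨k, hk⟩ := hw
        have := hf.parity w i k
        exact ⟨pairZ B w (f i) / 2, by omega⟩
      have h1 := hf.inner hB x y
      simp only [hx', hy'] at h1 ⊢
      have h2 : (2:ℤ) ∣ ∑ i ∈ cw B f y, x' i * pairZ B w (f i) - ∑ i, x' i * y' i := by
        have e : ∑ i ∈ cw B f y, x' i * pairZ B w (f i) =
            ∑ i, if i ∈ cw B f y then x' i * pairZ B w (f i) else 0 := by
          simp
        rw [e, ← Finset.sum_sub_distrib]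
        refine Finset.dvd_sum fun i _ => ?_
        obtain ⟨t, ht⟩ := hw' i
        split_ifs with h
        · rw [hmem] at h
          obtain ⟨r, hr⟩ : ∃ r, y' i = 2 * r + 1 := ⟨y' i / 2, by omega⟩
          exact ⟨x' i * (t - r), by rw [ht, hr]; ring⟩
        · rw [hmem, not_not] at h
          obtain ⟨r, hr⟩ := h
          exact ⟨-x' i * r, by rw [hr]; ring⟩
      have h3 : ∑ i, 2 * x' i * (2 * y' i) = 4 * ∑ i, x' i * y' i := by
        rw [Finset.mul_sum]; exact Finset.sum_congr rfl fun i _ => by ring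
      have h4 : ∑ i ∈ cw B f y, 2 * x' i * pairZ B w (f i) =
          2 * ∑ i ∈ cw B f y, x' i * pairZ B w (f i) := by
        rw [Finset.mul_sum]; exact Finset.sum_congr rfl fun i _ => by ring
      rw [h4]; omega
  by_cases hx : EvenC B f x
  · exact key x w hx
  by_cases hw : EvenC B f w
  · have := key w x hw
    simpa [mul_comm] using this
  have odd : ∀ x, ¬ EvenC B f x → ∀ i, ∃ t, pairZ B x (f i) = 2 * t + 1 := by
    intro x hx i
    simp only [EvenC, not_forall] at hx
    obtain ⟨k, hk⟩ := hx
    have := hf.parity x i k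
    exact ⟨pairZ B x (f i) / 2, by omega⟩
  have h1 : EvenC B f (w - x) := by
    intro i
    obtain ⟨t, ht⟩ := odd x hx i
    obtain ⟨s, hs⟩ := odd w hw i
    rw [pz_sub_left]; omega
  have h2 := key (w - x) x h1
  have h3 : (4:ℤ) ∣ ∑ i ∈ cw B f y, pairZ B x (f i) * pairZ B x (f i) := by
    have e1 := hf.inner hB y y
    obtain ⟨r, hr⟩ := hB.2.2.2.1 y
    have e2 : (4:ℤ) ∣ ∑ i ∈ cw B f y, pairZ B x (f i) * pairZ B x (f i) - ∑ i, y' i * y' i := by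
      have e : ∑ i ∈ cw B f y, pairZ B x (f i) * pairZ B x (f i) =
            ∑ i, if i ∈ cw B f y then pairZ B x (f i) * pairZ B x (f i) else 0 := by
          simp
      rw [e, ← Finset.sum_sub_distrib]
      refine Finset.dvd_sum fun i _ => ?_
      obtain ⟨t, ht⟩ := odd x hx i
      split_ifs with h
      · rw [hmem] at h
        obtain ⟨r, hr⟩ : ∃ r, y' i = 2 * r + 1 := ⟨y' i / 2, by omega⟩
        exact ⟨t * t + t - r * r - r, by rw [ht, hr]; ring⟩
      · rw [hmem, not_not] at h
        obtain ⟨r, hr⟩ := h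
        exact ⟨- r * r, by rw [hr]; ring⟩
    simp only [hy'] at e1
    have h3 : ∑ i, 2 * y' i * (2 * y' i) = 4 * ∑ i, y' i * y' i := by
      rw [Finset.mul_sum]; exact Finset.sum_congr rfl fun i _ => by ring
    omega
  have h4 : ∑ i ∈ cw B f y, pairZ B x (f i) * pairZ B w (f i) =
      ∑ i ∈ cw B f y, pairZ B (w - x) (f i) * pairZ B x (f i) +
      ∑ i ∈ cw B f y, pairZ B x (f i) * pairZ B x (f i) := by
    rw [← Finset.sum_add_distrib]; exact Finset.sum_congr rfl fun i _ => by rw [pz_sub_left]; ring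
  rw [h4]; exact dvd_add h2 h3

end IsFrame
end lat2

section lat3
variable {B : Matrix (Fin 24) (Fin 24) ℤ}
namespace IsFrame
variable {f : Fin 24 → LV}

lemma mem_cw {y : LV} {i : Fin 24} : i ∈ cw B f y ↔ ¬ (4:ℤ) ∣ pairZ B y (f i) := by
  simp [cw]

lemma exists_sep (hB : IsLeech B) (hf : IsFrame B f) (j : Fin 24) (T : Finset (Fin 24))
    (hjT : j ∉ T)
    (hno : ∀ y, EvenC B f y → j ∈ cw B f y → ¬ cw B f y ⊆ insert j T) :
    ∃ y, EvenC B f y ∧ j ∈ cw B f y ∧ Disjoint (cw B f y) T := by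
  classical
  by_contra hc
  let W0 : AddSubgroup (Fin 24 → ZMod 2) :=
    { carrier := {p | ∃ y, EvenC B f y ∧ ∀ i, p i = ((pairZ B y (f i) / 2 : ℤ) : ZMod 2)}
      zero_mem' := ⟨0, fun i => by simp, fun i => by simp⟩
      add_mem' := by
        rintro p p' ⟨y, hy, hp⟩ ⟨y', hy', hp'⟩
        refine ⟨y + y', fun i => ?_, fun i => ?_⟩
        · rw [pz_add_left]; exact dvd_add (hy i) (hy' i)
        · rw [Pi.add_apply, hp, hp', pz_add_left, Int.add_ediv_of_dvd_left (hy i)]; push_cast; rfl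
      neg_mem' := by
        rintro p ⟨y, hy, hp⟩
        refine ⟨y, hy, fun i => ?_⟩
        rw [Pi.neg_apply, hp, ZMod.neg_eq_self_mod_two] }
  let W := AddSubgroup.toZModSubmodule 2 W0
  let e : Fin 24 → (W →ₗ[ZMod 2] ZMod 2) := fun i => (LinearMap.proj i).comp W.subtype
  have hz : ∀ n : ℤ, ((n : ℤ) : ZMod 2) = 0 ↔ (2:ℤ) ∣ n := fun n => ZMod.intCast_zmod_eq_zero_iff_dvd n 2
  have h1 : (⨅ t : T, LinearMap.ker (e t)) ≤ LinearMap.ker (e j) := by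
    rintro ⟨p, y, hy, hp⟩ hmem
    simp only [Submodule.mem_iInf, LinearMap.mem_ker] at hmem ⊢
    by_contra hne
    apply hc
    refine ⟨y, hy, ?_, ?_⟩
    · rw [mem_cw]; intro h4; apply hne
      change p j = 0
      rw [hp, hz]; omega
    · rw [Finset.disjoint_left]
      intro t ht htT
      have := hmem ⟨t, htT⟩
      change p t = 0 at this
      rw [hp, hz] at this
      rw [mem_cw] at ht
      have := hy t
      omega
  obtain ⟨c, hc2⟩ := (Submodule.mem_span_range_iff_exists_fun (ZMod 2)).1 (mem_span_of_iInf_ker_le_ker h1)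
  let d : Finset (Fin 24) := insert j (T.filter fun t => ∃ h : t ∈ T, c ⟨t, h⟩ = 1)
  have hjd : j ∈ d := Finset.mem_insert_self _ _
  have hdT : d ⊆ insert j T := Finset.insert_subset_insert _ (Finset.filter_subset _ _)
  have hd : ∀ y, EvenC B f y → (4:ℤ) ∣ ∑ i ∈ d, pairZ B y (f i) := by
    intro y hy
    have h2 : (2:ℤ) ∣ ∑ i ∈ d, pairZ B y (f i) / 2 := by
      rw [← hz]
      have h3 := LinearMap.congr_fun hc2 ⟨fun i => ((pairZ B y (f i) / 2 : ℤ) : ZMod 2), y, hy, fun _ => rfl⟩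
      simp only [LinearMap.coe_sum, Finset.sum_apply, LinearMap.smul_apply, smul_eq_mul] at h3
      change ∑ t : T, c t * ((pairZ B y (f t) / 2 : ℤ) : ZMod 2) = ((pairZ B y (f j) / 2 : ℤ) : ZMod 2) at h3
      rw [Finset.sum_insert (by simp [hjT])]
      push_cast
      rw [← h3, Finset.sum_filter, ← Finset.sum_coe_sort T, ← Finset.sum_add_distrib]
      refine Finset.sum_eq_zero fun t _ => ?_
      have : c t = 0 ∨ c t = 1 := by
        generalize c t = x; revert x; decide
      rcases this with h | h
      · simp [h]
      · simp only [h, t.2, one_mul, Subtype.coe_eta, exists_prop, and_self, if_true]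
        exact CharTwo.add_self_eq_zero _
    obtain ⟨r, hr⟩ := h2
    refine ⟨r, ?_⟩
    rw [show (4:ℤ) * r = 2 * (2 * r) by ring, ← hr, Finset.mul_sum]
    exact Finset.sum_congr rfl fun i _ => (Int.mul_ediv_cancel' (hy i)).symm
  -- produce h
  have hpar : ∀ w, EvenC B f w ∨ ∀ i, ∃ t, pairZ B w (f i) = 2 * t + 1 := by
    intro w
    by_cases hw : EvenC B f w
    · exact Or.inl hw
    · right; intro i
      simp only [EvenC, not_forall] at hw
      obtain ⟨k, hk⟩ := hw
      have := hf.parity w i k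
      exact ⟨pairZ B w (f i) / 2, by omega⟩
  obtain ⟨h, s, hs, hh⟩ : ∃ (h : LV) (s : ℤ), (s = 0 ∨ s = 2) ∧ ∑ i ∈ d, f i - s • f j = (4:ℤ) • h := by
    by_cases hx : ∃ x0, (∀ i, ∃ t, pairZ B x0 (f i) = 2 * t + 1) ∧ ¬ (4:ℤ) ∣ ∑ i ∈ d, pairZ B x0 (f i)
    · obtain ⟨x0, hx0, hx1⟩ := hx
      obtain ⟨h, hh⟩ := unimod hB 4 (∑ i ∈ d, f i - (2:ℤ) • f j) (fun w => by
        rw [pz_sub_left, pz_sum_left, pz_smul_left]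
        simp only [pz_comm hB (f _)]
        rcases hpar w with hw | hw
        · have := hd w hw; have := hw j; omega
        · have e1 : EvenC B f (w + x0) := fun i => by
            obtain ⟨t, ht⟩ := hw i; obtain ⟨t', ht'⟩ := hx0 i
            rw [pz_add_left]; omega
          have e2 := hd _ e1
          have e3 : EvenC B f (x0 + x0) := fun i => by rw [pz_add_left]; omega
          have e4 := hd _ e3
          simp only [pz_add_left, Finset.sum_add_distrib] at e2 e4
          obtain ⟨t, ht⟩ := hw j
          omega)
      exact ⟨h, 2, Or.inr rfl, hh⟩
    · push Not at hx
      obtain ⟨h, hh⟩ := unimod hB 4 (∑ i ∈ d, f i - (0:ℤ) • f j) (fun w => by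
        rw [pz_sub_left, pz_sum_left, pz_smul_left]
        simp only [pz_comm hB (f _)]
        rcases hpar w with hw | hw
        · have := hd w hw; omega
        · have := hx w hw; omega)
      exact ⟨h, 0, Or.inl rfl, hh⟩
  have hco : ∀ k, pairZ B h (f k) = (if k ∈ d then 2 else 0) - if k = j then 2 * s else 0 := by
    intro k
    have := congrArg (fun v => pairZ B v (f k)) hh
    simp only [pz_sub_left, pz_sum_left, pz_smul_left, hf.orth, Finset.sum_ite_eq'] at this
    simp only [eq_comm (a := j)] at this
    split_ifs at * <;> linarith
  have hcw : cw B f h = d := by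
    ext k
    rw [mem_cw, hco]
    by_cases hk : k ∈ d
    · simp only [hk, if_true, iff_true]
      rcases hs with rfl | rfl <;> split_ifs <;> omega
    · have : k ≠ j := fun e => hk (e ▸ hjd)
      simp [hk, this]
  refine hno h (fun k => ?_) (hcw ▸ hjd) (hcw ▸ hdT)
  rw [hco]; rcases hs with rfl | rfl <;> split_ifs <;> omega

end IsFrame
open IsFrame

def Frames (B : Matrix (Fin 24) (Fin 24) ℤ) : Prop :=
  ∀ g : LV, pairZ B g g = 8 → ∃ f, IsFrame B f ∧
    ∀ h x : LV, pairZ B h h = 8 → h = g + (2:ℤ) • x → ∃ i, ∃ s : ℤ, (s = 1 ∨ s = -1) ∧ h = s • f i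

/-- frame adapted to an orthogonal pair -/
lemma frame_pair (hB : IsLeech B) (hF : Frames B) {u v : LV} (hu : pairZ B u u = 4)
    (hv : pairZ B v v = 4) (huv : pairZ B u v = 0) :
    ∃ f, IsFrame B f ∧ ∃ i j : Fin 24, i ≠ j ∧ ∃ s t : ℤ, (s = 1 ∨ s = -1) ∧ (t = 1 ∨ t = -1) ∧
      u + v = s • f i ∧ u - v = t • f j ∧
      (∀ k, pairZ B u (f k) = (if k = i then 4 * s else 0) + if k = j then 4 * t else 0) ∧
      (∀ k, pairZ B v (f k) = (if k = i then 4 * s else 0) - if k = j then 4 * t else 0) := by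
  have hvu := pz_comm hB v u
  obtain ⟨f, hf, h1⟩ := hF (u + v) (by simp [hu, hv, huv, hvu])
  obtain ⟨i, s, hs, hi⟩ := h1 (u + v) 0 (by simp [hu, hv, huv, hvu]) (by simp)
  obtain ⟨j, t, ht, hj⟩ := h1 (u - v) (-v) (by simp [hu, hv, huv, hvu]) (by ext; simp; ring)
  have e1 : ∀ k, pairZ B u (f k) + pairZ B v (f k) = if k = i then 8 * s else 0 := by
    intro k
    rw [← pz_add_left, hi, pz_smul_left, hf.orth]
    simp only [eq_comm (a := i)]; split_ifs <;> ring
  have e2 : ∀ k, pairZ B u (f k) - pairZ B v (f k) = if k = j then 8 * t else 0 := by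
    intro k
    rw [← pz_sub_left, hj, pz_smul_left, hf.orth]
    simp only [eq_comm (a := j)]; split_ifs <;> ring
  refine ⟨f, hf, i, j, ?_, s, t, hs, ht, hi, hj, ?_, ?_⟩
  · rintro rfl
    have := congrArg₂ (pairZ B) hi hj
    simp only [pz_add_left, pz_sub_right, pz_smul_left, pz_smul_right, hu, hv, huv, hvu, hf.orth, if_true] at this
    rcases hs with rfl | rfl <;> rcases ht with rfl | rfl <;> omega
  · intro k; have := e1 k; have := e2 k; split_ifs at * <;> linarith
  · intro k; have := e1 k; have := e2 k; split_ifs at * <;> linarith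

lemma no_cw (hB : IsLeech B) {f : Fin 24 → LV} (hf : IsFrame B f) {a : LV} {i j : Fin 24}
    (hae : EvenC B f a) (haj : pairZ B a (f j) = 0) {N : Finset (Fin 24)}
    (hsum : 4 * (cw B f a).card + 16 * (N \ cw B f a).card ≤ 32) :
    ∀ y, EvenC B f y → j ∈ cw B f y → ¬ cw B f y ⊆ insert j (insert i N) := by
  have hO1 : ∀ k, k ∈ cw B f a ↔ ¬ (4:ℤ) ∣ pairZ B a (f k) := fun k => mem_cw
  have hO2 : ∀ k, k ∈ cw B f a → 8 ≤ (cw B f a).card := fun k hk => hf.minwt hB hae hk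
  generalize cw B f a = O at *
  intro h hh hjh hsub
  have h8 := hf.minwt hB hh hjh
  by_cases hO : O = ∅
  · have h1 := Finset.card_le_card hsub
    have h2 := Finset.card_insert_le j (insert i N)
    have h3 := Finset.card_insert_le i N
    rw [hO] at hsum
    simp at hsum
    omega
  · obtain ⟨k, hk⟩ := Finset.nonempty_iff_ne_empty.2 hO
    have hO8 : 8 ≤ O.card := hO2 k hk
    have hNO : N \ O = ∅ := by rw [← Finset.card_eq_zero]; omega
    have hNO' : N ⊆ O := by rwa [Finset.sdiff_eq_empty_iff_subset] at hNO
    have hsub2 : cw B f h ⊆ insert j (insert i O) :=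
      hsub.trans (Finset.insert_subset_insert _ (Finset.insert_subset_insert _ hNO'))
    have hs3 : cw B f (h + a) ⊆ insert j (insert i (O \ cw B f h)) := by
      intro k hk
      by_cases hkh : k ∈ cw B f h
      · by_cases hkO : k ∈ O
        · exfalso
          have e1 := mem_cw.1 hk; have e2 := mem_cw.1 hkh
          have e3 : ¬ (4:ℤ) ∣ pairZ B a (f k) := (hO1 k).1 hkO
          rw [pz_add_left] at e1
          have := hh k; have := hae k
          omega
        · have := hsub2 hkh
          simp only [Finset.mem_insert] at this ⊢
          tauto
      · have hkO : k ∈ O := by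
          by_contra hkO
          have e1 := mem_cw.1 hk
          have e2 := not_not.1 (mt mem_cw.2 hkh)
          have e3 : (4:ℤ) ∣ pairZ B a (f k) := not_not.1 (mt (hO1 k).2 hkO)
          rw [pz_add_left] at e1
          omega
        simp [hkO, hkh]
    have hj3 : j ∈ cw B f (h + a) := by
      rw [mem_cw, pz_add_left, haj, add_zero]; exact mem_cw.1 hjh
    have h9 := hf.minwt hB (y := h + a) (fun k => by rw [pz_add_left]; exact dvd_add (hh k) (hae k)) hj3
    have h10 := Finset.card_le_card hs3
    have h11 := Finset.card_insert_le j (insert i (O \ cw B f h))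
    have h12 := Finset.card_insert_le i (O \ cw B f h)
    have h13 : (cw B f h).card ≤ (O ∩ cw B f h).card + 2 := by
      have : cw B f h ⊆ insert j (insert i (O ∩ cw B f h)) := by
        intro k hk
        have := hsub2 hk
        simp only [Finset.mem_insert, Finset.mem_inter] at this ⊢
        tauto
      have h1 := Finset.card_le_card this
      have h2 := Finset.card_insert_le j (insert i (O ∩ cw B f h))
      have h3 := Finset.card_insert_le i (O ∩ cw B f h)
      omega
    have h14 := Finset.card_sdiff_add_card_inter O (cw B f h)
    omega

lemma swap (hB : IsLeech B) (hF : Frames B) {a u v : LV} (ha : pairZ B a a = 4 ∨ a = 0)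
    (hu : pairZ B u u = 4) (hv : pairZ B v v = 4) (huv : pairZ B u v = 0)
    (hau : pairZ B a u = pairZ B a v) : CJ B a u v := by
  classical
  obtain ⟨f, hf, i, j, hij, s, t, hs, ht, hi, hj, huc, hvc⟩ := frame_pair hB hF hu hv huv
  have haj : pairZ B a (f j) = 0 := by
    have := congrArg (pairZ B a) hj
    rw [pz_sub_right, pz_smul_right, hau] at this
    rcases ht with rfl | rfl <;> linarith
  have hae : EvenC B f a := fun k => by
    have := hf.parity a k j
    rwa [haj, sub_zero] at this
  let N : Finset (Fin 24) := Finset.univ.filter fun k => pairZ B a (f k) ≠ 0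
  have hN : ∀ k, k ∈ N ↔ pairZ B a (f k) ≠ 0 := fun k => by simp [N]
  let O := cw B f a
  have hsum : 4 * O.card + 16 * (N \ O).card ≤ 32 := by
    have h1 := hf.inner hB a a
    have h2 : ∑ k, (((if k ∈ O then 4 else 0) + if k ∈ N \ O then 16 else 0) : ℤ) ≤
        ∑ k, pairZ B a (f k) * pairZ B a (f k) := by
      refine Finset.sum_le_sum fun k _ => ?_
      simp only [Finset.mem_sdiff, hN]
      have h3 := hae k
      by_cases hk : k ∈ O
      · simp only [hk, if_true, not_true, and_false, if_false]
        have : ¬ (4:ℤ) ∣ pairZ B a (f k) := mem_cw.1 hk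
        rcases le_or_gt (pairZ B a (f k)) 0 with h | h
        · nlinarith [show pairZ B a (f k) ≤ -2 by omega]
        · nlinarith [show pairZ B a (f k) ≥ 2 by omega]
      · simp only [hk, if_false, not_false_eq_true, and_true]
        have : (4:ℤ) ∣ pairZ B a (f k) := by_contra fun h => hk (mem_cw.2 h)
        split_ifs with h0
        · rcases le_or_gt (pairZ B a (f k)) 0 with h | h
          · nlinarith [show pairZ B a (f k) ≤ -4 by omega]
          · nlinarith [show pairZ B a (f k) ≥ 4 by omega]
        · nlinarith
    rw [Finset.sum_add_distrib] at h2
    simp only [Finset.sum_ite_mem, Finset.univ_inter, Finset.sum_const, nsmul_eq_mul] at h2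
    have : pairZ B a a ≤ 4 := by rcases ha with h | h <;> simp [h]
    omega
  obtain ⟨y, hy, hyj, hyT⟩ := hf.exists_sep hB j (insert i N) (by simp [hij.symm, hN, haj]) (no_cw hB hf hae haj hsum)
  obtain ⟨σ, hσ, hσ2⟩ := hf.eps hB (cw B f y) (hf.codeword hB hy)
  have hd : ∀ k, k ∈ cw B f y → k ≠ i ∧ pairZ B a (f k) = 0 := by
    intro k hk
    have := Finset.disjoint_left.1 hyT hk
    simpa [hN] using this
  refine ⟨σ, hσ, hf.eq_of_coords hB fun k => ?_, hf.eq_of_coords hB fun k => ?_⟩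
  · rw [hσ2]; split_ifs with h
    · rw [(hd k h).2]; ring
    · rfl
  · rw [hσ2, huc, hvc]
    by_cases h : k ∈ cw B f y
    · simp [h, (hd k h).1]
    · have : k ≠ j := fun e => h (e ▸ hyj)
      simp [h, this]
end lat3

section lat4
variable {B : Matrix (Fin 24) (Fin 24) ℤ}
open IsFrame

lemma pair_half (hB : IsLeech B) {f : Fin 24 → LV} {w x : LV} {i j : Fin 24} {s t : ℤ}
    (h : (2:ℤ) • w = s • f i + t • f j) :
    2 * pairZ B w x = s * pairZ B x (f i) + t * pairZ B x (f j) := by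
  rw [← pz_smul_left, h, pz_add_left, pz_smul_left, pz_smul_left, pz_comm hB x, pz_comm hB x]

lemma coord_sq_le (hB : IsLeech B) {f : Fin 24 → LV} (hf : IsFrame B f) (x : LV) (i : Fin 24) :
    pairZ B x (f i) ^ 2 ≤ 8 * pairZ B x x := by
  rw [hf.inner hB x x]
  simp only [← sq]
  exact Finset.single_le_sum (f := fun i => pairZ B x (f i) ^ 2) (fun k _ => sq_nonneg _) (Finset.mem_univ i)

lemma conn (hB : IsLeech B) (hF : Frames B) {f : Fin 24 → LV} (hf : IsFrame B f) (i1 i2 : Fin 24)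
    {a v v' : LV} (ha : pairZ B a a = 4 ∨ a = 0) (hv : pairZ B v v = 4) (hv' : pairZ B v' v' = 4)
    (hav : pairZ B a v = 0) (hav' : pairZ B a v' = 0)
    (ca : ∀ k, k ≠ i1 → k ≠ i2 → pairZ B a (f k) = 0)
    (cv : ∀ k, k ≠ i1 → k ≠ i2 → pairZ B v (f k) = 0) : CJ B a v' v := by
  classical
  obtain ⟨i, hi, j, hj, hij, he⟩ := Finset.exists_ne_map_eq_of_card_lt_of_maps_to
    (s := (Finset.univ.erase i1).erase i2) (t := Finset.range 6)
    (f := fun k => (pairZ B v' (f k)).natAbs) (by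
      have h1 := Finset.pred_card_le_card_erase (s := Finset.univ.erase i1) (a := i2)
      have h2 := Finset.pred_card_le_card_erase (s := (Finset.univ : Finset (Fin 24))) (a := i1)
      simp only [Finset.card_univ, Fintype.card_fin, Finset.card_range] at *
      omega) (fun k _ => by
      have := coord_sq_le hB hf v' k
      rw [hv'] at this
      simp only [Finset.coe_range, Set.mem_Iio]
      by_contra h
      have h6 : 6 ≤ |pairZ B v' (f k)| := by rw [Int.abs_eq_natAbs]; omega
      nlinarith [sq_abs (pairZ B v' (f k))])
  simp only [Finset.mem_erase, Finset.mem_univ, and_true] at hi hj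
  obtain ⟨t, ht, hvt⟩ : ∃ t : ℤ, (t = 1 ∨ t = -1) ∧ pairZ B v' (f i) + t * pairZ B v' (f j) = 0 := by
    rcases Int.natAbs_eq_natAbs_iff.1 he with h | h
    · exact ⟨-1, Or.inr rfl, by rw [h]; ring⟩
    · exact ⟨1, Or.inl rfl, by rw [h]; ring⟩
  obtain ⟨w, hw, hw2, -⟩ := hf.pairvec hij 1 t (Or.inl rfl) ht
  have e1 := pair_half hB (x := v') hw2
  have e2 := pair_half hB (x := v) hw2
  have e3 := pair_half hB (x := a) hw2
  rw [cv i hi.2 hi.1, cv j hj.2 hj.1] at e2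
  rw [ca i hi.2 hi.1, ca j hj.2 hj.1] at e3
  have c1 := pz_comm hB w v'
  have c2 := pz_comm hB w a
  exact (swap hB hF ha hv' hw (by linarith) (by linarith)).trans
    (swap hB hF ha hw hv (by linarith) (by linarith))

lemma trans2 (hB : IsLeech B) (hF : Frames B) {g : LV} (hg : pairZ B g g = 8) {u v : LV}
    (hu : pairZ B u u = 4) (hv : pairZ B v v = 4) : CJ B 0 u v := by
  obtain ⟨f, hf, -⟩ := hF g hg
  obtain ⟨w, hw, hw2, hw3⟩ := hf.pairvec (i := 0) (j := 1) (by decide) 1 1 (Or.inl rfl) (Or.inl rfl)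
  have key : ∀ u, pairZ B u u = 4 → CJ B 0 u w := fun u hu =>
    conn hB hF hf 0 1 (Or.inr rfl) hw hu (by simp) (by simp) (by simp)
      (fun k h0 h1 => by rw [hw3]; simp [h0, h1])
  exact (key u hu).trans (key v hv).symm

lemma decomp4 (hF : Frames B) {g : LV} (hg : pairZ B g g = 8) :
    ∃ u v : LV, pairZ B u u = 4 ∧ pairZ B v v = 4 ∧ pairZ B u v = 0 ∧ g = u + v := by
  obtain ⟨f, hf, h⟩ := hF g hg
  obtain ⟨i, s, hs, hi⟩ := h g 0 hg (by simp)
  obtain ⟨j, hj⟩ : ∃ j, i ≠ j := ⟨i + 1, by simp⟩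
  obtain ⟨u, hu, hu2, hu3⟩ := hf.pairvec hj s 1 hs (Or.inl rfl)
  obtain ⟨v, hv, hv2, hv3⟩ := hf.pairvec hj s (-1) hs (Or.inr rfl)
  refine ⟨u, v, hu, hv, ?_, ?_⟩
  · have := congrArg (pairZ B u) hv2
    simp only [pz_smul_right, pz_add_right, hu3, hj, hj.symm, if_true, if_false] at this
    rcases hs with rfl | rfl <;> linarith
  · apply smul_right_injective LV (by norm_num : (2:ℤ) ≠ 0)
    simp only [smul_add, hu2, hv2, hi]
    ext k; simp; ring

lemma trans4 (hB : IsLeech B) (hF : Frames B) {g g' : LV} (hg : pairZ B g g = 8)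
    (hg' : pairZ B g' g' = 8) : CJ B 0 g' g := by
  obtain ⟨u, v, hu, hv, huv, rfl⟩ := decomp4 hF hg
  obtain ⟨u', v', hu', hv', huv', rfl⟩ := decomp4 hF hg'
  obtain ⟨σ, hσ, -, h1⟩ := trans2 hB hF hg hu' hu
  obtain ⟨f, hf, i, j, hij, s, t, -, -, -, -, cu, cv⟩ := frame_pair hB hF hu hv huv
  obtain ⟨ρ, hρ, h2, h3⟩ := conn hB hF hf i j (a := u) (v := v) (v' := σ.mulVec v') (Or.inl hu) hv
    (by rw [conway_pair hσ, hv']) huv (by rw [← h1, conway_pair hσ, huv'])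
    (fun k h h' => by rw [cu]; simp [h, h']) (fun k h h' => by rw [cv]; simp [h, h'])
  exact ⟨ρ * σ, conway_mul hρ hσ, by simp, by rw [← mulVec_mulVec, mulVec_add, h1, mulVec_add, h2, h3]⟩

/-- zeros of an even vector -/
lemma zeros (hB : IsLeech B) {f : Fin 24 → LV} (hf : IsFrame B f) {u : LV} (hu : pairZ B u u ≤ 6)
    (he : EvenC B f u) : 12 ≤ (Finset.univ.filter fun k => pairZ B u (f k) = 0).card := by
  have h1 := hf.inner hB u u
  have h2 : ∑ k, (4 - (if pairZ B u (f k) = 0 then 4 else 0) : ℤ) ≤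
      ∑ k, pairZ B u (f k) * pairZ B u (f k) := by
    refine Finset.sum_le_sum fun k _ => ?_
    have := he k
    split_ifs with h
    · simp [h]
    · rcases le_or_gt (pairZ B u (f k)) 0 with h' | h'
      · nlinarith [show pairZ B u (f k) ≤ -2 by omega]
      · nlinarith [show pairZ B u (f k) ≥ 2 by omega]
  rw [Finset.sum_sub_distrib, ← Finset.sum_filter] at h2
  simp only [Finset.sum_const, Finset.card_univ, Fintype.card_fin, nsmul_eq_mul] at h2
  push_cast at h2
  omega

lemma quad (hB : IsLeech B) {f : Fin 24 → LV} (hf : IsFrame B f) {i j k l : Fin 24} (hij : i ≠ j)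
    (hkl : k ≠ l) (hik : i ≠ k) (hil : i ≠ l) (hjk : j ≠ k) (hjl : j ≠ l) :
    ∃ y : LV, pairZ B y y = 8 ∧ ∀ x, 2 * pairZ B x y =
      pairZ B x (f i) + pairZ B x (f j) + pairZ B x (f k) + pairZ B x (f l) := by
  obtain ⟨u, hu, hu2, hu3⟩ := hf.pairvec hij 1 1 (Or.inl rfl) (Or.inl rfl)
  obtain ⟨v, hv, hv2, hv3⟩ := hf.pairvec hkl 1 1 (Or.inl rfl) (Or.inl rfl)
  have huv := pair_half hB (x := u) hv2
  have c := pz_comm hB v u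
  simp only [hu3, hik.symm, hil.symm, hjk.symm, hjl.symm, if_false] at huv
  refine ⟨u + v, ?_, fun x => ?_⟩
  · simp only [pz_add_left, pz_add_right]; linarith
  · have e1 := pair_half hB (x := x) hu2
    have e2 := pair_half hB (x := x) hv2
    rw [pz_add_right, pz_comm hB x u, pz_comm hB x v]; linarith

lemma quad0 (hB : IsLeech B) {f : Fin 24 → LV} (hf : IsFrame B f) {u : LV} (hu : pairZ B u u ≤ 6)
    (he : EvenC B f u) (i : Fin 24) (hi : pairZ B u (f i) ≠ 0) :
    ∃ y : LV, pairZ B y y = 8 ∧ 2 * pairZ B u y = pairZ B u (f i) := by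
  obtain ⟨j, k, l, hj, hk, hl, h1, h2, h3⟩ := Finset.two_lt_card_iff.1
    (show 2 < _ from lt_of_lt_of_le (by norm_num) (zeros hB hf hu he))
  simp only [Finset.mem_filter, Finset.mem_univ, true_and] at hj hk hl
  obtain ⟨y, hy, hy2⟩ := quad hB hf (i := i) (j := j) (k := k) (l := l) (fun e => hi (e ▸ hj)) h3
    (fun e => hi (e ▸ hk)) (fun e => hi (e ▸ hl)) h1 h2
  exact ⟨y, hy, by rw [hy2, hj, hk, hl]; ring⟩

lemma odd_frame (hB : IsLeech B) (hF : Frames B) {g : LV} (hg : pairZ B g g = 8) {u : LV}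
    (hu0 : u ≠ 0) (hu : pairZ B u u ≤ 6) :
    ∃ f, IsFrame B f ∧ ∀ i, ¬ (2:ℤ) ∣ pairZ B u (f i) := by
  by_cases h : ∀ y, pairZ B y y = 8 → (2:ℤ) ∣ pairZ B u y
  · exfalso
    have step : ∀ f, IsFrame B f → ∀ i, (4:ℤ) ∣ pairZ B u (f i) := by
      intro f hf i
      have he : EvenC B f u := fun i => h _ (by rw [hf.orth]; simp)
      by_cases h0 : pairZ B u (f i) = 0
      · simp [h0]
      · obtain ⟨y, hy, hy2⟩ := quad0 hB hf hu he i h0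
        have := h y hy
        omega
    obtain ⟨f, hf, -⟩ := hF g hg
    have he : EvenC B f u := fun i => h _ (by rw [hf.orth]; simp)
    obtain ⟨i, hi⟩ : ∃ i, pairZ B u (f i) ≠ 0 := by
      by_contra hc; push Not at hc
      exact hu0 (hf.eq_of_coords hB fun i => by rw [hc]; simp)
    obtain ⟨y, hy, hy2⟩ := quad0 hB hf hu he i hi
    obtain ⟨f', hf', h3⟩ := hF y hy
    obtain ⟨m, s, hs, rfl⟩ := h3 y 0 hy (by simp)
    have h4 := step f' hf' m
    have h5 := coord_sq_le hB hf u i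
    rw [pz_smul_right] at hy2
    have h6 : (8:ℤ) ∣ pairZ B u (f i) := by rcases hs with rfl | rfl <;> omega
    rcases le_or_gt (pairZ B u (f i)) 0 with h' | h'
    · nlinarith [show pairZ B u (f i) ≤ -8 by omega]
    · nlinarith [show pairZ B u (f i) ≥ 8 by omega]
  · push Not at h
    obtain ⟨y, hy, hy2⟩ := h
    obtain ⟨f, hf, h3⟩ := hF y hy
    obtain ⟨m, s, hs, rfl⟩ := h3 y 0 hy (by simp)
    refine ⟨f, hf, fun i => ?_⟩
    have := hf.parity u i m
    rw [pz_smul_right] at hy2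
    rcases hs with rfl | rfl <;> omega

lemma odd_shape (hB : IsLeech B) {f : Fin 24 → LV} (hf : IsFrame B f) {u : LV}
    (hu : pairZ B u u ≤ 6) (ho : ∀ i, ¬ (2:ℤ) ∣ pairZ B u (f i)) :
    (∀ i, |pairZ B u (f i)| = 1 ∨ |pairZ B u (f i)| = 3 ∨ |pairZ B u (f i)| = 5) ∧
    pairZ B u u = 3 + (Finset.univ.filter fun k => |pairZ B u (f k)| = 3).card +
      3 * (Finset.univ.filter fun k => |pairZ B u (f k)| = 5).card := by
  have h1 : ∀ i, |pairZ B u (f i)| = 1 ∨ |pairZ B u (f i)| = 3 ∨ |pairZ B u (f i)| = 5 := by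
    intro i
    have h5 := coord_sq_le hB hf u i
    have h6 : |pairZ B u (f i)| ≤ 6 := by
      by_contra hc; nlinarith [sq_abs (pairZ B u (f i)), show 7 ≤ |pairZ B u (f i)| by omega]
    have := ho i
    rcases abs_choice (pairZ B u (f i)) with h | h <;> have := abs_nonneg (pairZ B u (f i)) <;> omega
  refine ⟨h1, ?_⟩
  have h2 := hf.inner hB u u
  have h3 : ∑ k, pairZ B u (f k) * pairZ B u (f k) = ∑ k, (1 + (if |pairZ B u (f k)| = 3 then 8 else 0)
      + (if |pairZ B u (f k)| = 5 then 24 else 0) : ℤ) := by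
    refine Finset.sum_congr rfl fun k _ => ?_
    rw [← abs_mul_abs_self]
    rcases h1 k with h | h | h <;> rw [h] <;> norm_num
  rw [h3, Finset.sum_add_distrib, Finset.sum_add_distrib, ← Finset.sum_filter, ← Finset.sum_filter] at h2
  simp only [Finset.sum_const, Finset.card_univ, Fintype.card_fin, nsmul_eq_mul] at h2
  push_cast at h2
  omega

lemma odd4 (hB : IsLeech B) {f : Fin 24 → LV} (hf : IsFrame B f) {u : LV}
    (hu : pairZ B u u = 4) (ho : ∀ i, ¬ (2:ℤ) ∣ pairZ B u (f i)) :
    ∃ p, |pairZ B u (f p)| = 3 ∧ ∀ k, k ≠ p → |pairZ B u (f k)| = 1 := by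
  obtain ⟨h1, h2⟩ := odd_shape hB hf (by omega) ho
  have h5 : (Finset.univ.filter fun k => |pairZ B u (f k)| = 5).card = 0 := by omega
  have h3 : (Finset.univ.filter fun k => |pairZ B u (f k)| = 3).card = 1 := by omega
  obtain ⟨p, hp⟩ := Finset.card_eq_one.1 h3
  have hp' : ∀ k, |pairZ B u (f k)| = 3 ↔ k = p := fun k => by
    have := Finset.ext_iff.1 hp k; simpa using this
  refine ⟨p, (hp' p).2 rfl, fun k hk => ?_⟩
  rcases h1 k with h | h | h
  · exact h
  · exact absurd ((hp' k).1 h) hk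
  · rw [Finset.card_eq_zero] at h5
    have := Finset.ext_iff.1 h5 k
    simp [h] at this

lemma decomp3 (hB : IsLeech B) (hF : Frames B) {g : LV} (hg : pairZ B g g = 8) {u : LV}
    (hu : pairZ B u u = 6) : ∃ a : LV, pairZ B a a = 4 ∧ pairZ B a u = 3 := by
  obtain ⟨f, hf, ho⟩ := odd_frame hB hF hg (u := u) (by rintro rfl; simp at hu) (by omega)
  obtain ⟨h1, h2⟩ := odd_shape hB hf (by omega) ho
  obtain ⟨i, j, hij, hs⟩ : ∃ i j, i ≠ j ∧ |pairZ B u (f i)| + |pairZ B u (f j)| = 6 := by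
    by_cases h5 : ∃ i, |pairZ B u (f i)| = 5
    · obtain ⟨i, hi⟩ := h5
      by_contra hc; push Not at hc
      have h3 : (Finset.univ.erase i) ⊆ (Finset.univ.filter fun k => |pairZ B u (f k)| = 3) ∪
          (Finset.univ.filter fun k => |pairZ B u (f k)| = 5) := by
        intro k hk
        simp only [Finset.mem_erase, Finset.mem_univ, and_true] at hk
        have := hc i k (Ne.symm hk)
        simp only [Finset.mem_union, Finset.mem_filter, Finset.mem_univ, true_and]
        have := h1 k
        omega
      have h4 := Finset.card_le_card h3
      have h6 := Finset.card_union_le (Finset.univ.filter fun k => |pairZ B u (f k)| = 3)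
        (Finset.univ.filter fun k => |pairZ B u (f k)| = 5)
      rw [Finset.card_erase_of_mem (Finset.mem_univ _), Finset.card_univ, Fintype.card_fin] at h4
      omega
    · push Not at h5
      have : (Finset.univ.filter fun k => |pairZ B u (f k)| = 5).card = 0 := by
        rw [Finset.card_eq_zero, Finset.filter_eq_empty_iff]; exact fun k _ => h5 k
      obtain ⟨i, hi, j, hj, hij⟩ := Finset.one_lt_card.1
        (show 1 < (Finset.univ.filter fun k => |pairZ B u (f k)| = 3).card by omega)
      simp only [Finset.mem_filter, Finset.mem_univ, true_and] at hi hj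
      exact ⟨i, j, hij, by omega⟩
  have sg : ∀ n : ℤ, ∃ s : ℤ, (s = 1 ∨ s = -1) ∧ s * n = |n| := by
    intro n
    rcases abs_choice n with h | h
    · exact ⟨1, Or.inl rfl, by rw [h]; ring⟩
    · exact ⟨-1, Or.inr rfl, by rw [h]; ring⟩
  obtain ⟨s, hs1, hs2⟩ := sg (pairZ B u (f i))
  obtain ⟨t, ht1, ht2⟩ := sg (pairZ B u (f j))
  obtain ⟨a, ha, ha2, -⟩ := hf.pairvec hij s t hs1 ht1
  exact ⟨a, ha, by have := pair_half hB (x := u) ha2; omega⟩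

lemma trans3a (hB : IsLeech B) (hF : Frames B) {g : LV} (hg : pairZ B g g = 8) {a b b' : LV}
    (ha : pairZ B a a = 4) (hb : pairZ B b b = 4) (hb' : pairZ B b' b' = 4)
    (hab : pairZ B a b = 1) (hab' : pairZ B a b' = 1) : CJ B a b b' := by
  classical
  obtain ⟨f0, hf0, ho0⟩ := odd_frame hB hF hg (u := a) (by rintro rfl; simp at ha) (by omega)
  obtain ⟨f, hf, p, hp, hp1⟩ : ∃ f, IsFrame B f ∧ ∃ p, pairZ B a (f p) = 3 ∧
      ∀ k, k ≠ p → pairZ B a (f k) = 1 := by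
    obtain ⟨p, hp, hp1⟩ := odd4 hB hf0 ha ho0
    refine ⟨fun i => (if 0 ≤ pairZ B a (f0 i) then 1 else -1 : ℤ) • f0 i, hf0.flip _ (fun i => ?_), p, ?_, ?_⟩
    · split_ifs <;> simp
    · rw [pz_smul_right, ← hp]; split_ifs with h
      · rw [abs_of_nonneg h]; ring
      · rw [abs_of_neg (by omega)]; ring
    · intro k hk
      have := hp1 k hk
      rw [pz_smul_right]; split_ifs with h
      · rw [abs_of_nonneg h] at this; omega
      · rw [abs_of_neg (by omega)] at this; omega
  have key : ∀ b, pairZ B b b = 4 → pairZ B a b = 1 → ∃ i j, i ≠ j ∧ i ≠ p ∧ j ≠ p ∧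
      pairZ B b (f i) + pairZ B b (f j) = 0 := by
    intro b hb hab
    by_cases he : EvenC B f b
    · have h1 := zeros hB hf (u := b) (by omega) he
      have h2 := Finset.pred_card_le_card_erase
        (s := Finset.univ.filter fun k => pairZ B b (f k) = 0) (a := p)
      obtain ⟨i, hi, j, hj, hij⟩ := Finset.one_lt_card.1
        (show 1 < ((Finset.univ.filter fun k => pairZ B b (f k) = 0).erase p).card by omega)
      simp only [Finset.mem_erase, Finset.mem_filter, Finset.mem_univ, true_and] at hi hj
      exact ⟨i, j, hij, hi.1, hj.1, by omega⟩
    · have ho : ∀ i, ¬ (2:ℤ) ∣ pairZ B b (f i) := by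
        simp only [EvenC, not_forall] at he
        obtain ⟨m, hm⟩ := he
        intro i; have := hf.parity b i m; omega
      obtain ⟨r, hr, hr1⟩ := odd4 hB hf hb ho
      by_contra hc; push Not at hc
      obtain ⟨k0, hk0⟩ : ∃ k0 : Fin 24, k0 ∉ ({p, r} : Finset (Fin 24)) := by
        by_contra h; push Not at h
        have := Finset.card_le_card (fun k _ => h k : (Finset.univ : Finset (Fin 24)) ⊆ {p, r})
        have h2 := Finset.card_le_two (a := p) (b := r)
        simp at this; omega
      simp only [Finset.mem_insert, Finset.mem_singleton, not_or] at hk0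
      have hk01 := hr1 k0 hk0.2
      have h3 : ∀ k, k ≠ p → k ≠ r → pairZ B b (f k) = pairZ B b (f k0) := by
        intro k h1 h2
        by_cases h : k = k0
        · rw [h]
        · have e1 := hc k k0 h h1 hk0.1
          have := hr1 k h2
          rcases abs_choice (pairZ B b (f k)) with h | h <;>
          rcases abs_choice (pairZ B b (f k0)) with h' | h' <;> omega
      have h4 := hf.inner hB a b
      have h5 : ∑ k, pairZ B a (f k) * pairZ B b (f k) = ∑ k, (pairZ B b (f k0) +
          (if k = p then 3 * pairZ B b (f p) - pairZ B b (f k0) else 0) +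
          (if k = r then if r = p then 0 else pairZ B b (f r) - pairZ B b (f k0) else 0)) := by
        refine Finset.sum_congr rfl fun k _ => ?_
        by_cases h1 : k = p
        · subst h1
          rw [hp]
          by_cases h2 : k = r
          · subst h2; simp
          · simp [h2]
        · rw [hp1 k h1]
          by_cases h2 : k = r
          · subst h2; simp [h1]
          · simp [h1, h2, h3 k h1 h2]
      rw [h5, Finset.sum_add_distrib, Finset.sum_add_distrib] at h4
      simp only [Finset.sum_const, Finset.card_univ, Fintype.card_fin, nsmul_eq_mul, Finset.sum_ite_eq',
        Finset.mem_univ, if_true, hab] at h4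
      push_cast at h4
      by_cases h6 : r = p
      · subst h6
        simp only [if_true] at h4
        rcases abs_choice (pairZ B b (f r)) with h | h <;>
          rcases abs_choice (pairZ B b (f k0)) with h' | h' <;> omega
      · have := hr1 p (Ne.symm h6)
        simp only [h6, if_false] at h4
        rcases abs_choice (pairZ B b (f r)) with h | h <;> rcases abs_choice (pairZ B b (f p)) with h'' | h'' <;>
          rcases abs_choice (pairZ B b (f k0)) with h' | h' <;> omega
  obtain ⟨i, j, hij, hip, hjp, h1⟩ := key b hb hab
  obtain ⟨k, l, hkl, hkp, hlp, h2⟩ := key b' hb' hab'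
  obtain ⟨m, hm, n, hn, hmn⟩ := Finset.one_lt_card.1
    (show 1 < (Finset.univ \ ({p, i, j, k, l} : Finset (Fin 24))).card by
      have h3 := Finset.le_card_sdiff ({p, i, j, k, l} : Finset (Fin 24)) Finset.univ
      have h4 := Finset.card_le_five (a := p) (b := i) (c := j) (d := k) (e := l)
      simp only [Finset.card_univ, Fintype.card_fin] at h3
      omega)
  simp only [Finset.mem_sdiff, Finset.mem_univ, true_and, Finset.mem_insert, Finset.mem_singleton,
    not_or] at hm hn
  obtain ⟨w1, hw1, hw1', hw1c⟩ := hf.pairvec hij 1 1 (Or.inl rfl) (Or.inl rfl)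
  obtain ⟨w2, hw2, hw2', hw2c⟩ := hf.pairvec hkl 1 1 (Or.inl rfl) (Or.inl rfl)
  obtain ⟨w3, hw3, hw3', hw3c⟩ := hf.pairvec hmn 1 1 (Or.inl rfl) (Or.inl rfl)
  have a1 := pair_half hB (x := a) hw1'
  have a2 := pair_half hB (x := a) hw2'
  have a3 := pair_half hB (x := a) hw3'
  rw [hp1 i hip, hp1 j hjp, pz_comm hB] at a1
  rw [hp1 k hkp, hp1 l hlp, pz_comm hB] at a2
  rw [hp1 m hm.1, hp1 n hn.1, pz_comm hB] at a3
  have b1 := pair_half hB (x := b) hw1'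
  have b2 := pair_half hB (x := b') hw2'
  have c1 := pair_half hB (x := w1) hw3'
  have c2 := pair_half hB (x := w2) hw3'
  simp only [hw1c, hw2c, hm, hn, if_false] at c1 c2
  have d1 := pz_comm hB b w1
  have d2 := pz_comm hB w1 w3
  exact (swap hB hF (Or.inl ha) hb hw1 (by linarith) (by linarith)).trans
    ((swap hB hF (Or.inl ha) hw1 hw3 (by linarith) (by linarith)).trans
    ((swap hB hF (Or.inl ha) hw3 hw2 (by linarith) (by linarith)).trans
    (swap hB hF (Or.inl ha) hw2 hb' (by linarith) (by linarith))))

lemma trans3 (hB : IsLeech B) (hF : Frames B) {g : LV} (hg : pairZ B g g = 8) {u u' : LV}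
    (hu : pairZ B u u = 6) (hu' : pairZ B u' u' = 6) : CJ B 0 u' u := by
  obtain ⟨a, ha, hau⟩ := decomp3 hB hF hg hu
  obtain ⟨a', ha', hau'⟩ := decomp3 hB hF hg hu'
  obtain ⟨σ, hσ, -, h1⟩ := trans2 hB hF hg ha' ha
  have c := pz_comm hB u a
  have c' := pz_comm hB u' a'
  obtain ⟨ρ, hρ, h2, h3⟩ := trans3a hB hF hg (a := a) (b := σ.mulVec (a' - u')) (b' := a - u) ha
    (by rw [conway_pair hσ]; simp only [pz_sub_left, pz_sub_right]; linarith)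
    (by simp only [pz_sub_left, pz_sub_right]; linarith)
    (by rw [← h1, conway_pair hσ]; simp only [pz_sub_right]; linarith)
    (by simp only [pz_sub_right]; linarith)
  refine ⟨ρ * σ, conway_mul hρ hσ, by simp, ?_⟩
  rw [← mulVec_mulVec]
  rw [mulVec_sub, h1, mulVec_sub, h2] at h3
  exact sub_right_injective h3
end lat4

section theta
variable {B : Matrix (Fin 24) (Fin 24) ℤ}

/-- real form -/
def realB (B : Matrix (Fin 24) (Fin 24) ℤ) : Matrix (Fin 24) (Fin 24) ℝ := B.map (Int.cast : ℤ → ℝ)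

lemma realB_cast (v : LV) : (fun i => (v i : ℝ)) ⬝ᵥ (realB B).mulVec (fun i => (v i : ℝ)) = (pairZ B v v : ℝ) := by
  simp [pairZ, realB, dotProduct, mulVec]

lemma realB_psd (hB : IsLeech B) : (realB B).PosSemidef := by
  refine Matrix.PosSemidef.of_dotProduct_mulVec_nonneg ?_ fun x => ?_
  · ext i j
    simp only [realB, conjTranspose_apply, map_apply, star_trivial]
    rw [← hB.1.apply i j]
  · have hd : DenseRange (fun (q : Fin 24 → ℚ) (i : Fin 24) => (q i : ℝ)) :=
      DenseRange.piMap (f := fun _ : Fin 24 => ((↑) : ℚ → ℝ)) fun _ => Rat.denseRange_cast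
    have hc : IsClosed {x : Fin 24 → ℝ | 0 ≤ star x ⬝ᵥ (realB B).mulVec x} := by
      apply isClosed_le continuous_const
      simp only [star_trivial]
      exact Continuous.dotProduct continuous_id (Continuous.matrix_mulVec continuous_const continuous_id)
    refine hd.induction_on (p := fun x => 0 ≤ star x ⬝ᵥ (realB B).mulVec x) x hc fun q => ?_
    obtain ⟨N, hN⟩ : ∃ N : ℕ, N = ∏ i, (q i).den := ⟨_, rfl⟩
    have hN0 : 0 < N := hN ▸ Finset.prod_pos fun i _ => (q i).den_pos
    have h1 : ∀ i, ∃ m : ℤ, (N : ℝ) * (q i : ℝ) = m := by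
      intro i
      obtain ⟨k, hk⟩ := Finset.dvd_prod_of_mem (fun i => (q i).den) (Finset.mem_univ i)
      refine ⟨k * (q i).num, ?_⟩
      have : ((q i).den : ℝ) * (q i : ℝ) = (q i).num := by exact_mod_cast Rat.den_mul_eq_num (q i)
      rw [hN, hk]; push_cast; rw [← this]; ring
    choose m hm using h1
    have h2 := realB_cast (B := B) m
    have h3 : (fun i => (m i : ℝ)) = (N : ℝ) • (fun i => (q i : ℝ)) := by
      ext i; rw [Pi.smul_apply, smul_eq_mul, hm]
    rw [h3, mulVec_smul, smul_dotProduct, dotProduct_smul] at h2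
    have h4 : (0:ℝ) ≤ pairZ B m m := by exact_mod_cast pz_nonneg hB m
    rw [← h2] at h4
    simp only [smul_eq_mul] at h4
    rw [star_trivial]
    have hN' : (0:ℝ) < N := by exact_mod_cast hN0
    exact nonneg_of_mul_nonneg_right (nonneg_of_mul_nonneg_right h4 hN') hN'

lemma realB_det (hB : IsLeech B) : (realB B).det = 1 := by
  have := Int.cast_det (R := ℝ) B
  rw [hB.2.1] at this
  simpa [realB] using this.symm

open scoped MatrixOrder in
lemma exists_sqrt (hB : IsLeech B) : ∃ A : Matrix (Fin 24) (Fin 24) ℝ, Aᵀ * A = realB B ∧ |A.det| = 1 := by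
  have h := (realB_psd hB)
  obtain ⟨A, hA⟩ := CStarAlgebra.nonneg_iff_eq_star_mul_self.1 h.nonneg
  have hA' : Aᵀ * A = realB B := by rw [hA]; rfl
  refine ⟨A, hA', ?_⟩
  have h2 : A.det * A.det = 1 := by
    rw [← realB_det hB, ← hA', det_mul, det_transpose]
  rcases mul_self_eq_one_iff.1 h2 with h | h <;> simp [h]

lemma low (hB : IsLeech B) : ∃ c : ℝ, 0 < c ∧ ∀ x : Fin 24 → ℝ,
    c * ∑ i, x i ^ 2 ≤ x ⬝ᵥ (realB B).mulVec x := by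
  obtain ⟨A, hA, hd⟩ := exists_sqrt hB
  have hu : IsUnit A.det := by rw [isUnit_iff_ne_zero]; intro h; simp [h] at hd
  set M := ∑ i, ∑ j, (A⁻¹ i j) ^ 2 with hM
  have hM0 : 0 ≤ M := by positivity
  refine ⟨(M + 1)⁻¹, by positivity, fun x => ?_⟩
  have h1 : x ⬝ᵥ (realB B).mulVec x = ∑ i, (A.mulVec x i) ^ 2 := by
    rw [← hA, ← mulVec_mulVec, dotProduct_mulVec, vecMul_transpose]
    simp [dotProduct, sq]
  have h2 : x = A⁻¹.mulVec (A.mulVec x) := by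
    rw [mulVec_mulVec, nonsing_inv_mul _ hu, one_mulVec]
  have h3 : ∑ i, x i ^ 2 ≤ M * ∑ i, (A.mulVec x i) ^ 2 := by
    rw [hM, Finset.sum_mul]
    refine Finset.sum_le_sum fun i _ => ?_
    conv_lhs => rw [h2]
    exact Finset.sum_mul_sq_le_sq_mul_sq Finset.univ (A⁻¹ i) (A.mulVec x)
  rw [h1, inv_mul_le_iff₀ (by positivity)]
  refine h3.trans ?_
  have : 0 ≤ ∑ i, (A.mulVec x i) ^ 2 := by positivity
  nlinarith

/-- majorant -/
def gB (a K : ℝ) (ℓ : LV) : ℝ := ∏ i, Real.exp (-a * (ℓ i : ℝ) ^ 2 + K * |(ℓ i : ℝ)|)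

lemma summable_pi_prod {g : ℤ → ℝ} (h0 : ∀ n, 0 ≤ g n) (hg : Summable g) :
    ∀ n : ℕ, Summable fun ℓ : Fin n → ℤ => ∏ i, g (ℓ i) := by
  intro n
  induction n with
  | zero => exact (hasSum_fintype _).summable
  | succ n ih =>
    rw [← (Fin.consEquiv (fun _ : Fin (n+1) => ℤ)).summable_iff]
    have := hg.mul_of_nonneg ih h0 (fun ℓ => Finset.prod_nonneg fun i _ => h0 _)
    refine this.congr fun p => ?_
    simp [Fin.consEquiv, Fin.prod_univ_succ]

lemma summable_gB {a : ℝ} (ha : 0 < a) (K : ℝ) : Summable (gB a K) := by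
  refine summable_pi_prod (g := fun n => Real.exp (-a * (n : ℝ) ^ 2 + K * |(n : ℝ)|))
    (fun n => (Real.exp_pos _).le) ?_ 24
  refine (summable_pow_mul_jacobiTheta₂_term_bound (K / (2 * π)) (T := a / π) (by positivity) 0).congr
    fun n => ?_
  simp only [pow_zero, one_mul]
  congr 1
  have := Real.pi_ne_zero
  push_cast
  field_simp
  ring

lemma gB_eq (a K : ℝ) (ℓ : LV) : gB a K ℓ = Real.exp (-a * ∑ i, (ℓ i : ℝ) ^ 2 + K * ∑ i, |(ℓ i : ℝ)|) := by
  rw [gB, ← Real.exp_sum, Finset.sum_add_distrib, Finset.mul_sum, Finset.mul_sum]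

lemma gB_pos (a K : ℝ) (ℓ : LV) : 0 < gB a K ℓ := by rw [gB_eq]; exact Real.exp_pos _

/-- theta term -/
def tt (B : Matrix (Fin 24) (Fin 24) ℤ) (ℓ : LV) (τ : ℂ) (z : CV) : ℂ :=
  cexp (π * Complex.I * (pairZ B ℓ ℓ : ℂ) * τ + 2 * π * Complex.I * pairC B (liftC ℓ) z)

/-- weighted theta series -/
def Th (B : Matrix (Fin 24) (Fin 24) ℤ) (w : LV → ℂ) (τ : ℂ) (z : CV) : ℂ := ∑' ℓ, w ℓ * tt B ℓ τ z

/-- bound for the matrix -/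
def MB (B : Matrix (Fin 24) (Fin 24) ℤ) : ℝ := ∑ i, ∑ j, |(B i j : ℝ)|

lemma MB_nonneg : 0 ≤ MB B := by unfold MB; positivity

lemma pairC_bound (ℓ : LV) (z : CV) : ‖pairC B (liftC ℓ) z‖ ≤ MB B * ‖z‖ * ∑ i, |(ℓ i : ℝ)| := by
  unfold pairC dotProduct
  rw [Finset.mul_sum]
  refine (norm_sum_le _ _).trans (Finset.sum_le_sum fun i _ => ?_)
  rw [norm_mul, mul_comm]
  have h1 : ‖liftC ℓ i‖ = |(ℓ i : ℝ)| := by simp [liftC]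
  rw [h1]
  gcongr
  simp only [mulVec, dotProduct, map_apply]
  refine (norm_sum_le _ _).trans ?_
  have h2 : ∑ j, |(B i j : ℝ)| ≤ MB B :=
    Finset.single_le_sum (f := fun i => ∑ j, |(B i j : ℝ)|) (fun i _ => by positivity) (Finset.mem_univ i)
  refine le_trans ?_ (mul_le_mul_of_nonneg_right h2 (norm_nonneg z))
  rw [Finset.sum_mul]
  refine Finset.sum_le_sum fun j _ => ?_
  rw [norm_mul]
  gcongr
  · simp
  · exact norm_le_pi_norm z j

lemma tt_bound {c : ℝ} (hc : 0 < c) (hl : ∀ x : Fin 24 → ℝ, c * ∑ i, x i ^ 2 ≤ x ⬝ᵥ (realB B).mulVec x)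
    {ε R : ℝ} (hε : 0 < ε) {τ : ℂ} {z : CV} (hτ : ε ≤ τ.im) (hz : ‖z‖ ≤ R) (ℓ : LV) :
    ‖tt B ℓ τ z‖ ≤ gB (π * ε * c) (2 * π * MB B * R) ℓ := by
  rw [tt, Complex.norm_exp, gB_eq, Real.exp_le_exp, Complex.add_re]
  refine add_le_add ?_ ?_
  · have : (π * Complex.I * (pairZ B ℓ ℓ : ℂ) * τ).re = -(π * (pairZ B ℓ ℓ : ℝ) * τ.im) := by
      rw [show (π * Complex.I * (pairZ B ℓ ℓ : ℂ) * τ) = ((π * (pairZ B ℓ ℓ : ℝ) : ℝ) : ℂ) * (Complex.I * τ) by push_cast; ring,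
        Complex.re_ofReal_mul]
      simp
    rw [this, ← realB_cast]
    have h1 := hl fun i => (ℓ i : ℝ)
    have h0 : 0 ≤ c * ∑ i, (ℓ i : ℝ) ^ 2 := by positivity
    have h2 : c * (∑ i, (ℓ i : ℝ) ^ 2) * ε ≤
      ((fun i => (ℓ i : ℝ)) ⬝ᵥ (realB B).mulVec fun i => (ℓ i : ℝ)) * τ.im :=
      mul_le_mul h1 hτ hε.le (h0.trans h1)
    nlinarith [Real.pi_pos]
  · refine (Complex.re_le_norm _).trans ?_
    rw [norm_mul]
    have : ‖(2 * π * Complex.I : ℂ)‖ = 2 * π := by simp [abs_of_pos Real.pi_pos]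
    rw [this]
    have h2 := pairC_bound (B := B) ℓ z
    have h3 : MB B * ‖z‖ * ∑ i, |(ℓ i : ℝ)| ≤ MB B * R * ∑ i, |(ℓ i : ℝ)| := by
      have := MB_nonneg (B := B)
      gcongr
    calc 2 * π * ‖pairC B (liftC ℓ) z‖ ≤ 2 * π * (MB B * R * ∑ i, |(ℓ i : ℝ)|) := by
          gcongr; exact h2.trans h3
      _ = _ := by ring

lemma tt_summable (hB : IsLeech B) {τ : ℂ} (hτ : 0 < τ.im) (z : CV) : Summable fun ℓ => ‖tt B ℓ τ z‖ := by
  obtain ⟨c, hc, hl⟩ := low hB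
  exact Summable.of_nonneg_of_le (fun _ => norm_nonneg _) (fun ℓ => tt_bound hc hl hτ le_rfl le_rfl ℓ)
    (summable_gB (by positivity) _)

lemma Th_summable (hB : IsLeech B) {w : LV → ℂ} {C : ℝ} (hw : ∀ ℓ, ‖w ℓ‖ ≤ C) {τ : ℂ} (hτ : 0 < τ.im) (z : CV) :
    Summable fun ℓ => ‖w ℓ * tt B ℓ τ z‖ := by
  refine Summable.of_nonneg_of_le (fun _ => norm_nonneg _) (fun ℓ => ?_) ((tt_summable hB hτ z).mul_left C)
  rw [norm_mul]; gcongr; exact hw ℓ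

/-- pairing with a fixed lattice vector as a linear functional -/
def pcL (B : Matrix (Fin 24) (Fin 24) ℤ) (ℓ : LV) : CV →L[ℂ] ℂ :=
  LinearMap.toContinuousLinearMap
    { toFun := fun z => pairC B (liftC ℓ) z
      map_add' := fun z w => by simp [pairC, mulVec_add]
      map_smul' := fun a z => by simp [pairC, mulVec_smul] }

lemma pcL_apply (ℓ : LV) (z : CV) : pcL B ℓ z = pairC B (liftC ℓ) z := rfl

/-- Joint holomorphy. -/
lemma Th_differentiableAt (hB : IsLeech B) {w : LV → ℂ} {C : ℝ} (hw : ∀ ℓ, ‖w ℓ‖ ≤ C) {τ : ℂ} (hτ : 0 < τ.im)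
    (z : CV) : DifferentiableAt ℂ (fun p : ℂ × CV => Th B w p.1 p.2) (τ, z) := by
  obtain ⟨c, hc, hl⟩ := low hB
  have hC : 0 ≤ C := (norm_nonneg _).trans (hw 0)
  have hM := MB_nonneg (B := B)
  set R := ‖z‖ + 1 with hR
  set ε := τ.im / 2 with hε
  have hε0 : 0 < ε := by positivity
  set s : Set (ℂ × CV) := {p | ε < p.1.im} ∩ {p | ‖p.2‖ < R} with hs
  have hso : IsOpen s := by
    apply IsOpen.inter
    · exact isOpen_lt continuous_const (Complex.continuous_im.comp continuous_fst)
    · exact isOpen_lt (continuous_norm.comp continuous_snd) continuous_const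
  have hsc : IsPreconnected s := by
    apply Convex.isPreconnected
    apply Convex.inter
    · have : {p : ℂ × CV | ε < p.1.im} = (fun p : ℂ × CV => p.1.im) ⁻¹' Set.Ioi ε := rfl
      rw [this]
      exact (convex_Ioi ε).linear_preimage (Complex.imLm.comp (LinearMap.fst ℝ ℂ CV))
    · have : {p : ℂ × CV | ‖p.2‖ < R} = (LinearMap.snd ℝ ℂ CV) ⁻¹' Metric.ball 0 R := by
        ext p; simp
      rw [this]
      exact (convex_ball (0 : CV) R).linear_preimage _
  set L : LV → (ℂ × CV →L[ℂ] ℂ) := fun ℓ =>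
    (π * Complex.I * (pairZ B ℓ ℓ : ℂ)) • ContinuousLinearMap.fst ℂ ℂ CV +
      (2 * π * Complex.I : ℂ) • ((pcL B ℓ).comp (ContinuousLinearMap.snd ℂ ℂ CV)) with hL
  have hLa : ∀ ℓ (p : ℂ × CV), L ℓ p = π * Complex.I * (pairZ B ℓ ℓ : ℂ) * p.1 + 2 * π * Complex.I * pairC B (liftC ℓ) p.2 := by
    intro ℓ p; simp [hL, pcL_apply]
  have hLn : ∀ ℓ, ‖L ℓ‖ ≤ π * MB B * (∑ i, |(ℓ i : ℝ)|) ^ 2 + 2 * π * MB B * ∑ i, |(ℓ i : ℝ)| := by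
    intro ℓ
    refine ContinuousLinearMap.opNorm_le_bound _ (by positivity) fun p => ?_
    rw [hLa, add_mul]
    refine (norm_add_le _ _).trans (add_le_add ?_ ?_)
    · have h1 : ‖(pairZ B ℓ ℓ : ℂ)‖ ≤ MB B * (∑ i, |(ℓ i : ℝ)|) ^ 2 := by
        have h2 : (pairZ B ℓ ℓ : ℂ) = pairC B (liftC ℓ) (liftC ℓ) := by
          simp [pairZ, pairC, liftC, dotProduct, mulVec]
        rw [h2]
        refine (pairC_bound ℓ _).trans ?_
        rw [sq, ← mul_assoc]
        gcongr
        refine (pi_norm_le_iff_of_nonneg (by positivity)).2 fun i => ?_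
        have : ‖liftC ℓ i‖ = |(ℓ i : ℝ)| := by simp [liftC]
        rw [this]
        exact Finset.single_le_sum (f := fun i => |(ℓ i : ℝ)|) (fun i _ => abs_nonneg _) (Finset.mem_univ i)
      rw [norm_mul, norm_mul]
      have h3 : ‖(π * Complex.I : ℂ)‖ = π := by simp [abs_of_pos Real.pi_pos]
      rw [h3, mul_assoc π (MB B)]
      gcongr
      exact norm_fst_le p
    · rw [norm_mul]
      have h3 : ‖(2 * π * Complex.I : ℂ)‖ = 2 * π := by simp [abs_of_pos Real.pi_pos]
      rw [h3]
      have h4 := (pairC_bound (B := B) ℓ p.2)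
      calc 2 * π * ‖pairC B (liftC ℓ) p.2‖ ≤ 2 * π * (MB B * ‖p‖ * ∑ i, |(ℓ i : ℝ)|) := by
            gcongr
            refine h4.trans ?_
            gcongr
            exact norm_snd_le p
        _ = _ := by ring
  have hf : ∀ ℓ (p : ℂ × CV), HasFDerivAt (fun p : ℂ × CV => w ℓ * tt B ℓ p.1 p.2)
      ((w ℓ * tt B ℓ p.1 p.2) • L ℓ) p := by
    intro ℓ p
    have h1 : HasFDerivAt (fun p : ℂ × CV => cexp (L ℓ p)) (cexp (L ℓ p) • L ℓ) p := (L ℓ).hasFDerivAt.cexp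
    have h2 := h1.const_mul (w ℓ)
    rw [smul_smul] at h2
    simpa only [hLa, tt] using h2
  set K := 2 * π * MB B * R with hK
  have hx : ∀ x : ℝ, 0 ≤ x → π * MB B * x ^ 2 + 2 * π * MB B * x ≤ (4 * π * MB B) * Real.exp x := by
    intro x hx
    have h1 := Real.quadratic_le_exp_of_nonneg hx
    have h2 : x ^ 2 + 2 * x ≤ 4 * Real.exp x := by nlinarith
    have h3 : 0 ≤ π * MB B := by positivity
    nlinarith
  refine (hasFDerivAt_tsum_of_isPreconnected (𝕜 := ℂ) (u := fun ℓ => C * (4 * π * MB B) * gB (π * ε * c) (K + 1) ℓ)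
    ((summable_gB (by positivity) _).mul_left _) hso hsc (fun ℓ p _ => hf ℓ p) (fun ℓ p hp => ?_)
    (x₀ := (τ, z)) ?_ (Th_summable hB hw hτ z).of_norm ?_).differentiableAt
  · have h1 := tt_bound hc hl hε0 (R := R) (le_of_lt hp.1) (le_of_lt hp.2) ℓ
    rw [norm_smul, norm_mul]
    have h2 : gB (π * ε * c) (K + 1) ℓ = gB (π * ε * c) K ℓ * Real.exp (∑ i, |(ℓ i : ℝ)|) := by
      rw [gB_eq, gB_eq, ← Real.exp_add]; congr 1; ring
    rw [h2]
    calc ‖w ℓ‖ * ‖tt B ℓ p.1 p.2‖ * ‖L ℓ‖ ≤ C * gB (π * ε * c) K ℓ * ((4 * π * MB B) * Real.exp (∑ i, |(ℓ i : ℝ)|)) := by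
          have := (gB_pos (π * ε * c) K ℓ).le
          gcongr
          · exact hw ℓ
          · exact (hLn ℓ).trans (hx _ (by positivity))
      _ = _ := by ring
  · exact ⟨by simp only [Set.mem_ofPred_eq, hε]; linarith, by simp only [Set.mem_ofPred_eq, hR]; linarith⟩
  · exact ⟨by simp only [Set.mem_ofPred_eq, hε]; linarith, by simp only [Set.mem_ofPred_eq, hR]; linarith⟩

end theta

section poisson
variable {B : Matrix (Fin 24) (Fin 24) ℤ}

lemma pc_add_left (x y z : CV) : pairC B (x + y) z = pairC B x z + pairC B y z := by simp [pairC]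
lemma pc_add_right (x y z : CV) : pairC B z (x + y) = pairC B z x + pairC B z y := by simp [pairC, mulVec_add]
lemma pc_smul_left (a : ℂ) (x z : CV) : pairC B (a • x) z = a * pairC B x z := by simp [pairC]
lemma pc_smul_right (a : ℂ) (x z : CV) : pairC B z (a • x) = a * pairC B z x := by simp [pairC, mulVec_smul]
lemma pc_comm (hB : IsLeech B) (x y : CV) : pairC B x y = pairC B y x := by
  rw [pairC, pairC, dotProduct_mulVec, ← mulVec_transpose, dotProduct_comm, ← transpose_map, hB.1.eq]
lemma pc_lift (x y : LV) : pairC B (liftC x) (liftC y) = pairZ B x y := by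
  simp [pairZ, pairC, liftC, dotProduct, mulVec]
lemma liftC_add (x y : LV) : liftC (x + y) = liftC x + liftC y := by ext i; simp [liftC]
lemma liftC_neg (x : LV) : liftC (-x) = - liftC x := by ext i; simp [liftC]
lemma liftC_zero : liftC 0 = 0 := by ext i; simp [liftC]

/-- complexified real vector -/
def rC (x : Fin 24 → ℝ) : CV := fun i => (x i : ℂ)

/-- Gaussian -/
def Gs (B : Matrix (Fin 24) (Fin 24) ℤ) (τ : ℂ) (z : CV) (x : Fin 24 → ℝ) : ℂ :=
  cexp (π * Complex.I * τ * pairC B (rC x) (rC x) + 2 * π * Complex.I * pairC B (rC x) z)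

/-- integer vector as a real vector -/
def iR (ℓ : LV) : Fin 24 → ℝ := fun i => (ℓ i : ℝ)

lemma rC_add (x y : Fin 24 → ℝ) : rC (x + y) = rC x + rC y := by ext i; simp [rC]
lemma rC_iR (ℓ : LV) : rC (iR ℓ) = liftC ℓ := by ext i; simp [rC, iR, liftC]

lemma Gs_add (hB : IsLeech B) (τ : ℂ) (z : CV) (x : Fin 24 → ℝ) (ℓ : LV) :
    Gs B τ z (x + iR ℓ) = Gs B τ z x * tt B ℓ τ (z + τ • rC x) := by
  rw [Gs, Gs, tt, ← Complex.exp_add, rC_add, rC_iR]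
  congr 1
  simp only [pc_add_left, pc_add_right, pc_smul_right, pc_lift]
  rw [pc_comm hB (rC x) (liftC ℓ)]
  ring

/-- periodised Gaussian -/
def perG (B : Matrix (Fin 24) (Fin 24) ℤ) (τ : ℂ) (z : CV) (x : Fin 24 → ℝ) : ℂ :=
  ∑' ℓ : LV, Gs B τ z (x + iR ℓ)

lemma cont_rC : Continuous rC := by unfold rC; fun_prop

lemma cont_Gs (τ : ℂ) (z : CV) : Continuous (Gs B τ z) := by
  have h1 := cont_rC
  unfold Gs pairC
  have h2 : Continuous fun x => rC x ⬝ᵥ (B.map (Int.cast : ℤ → ℂ)).mulVec (rC x) :=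
    Continuous.dotProduct h1 (Continuous.matrix_mulVec continuous_const h1)
  have h3 : Continuous fun x => rC x ⬝ᵥ (B.map (Int.cast : ℤ → ℂ)).mulVec z :=
    Continuous.dotProduct h1 continuous_const
  fun_prop

lemma perG_eq (hB : IsLeech B) (τ : ℂ) (z : CV) (x : Fin 24 → ℝ) :
    perG B τ z x = Gs B τ z x * Th B (fun _ => 1) τ (z + τ • rC x) := by
  rw [perG, Th, ← tsum_mul_left]
  simp only [Gs_add hB, one_mul]

lemma perG_cont (hB : IsLeech B) {τ : ℂ} (hτ : 0 < τ.im) (z : CV) : Continuous (perG B τ z) := by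
  have h : perG B τ z = fun x => Gs B τ z x * Th B (fun _ => 1) τ (z + τ • rC x) := by
    ext x; exact perG_eq hB τ z x
  rw [h]
  refine (cont_Gs τ z).mul ?_
  have h2 : Continuous fun x : Fin 24 → ℝ => (τ, z + τ • rC x) := by
    have := cont_rC; fun_prop
  refine continuous_iff_continuousAt.2 fun x => ?_
  exact ContinuousAt.comp (f := fun x : Fin 24 → ℝ => (τ, z + τ • rC x)) (g := fun p : ℂ × CV => Th B (fun _ => 1) p.1 p.2)
    (Th_differentiableAt hB (w := fun _ => 1) (C := 1) (fun _ => by simp) hτ (z + τ • rC x)).continuousAt h2.continuousAt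

lemma iR_add (k ℓ : LV) : iR (k + ℓ) = iR k + iR ℓ := by ext i; simp [iR]

lemma perG_per (τ : ℂ) (z : CV) (x : Fin 24 → ℝ) (k : LV) : perG B τ z (x + iR k) = perG B τ z x := by
  rw [perG, perG, ← (Equiv.addLeft k).tsum_eq (fun ℓ => Gs B τ z (x + iR ℓ))]
  simp only [Equiv.coe_addLeft, iR_add, add_assoc]

/-- the covering map -/
def mkT : (Fin 24 → ℝ) → UnitAddTorus (Fin 24) := fun x i => (x i : UnitAddCircle)

lemma mkT_quot : IsOpenQuotientMap mkT :=
  IsOpenQuotientMap.piMap (f := fun _ : Fin 24 => ((↑) : ℝ → UnitAddCircle)) fun _ =>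
    QuotientAddGroup.isOpenQuotientMap_mk

lemma mkT_eq {a b : Fin 24 → ℝ} (h : mkT a = mkT b) : ∃ ℓ : LV, b = a + iR ℓ := by
  have : ∀ i, ∃ n : ℤ, b i = a i + n := by
    intro i
    have h1 := congrFun h i
    simp only [mkT] at h1
    rw [QuotientAddGroup.eq, AddSubgroup.mem_zmultiples_iff] at h1
    obtain ⟨n, hn⟩ := h1
    exact ⟨n, by simp at hn; linarith⟩
  choose ℓ hℓ using this
  exact ⟨ℓ, funext hℓ⟩

lemma mFourier_mk (m : LV) (x : Fin 24 → ℝ) :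
    UnitAddTorus.mFourier m (mkT x) = cexp (2 * π * Complex.I * (liftC m ⬝ᵥ rC x)) := by
  simp only [UnitAddTorus.mFourier, ContinuousMap.coe_mk, mkT, fourier_coe_apply, ← Complex.exp_sum, dotProduct,
    liftC, rC, Finset.mul_sum]
  congr 1
  refine Finset.sum_congr rfl fun i _ => ?_
  push_cast
  ring

/-- the box -/
def box (ℓ : LV) : Set (Fin 24 → ℝ) := {x | ∀ i, x i ∈ Set.Ioc ((ℓ i : ℝ)) ((ℓ i : ℝ) + 1)}

lemma box_union : ⋃ ℓ, box ℓ = Set.univ := by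
  refine Set.eq_univ_of_forall fun x => Set.mem_iUnion.2 ⟨fun i => ⌈x i⌉ - 1, fun i => ?_⟩
  push_cast
  exact ⟨by linarith [Int.ceil_lt_add_one (x i)], by linarith [Int.le_ceil (x i)]⟩

lemma box_disj : Pairwise (Function.onFun Disjoint box) := by
  intro k ℓ hkl
  refine Set.disjoint_left.2 fun x h1 h2 => hkl (funext fun i => ?_)
  obtain ⟨a, b⟩ := h1 i
  obtain ⟨c, d⟩ := h2 i
  have e1 : (k i : ℝ) < ℓ i + 1 := by linarith
  have e2 : (ℓ i : ℝ) < k i + 1 := by linarith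
  norm_cast at e1 e2
  omega

lemma box_meas (ℓ : LV) : MeasurableSet (box ℓ) := by
  have : box ℓ = Set.univ.pi fun i => Set.Ioc ((ℓ i : ℝ)) ((ℓ i : ℝ) + 1) := by ext x; simp [box]
  rw [this]
  exact MeasurableSet.univ_pi fun i => measurableSet_Ioc

open MeasureTheory in
lemma unfold_box {K : (Fin 24 → ℝ) → ℂ} (hK : Integrable K) :
    ∫ x in box 0, ∑' ℓ : LV, K (x + iR ℓ) = ∫ x, K x := by
  have key : ∀ {E : Type} [NormedAddCommGroup E] [NormedSpace ℝ E] (K : (Fin 24 → ℝ) → E) (ℓ : LV), ∫ x in box 0, K (x + iR ℓ) = ∫ x in box ℓ, K x := by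
    intro E _ _ K ℓ
    have hp : (fun x => x + iR ℓ) ⁻¹' box ℓ = box 0 := by
      ext x
      simp only [Set.mem_preimage, box, Set.mem_ofPred_eq, Pi.add_apply, iR, Set.mem_Ioc, Pi.zero_apply, Int.cast_zero]
      refine forall_congr' fun i => ?_
      constructor <;> rintro ⟨a, b⟩ <;> constructor <;> linarith
    rw [← hp]
    exact (measurePreserving_add_right volume (iR ℓ)).setIntegral_preimage_emb
      (measurableEmbedding_addRight (iR ℓ)) K (box ℓ)
  have h1 : HasSum (fun ℓ => ∫ x in box ℓ, K x) (∫ x in ⋃ ℓ, box ℓ, K x) :=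
    hasSum_integral_iUnion box_meas box_disj hK.integrableOn
  have h2 : HasSum (fun ℓ => ∫ x in box ℓ, ‖K x‖) (∫ x in ⋃ ℓ, box ℓ, ‖K x‖) :=
    hasSum_integral_iUnion box_meas box_disj hK.norm.integrableOn
  rw [box_union, Measure.restrict_univ] at h1
  rw [← h1.tsum_eq, ← integral_tsum_of_summable_integral_norm]
  · exact tsum_congr fun ℓ => key K ℓ
  · intro ℓ
    exact ((measurePreserving_add_right volume (iR ℓ)).integrable_comp_of_integrable hK).integrableOn
  · exact h2.summable.congr fun ℓ => (key (fun x => ‖K x‖) ℓ).symm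

/-- complexified square root -/
lemma pairC_sqrt {A : Matrix (Fin 24) (Fin 24) ℝ} (hA : Aᵀ * A = realB B) (x y : CV) :
    pairC B x y = ∑ i, (A.map (Complex.ofReal)).mulVec x i * (A.map (Complex.ofReal)).mulVec y i := by
  have h1 : B.map (Int.cast : ℤ → ℂ) = (A.map Complex.ofReal)ᵀ * (A.map Complex.ofReal) := by
    have h2 : (realB B).map Complex.ofReal = B.map (Int.cast : ℤ → ℂ) := by ext i j; simp [realB]
    rw [← h2, ← hA]
    ext i j
    simp [Matrix.mul_apply]
  rw [pairC, h1, ← mulVec_mulVec, dotProduct_mulVec, vecMul_transpose]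
  rfl

open MeasureTheory in
lemma gauss_int (hB : IsLeech B) {τ : ℂ} (hτ : 0 < τ.im) (z : CV) :
    Integrable (Gs B τ z) ∧ ∫ x, Gs B τ z x = (τ ^ 12)⁻¹ * cexp (-(π * Complex.I * pairC B z z / τ)) := by
  obtain ⟨A, hA, hd⟩ := exists_sqrt hB
  have hd0 : A.det ≠ 0 := by intro h; simp [h] at hd
  have hτ0 : τ ≠ 0 := by rintro rfl; simp at hτ
  set b : ℂ := -(π * Complex.I * τ) with hb
  have hb0 : 0 < b.re := by
    have : b.re = π * τ.im := by simp [hb]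
    rw [this]; positivity
  set c : Fin 24 → ℂ := fun i => 2 * π * Complex.I * (A.map Complex.ofReal).mulVec z i with hc
  have hmap : Measure.map (toLin' A) (volume : Measure (Fin 24 → ℝ)) = volume := by
    rw [Real.map_matrix_volume_pi_eq_smul_volume_pi hd0, abs_inv, hd]; simp
  have hcont : Continuous (toLin' A) := LinearMap.continuous_of_finiteDimensional _
  set g : (Fin 24 → ℝ) → ℂ := fun v => cexp (-b * ∑ i, (v i : ℂ) ^ 2 + ∑ i, c i * v i) with hg
  have hgi : Integrable g := GaussianFourier.integrable_cexp_neg_mul_sum_add hb0 c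
  have hG : Gs B τ z = g ∘ toLin' A := by
    ext x
    simp only [Gs, hg, Function.comp, pairC_sqrt hA]
    have h1 : ∀ i, (A.map Complex.ofReal).mulVec (rC x) i = ((toLin' A x i : ℝ) : ℂ) := by
      intro i; simp [mulVec, dotProduct, rC]
    simp only [h1, hb, hc, neg_neg, sq, Finset.mul_sum]
    congr 2
    refine Finset.sum_congr rfl fun i _ => by ring
  constructor
  · rw [hG]
    rw [← hmap] at hgi
    exact hgi.comp_measurable hcont.measurable
  · rw [hG]
    have h2 := integral_map (μ := (volume : Measure (Fin 24 → ℝ))) hcont.measurable.aemeasurable (f := g)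
      (by rw [hmap]; exact hgi.aestronglyMeasurable)
    rw [hmap] at h2
    simp only [Function.comp]
    rw [← h2, hg, GaussianFourier.integral_cexp_neg_mul_sum_add hb0 c]
    have hpi : (π : ℂ) ≠ 0 := by exact_mod_cast Real.pi_ne_zero
    congr 1
    · have h12 : ((Fintype.card (Fin 24) : ℂ) / 2) = ((12 : ℕ) : ℂ) := by rw [Fintype.card_fin]; norm_num
      rw [h12, Complex.cpow_natCast]
      have : (π : ℂ) / b = Complex.I * τ⁻¹ := by
        rw [hb]; field_simp; simp
      rw [this, mul_pow, show (12:ℕ) = 4 * 3 from rfl, pow_mul Complex.I, Complex.I_pow_four, one_pow, one_mul, inv_pow]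
    · congr 1
      rw [pairC_sqrt hA, hb]
      have h3 : ∑ i, c i ^ 2 = (-(4 * π ^ 2) : ℂ) * ∑ i, (A.map Complex.ofReal).mulVec z i * (A.map Complex.ofReal).mulVec z i := by
        rw [Finset.mul_sum]
        refine Finset.sum_congr rfl fun i _ => ?_
        simp only [hc]
        ring_nf
        rw [Complex.I_sq]; ring
      rw [h3]
      field_simp
      rw [Complex.I_sq]; ring

/-- dual reindexing -/
def dualEquiv (hB : IsLeech B) : LV ≃ LV where
  toFun v := B.mulVec v
  invFun v := B⁻¹.mulVec v
  left_inv v := by simp only [mulVec_mulVec]; rw [nonsing_inv_mul _ (by rw [hB.2.1]; exact isUnit_one), one_mulVec]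
  right_inv v := by simp only [mulVec_mulVec]; rw [mul_nonsing_inv _ (by rw [hB.2.1]; exact isUnit_one), one_mulVec]

lemma dual_dot (hB : IsLeech B) (v : LV) (x : CV) : liftC (B.mulVec v) ⬝ᵥ x = pairC B (liftC v) x := by
  have : liftC (B.mulVec v) = (B.map (Int.cast : ℤ → ℂ)).mulVec (liftC v) := by
    ext i; simp [liftC, mulVec, dotProduct]
  rw [this, pc_comm hB, pairC, dotProduct_comm]

theorem theta_S (hB : IsLeech B) {τ : ℂ} (hτ : 0 < τ.im) (z : CV) :
    Th B (fun _ => 1) (-1 / τ) (τ⁻¹ • z) = τ ^ 12 * cexp (π * Complex.I * pairC B z z / τ) * Th B (fun _ => 1) τ z := by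
  have hτ0 : τ ≠ 0 := by rintro rfl; simp at hτ
  have hτ' : 0 < (-1 / τ).im := by
    have : -1 / τ = -τ⁻¹ := by field_simp
    rw [this]
    simp only [Complex.neg_im, Complex.inv_im, neg_div, neg_neg]
    exact div_pos hτ (Complex.normSq_pos.2 hτ0)
  have hq : Topology.IsQuotientMap (⟨mkT, mkT_quot.continuous⟩ : C(Fin 24 → ℝ, UnitAddTorus (Fin 24))) := mkT_quot.isQuotientMap
  have hft : Function.FactorsThrough (⟨perG B τ z, perG_cont hB hτ z⟩ : C(Fin 24 → ℝ, ℂ))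
      (⟨mkT, mkT_quot.continuous⟩ : C(Fin 24 → ℝ, UnitAddTorus (Fin 24))) := fun a b h => by
    obtain ⟨ℓ, rfl⟩ := mkT_eq h
    exact (perG_per τ z a ℓ).symm
  obtain ⟨F, hFm⟩ : ∃ F : C(UnitAddTorus (Fin 24), ℂ), ∀ x, F (mkT x) = perG B τ z x :=
    ⟨hq.lift _ hft, fun x => DFunLike.congr_fun (hq.lift_comp _ hft) x⟩
  have hco : ∀ k : LV, UnitAddTorus.mFourierCoeff F (B.mulVec k) =
      (τ ^ 12)⁻¹ * cexp (-(π * Complex.I * pairC B z z / τ)) * tt B k (-1 / τ) (τ⁻¹ • z) := by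
    intro k
    have h0 : (fun i => (0 : Fin 24 → ℝ) i) = 0 := rfl
    rw [UnitAddTorus.mFourierCoeff_eq_integral _ _ 0]
    have hb : {x : Fin 24 → ℝ | ∀ i, x i ∈ Set.Ioc ((0 : Fin 24 → ℝ) i) ((0 : Fin 24 → ℝ) i + 1)} = box 0 := by
      simp [box]
    rw [hb]
    have hK : ∀ x : Fin 24 → ℝ, UnitAddTorus.mFourier (-(B.mulVec k)) (fun i => (x i : UnitAddCircle)) •
        F (fun i => (x i : UnitAddCircle)) = ∑' ℓ : LV, Gs B τ (z - liftC k) (x + iR ℓ) := by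
      intro x
      change UnitAddTorus.mFourier (-(B.mulVec k)) (mkT x) • F (mkT x) = _
      rw [hFm, mFourier_mk, smul_eq_mul, perG, ← tsum_mul_left]
      refine tsum_congr fun ℓ => ?_
      rw [Gs, Gs, ← Complex.exp_add, liftC_neg, neg_dotProduct, dual_dot hB]
      have h1 : pairC B (rC (x + iR ℓ)) (z - liftC k) = pairC B (rC (x + iR ℓ)) z - pairC B (liftC k) (rC x) -
          (pairZ B k ℓ : ℂ) := by
        rw [sub_eq_add_neg, ← neg_one_smul ℂ (liftC k), pc_add_right, pc_smul_right, pc_comm hB _ (liftC k), rC_add,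
          rC_iR, pc_add_right, pc_lift]
        ring
      rw [h1, Complex.exp_eq_exp_iff_exists_int]
      exact ⟨pairZ B k ℓ, by ring⟩
    simp only [hK]
    obtain ⟨h2, h3⟩ := gauss_int hB hτ (z - liftC k)
    rw [unfold_box h2, h3, tt, mul_assoc ((τ ^ 12)⁻¹), ← Complex.exp_add]
    congr 2
    rw [sub_eq_add_neg, ← neg_one_smul ℂ (liftC k)]
    simp only [pc_add_left, pc_add_right, pc_smul_left, pc_smul_right, pc_lift]
    rw [pc_comm hB z (liftC k)]
    field_simp
    ring
  have hs : Summable (UnitAddTorus.mFourierCoeff F) := by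
    rw [← (dualEquiv hB).summable_iff]
    refine Summable.congr (f := fun k => (τ ^ 12)⁻¹ * cexp (-(π * Complex.I * pairC B z z / τ)) * tt B k (-1 / τ) (τ⁻¹ • z))
      ((tt_summable hB hτ' _).of_norm.mul_left _) fun k => ?_
    exact (hco k).symm
  have hsum := UnitAddTorus.hasSum_mFourier_series_apply_of_summable hs (mkT 0)
  rw [hFm, ← (dualEquiv hB).hasSum_iff] at hsum
  have h4 : ∀ k, ((fun i => UnitAddTorus.mFourierCoeff F i • UnitAddTorus.mFourier i (mkT 0)) ∘ (dualEquiv hB)) k =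
      (τ ^ 12)⁻¹ * cexp (-(π * Complex.I * pairC B z z / τ)) * tt B k (-1 / τ) (τ⁻¹ • z) := by
    intro k
    simp only [Function.comp, dualEquiv, Equiv.coe_fn_mk, hco]
    rw [mFourier_mk]
    have : rC 0 = 0 := by ext i; simp [rC]
    rw [this]; simp
  have h5 := hsum.tsum_eq
  rw [tsum_congr h4, tsum_mul_left] at h5
  have h6 : perG B τ z 0 = Th B (fun _ => 1) τ z := by
    rw [perG_eq hB]
    have : rC 0 = 0 := by ext i; simp [rC]
    simp [this, Gs, pairC]
  rw [h6] at h5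
  have h7 : Th B (fun _ => 1) (-1 / τ) (τ⁻¹ • z) = ∑' k, tt B k (-1 / τ) (τ⁻¹ • z) := by simp [Th]
  rw [h7, ← h5, Complex.exp_neg]
  have := Complex.exp_ne_zero (π * Complex.I * pairC B z z / τ)
  field_simp

end poisson

section uniq
variable {B : Matrix (Fin 24) (Fin 24) ℤ}

theorem four_unique_aux {E : Type*} [NormedAddCommGroup E] [InnerProductSpace ℂ E]
    (T : C(UnitAddTorus (Fin 24), ℂ) →L[ℂ] E) (ho : Orthonormal ℂ fun n : LV => T (UnitAddTorus.mFourier n))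
    (hB : IsLeech B) {a : LV → ℂ} (ha : Summable fun ℓ => ‖a ℓ‖)
    (h : ∀ z : CV, ∑' ℓ, a ℓ * cexp (2 * π * Complex.I * pairC B (liftC ℓ) z) = 0) (ℓ : LV) : a ℓ = 0 := by
  have hs : Summable fun ℓ : LV => a ℓ • UnitAddTorus.mFourier (B.mulVec ℓ) := by
    refine Summable.of_norm ?_
    simpa [norm_smul, UnitAddTorus.mFourier_norm] using ha
  have h0 : (∑' ℓ : LV, a ℓ • UnitAddTorus.mFourier (B.mulVec ℓ)) = 0 := by
    ext y
    obtain ⟨x, rfl⟩ := mkT_quot.surjective y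
    rw [← ContinuousMap.tsum_apply hs, ContinuousMap.zero_apply, ← h (rC x)]
    refine tsum_congr fun ℓ => ?_
    rw [ContinuousMap.smul_apply, mFourier_mk, dual_dot hB, smul_eq_mul]
  have h1 := hs.hasSum
  rw [h0] at h1
  have h2 := (h1.mapL T).mapL (innerSL ℂ (T (UnitAddTorus.mFourier (B.mulVec ℓ))))
  simp only [map_zero, map_smul, innerSL_apply_apply] at h2
  have ho := orthonormal_iff_ite.1 ho
  have h3 : ∀ m : LV, a m • inner ℂ (T (UnitAddTorus.mFourier (B.mulVec ℓ))) (T (UnitAddTorus.mFourier (B.mulVec m))) = if m = ℓ then a ℓ else 0 := by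
    intro m
    have h4 := ho (B.mulVec ℓ) (B.mulVec m)
    have h5 : B.mulVec ℓ = B.mulVec m ↔ m = ℓ := ⟨fun h => ((dualEquiv hB).injective h).symm, fun h => by rw [h]⟩
    rw [h4]
    simp only [h5]
    split_ifs with h6 <;> simp [h6]
  simp only [h3] at h2
  exact (hasSum_ite_eq ℓ (a ℓ)).unique h2

theorem four_unique (hB : IsLeech B) {a : LV → ℂ} (ha : Summable fun ℓ => ‖a ℓ‖)
    (h : ∀ z : CV, ∑' ℓ, a ℓ * cexp (2 * π * Complex.I * pairC B (liftC ℓ) z) = 0) (ℓ : LV) : a ℓ = 0 :=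
  four_unique_aux _ UnitAddTorus.orthonormal_mFourier hB ha h ℓ

theorem four_unique2 (hB : IsLeech B) {a b : LV → ℂ} (ha : Summable fun ℓ => ‖a ℓ‖) (hb : Summable fun ℓ => ‖b ℓ‖)
    (h : ∀ z : CV, ∑' ℓ, a ℓ * cexp (2 * π * Complex.I * pairC B (liftC ℓ) z) =
      ∑' ℓ, b ℓ * cexp (2 * π * Complex.I * pairC B (liftC ℓ) z)) (ℓ : LV)
    (hsum : ∀ z, Summable fun ℓ => a ℓ * cexp (2 * π * Complex.I * pairC B (liftC ℓ) z))
    (hsumb : ∀ z, Summable fun ℓ => b ℓ * cexp (2 * π * Complex.I * pairC B (liftC ℓ) z)) : a ℓ = b ℓ := by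
  refine sub_eq_zero.1 (four_unique hB (a := fun ℓ => a ℓ - b ℓ) ?_ (fun z => ?_) ℓ)
  · exact Summable.of_nonneg_of_le (fun _ => norm_nonneg _) (fun _ => norm_sub_le _ _) (ha.add hb)
  · simp only [sub_mul]
    rw [(hsum z).tsum_sub (hsumb z), h z, sub_self]
end uniq

section mf
open ModularForm ModularGroup

lemma coe_Smul (τ : ℍ) : ((S • τ : ℍ) : ℂ) = -1 / (τ : ℂ) := by
  rw [modular_S_smul]; simp [neg_div]
lemma coe_Tmul (τ : ℍ) : ((T • τ : ℍ) : ℂ) = (τ : ℂ) + 1 := by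
  rw [modular_T_smul]; simp [add_comm]

lemma slash_S_of {k : ℤ} {f : ℍ → ℂ} (hS : ∀ τ, f (S • τ) = (τ : ℂ) ^ k * f τ) : f ∣[k] S = f := by
  ext τ
  rw [SL_slash_apply, hS]
  have : denom (S : GL (Fin 2) ℝ) τ = τ := denom_S τ
  rw [this, _root_.zpow_neg]
  have h0 := zpow_ne_zero k τ.ne_zero
  field_simp
lemma slash_T_of {k : ℤ} {f : ℍ → ℂ} (hT : ∀ τ, f (T • τ) = f τ) : f ∣[k] T = f := by
  ext τ
  rw [SL_slash_apply, hT]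
  have : denom (T : GL (Fin 2) ℝ) τ = 1 := by
    change (((T.1 1 0 : ℤ) : ℝ) : ℂ) * τ + (((T.1 1 1 : ℤ) : ℝ) : ℂ) = 1
    simp [T]
  rw [this]; simp

lemma mkMF {k : ℤ} {f : ℍ → ℂ} (hol : MDifferentiable 𝓘(ℂ) 𝓘(ℂ) f)
    (hS : ∀ τ, f (S • τ) = (τ : ℂ) ^ k * f τ) (hT : ∀ τ, f (T • τ) = f τ) (hb : IsBoundedAtImInfty f) :
    ∃ F : ModularForm 𝒮ℒ k, ⇑F = f := by
  have hinv := SlashInvariantForm.slash_action_generators_SL2Z (slash_S_of hS) (slash_T_of (k := k) hT)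
  refine ⟨{ toFun := f, slash_action_eq' := ?_, holo' := hol, bdd_at_cusps' := ?_ }, rfl⟩
  · intro A hA
    obtain ⟨A, rfl⟩ := hA
    exact hinv A
  · intro c hc
    rw [Subgroup.IsArithmetic.isCusp_iff_isCusp_SL2Z] at hc
    rw [OnePoint.isBoundedAt_iff_forall_SL2Z hc]
    intro γ _
    rw [hinv]
    exact hb

end mf

section theta0
open ModularForm ModularGroup
variable {B : Matrix (Fin 24) (Fin 24) ℤ}

/-- vectors of given norm -/
def shell (B : Matrix (Fin 24) (Fin 24) ℤ) (m : ℤ) : Set LV := {ℓ | pairZ B ℓ ℓ = m}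

lemma shell_finite (hB : IsLeech B) (m : ℤ) : (shell B m).Finite := by
  have h := (tt_summable hB (τ := Complex.I) (by simp) 0).subtype (shell B m)
  have h2 : (fun x : shell B m => ‖tt B x Complex.I 0‖) = fun _ => Real.exp (-(π * m)) := by
    ext ⟨ℓ, hℓ⟩
    have hℓ' : pairZ B ℓ ℓ = m := hℓ
    simp only [tt, hℓ', Complex.norm_exp]
    congr 1
    simp [pairC]
  replace h := (show Summable fun x : shell B m => ‖tt B x Complex.I 0‖ from h)
  rw [h2] at h
  by_contra hf
  have : Infinite (shell B m) := Set.infinite_coe_iff.2 hf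
  have h3 := h.tendsto_cofinite_zero
  have h4 := tendsto_nhds_unique h3 tendsto_const_nhds
  exact (Real.exp_pos _).ne h4

/-- half norm as a natural number -/
def hn (B : Matrix (Fin 24) (Fin 24) ℤ) (ℓ : LV) : ℕ := (pairZ B ℓ ℓ / 2).toNat

lemma hn_spec (hB : IsLeech B) (ℓ : LV) : pairZ B ℓ ℓ = 2 * (hn B ℓ : ℤ) := by
  have h1 := pz_nonneg hB ℓ
  obtain ⟨r, hr⟩ := hB.2.2.2.1 ℓ
  simp only [hn]; omega

def Nn (B : Matrix (Fin 24) (Fin 24) ℤ) (n : ℕ) : ℕ := Nat.card (shell B (2 * n))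

lemma theta0_hasSum (hB : IsLeech B) (τ : ℍ) :
    HasSum (fun n : ℕ => (Nn B n : ℂ) • Function.Periodic.qParam 1 τ ^ n) (Th B (fun _ => 1) τ 0) := by
  have h1 : Summable fun ℓ => tt B ℓ τ 0 := (tt_summable hB τ.2 0).of_norm
  have h2 : HasSum (fun ℓ => tt B ℓ τ 0) (Th B (fun _ => 1) τ 0) := by
    simpa [Th] using h1.hasSum
  rw [← (Equiv.sigmaFiberEquiv (hn B)).hasSum_iff] at h2
  have h3 : ∀ n : ℕ, HasSum (fun x : {ℓ // hn B ℓ = n} => tt B x.1 τ 0) ((Nn B n : ℂ) • Function.Periodic.qParam 1 τ ^ n) := by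
    intro n
    have hse : {ℓ // hn B ℓ = n} = shell B (2 * n) := by
      congr 1; ext ℓ
      have := hn_spec hB ℓ
      simp only [shell, Set.mem_ofPred_eq]; omega
    have hfin : Finite {ℓ // hn B ℓ = n} := by rw [hse]; exact shell_finite hB _
    have := Fintype.ofFinite {ℓ // hn B ℓ = n}
    have h4 : (fun x : {ℓ // hn B ℓ = n} => tt B x.1 τ 0) = fun _ => Function.Periodic.qParam 1 τ ^ n := by
      ext ⟨ℓ, hℓ⟩
      simp only [tt, hn_spec hB ℓ, hℓ, Function.Periodic.qParam, ← Complex.exp_nat_mul]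
      congr 1
      simp [pairC]; ring
    rw [h4, Nn, ← hse, Nat.card_eq_fintype_card]
    have := hasSum_fintype (fun _ : {ℓ // hn B ℓ = n} => Function.Periodic.qParam 1 τ ^ n)
    simpa using this
  exact h2.sigma h3

lemma theta0_T (hB : IsLeech B) (τ : ℂ) (z : CV) : Th B (fun _ => 1) (τ + 1) z = Th B (fun _ => 1) τ z := by
  simp only [Th, one_mul]
  refine tsum_congr fun ℓ => ?_
  rw [tt, tt, Complex.exp_eq_exp_iff_exists_int]
  refine ⟨hn B ℓ, ?_⟩
  rw [hn_spec hB]; push_cast; ring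

lemma Nn_zero (hB : IsLeech B) : Nn B 0 = 1 := by
  have : shell B (2 * ((0 : ℕ) : ℤ)) = {0} := by
    ext ℓ
    simp only [shell, Set.mem_ofPred_eq, Set.mem_singleton_iff]
    constructor
    · intro h; exact pz_eq_zero hB (by simpa using h)
    · rintro rfl; simp [pz_zero_left]
  rw [Nn, this]; simp
lemma Nn_one (hB : IsLeech B) : Nn B 1 = 0 := by
  have : shell B (2 * ((1 : ℕ) : ℤ)) = ∅ := by
    ext ℓ
    simp only [shell, Set.mem_ofPred_eq, Set.mem_empty_iff_false, iff_false]
    simpa using hB.2.2.2.2 ℓ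
  rw [Nn, this]; simp

lemma counts (hB : IsLeech B) : Nn B 2 = 196560 ∧ Nn B 3 = 16773120 ∧ Nn B 4 = 398034000 := by
  obtain ⟨F, hF⟩ := mkMF (k := 12) (f := fun τ : ℍ => Th B (fun _ => 1) τ 0) (by
      rw [UpperHalfPlane.mdifferentiable_iff]
      intro τ hτ
      have h1 := Th_differentiableAt hB (w := fun _ => 1) (C := 1) (fun _ => by simp) hτ 0
      have h2 : DifferentiableAt ℂ (fun τ : ℂ => Th B (fun _ => 1) τ 0) τ :=
        h1.comp (f := fun τ : ℂ => (τ, (0 : CV))) τ (by fun_prop)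
      refine (h2.differentiableWithinAt).congr_of_eventuallyEq_of_mem ?_ hτ
      filter_upwards [self_mem_nhdsWithin] with y hy
      simp [ofComplex_apply_of_im_pos hy])
    (fun τ => by
      have := theta_S hB τ.2 0
      simp only [smul_zero] at this
      rw [coe_Smul, this]
      simp [pairC]
      )
    (fun τ => by rw [coe_Tmul]; exact theta0_T hB _ _)
    (isBoundedAtImInfty_of_hasSum_qExpansion one_pos (theta0_hasSum hB))
  have hq : ∀ n, (Nn B n : ℂ) = (qExpansion 1 F).coeff n := fun n =>
    ModularFormClass.qExpansion_coeff_unique one_pos one_mem_strictPeriods_SL (f := F) (fun τ => by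
      rw [hF]; exact theta0_hasSum hB τ) n
  obtain ⟨X, hX⟩ : ∃ X : ModularForm 𝒮ℒ 12, X = ModularForm.mcast (by decide) (E₄.pow 3) := ⟨_, rfl⟩
  obtain ⟨Y, hY⟩ : ∃ X : ModularForm 𝒮ℒ 12, X = ModularForm.mcast (by decide) (E₆.pow 2) := ⟨_, rfl⟩
  have hXq : qExpansion 1 X = qExpansion 1 E₄ * (qExpansion 1 E₄ * qExpansion 1 E₄) := by
    rw [hX, coe_mcast, ModularForm.qExpansion_pow one_pos one_mem_strictPeriods_SL]; ring
  have hYq : qExpansion 1 Y = qExpansion 1 E₆ * qExpansion 1 E₆ := by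
    rw [hY, coe_mcast, ModularForm.qExpansion_pow one_pos one_mem_strictPeriods_SL]; ring
  have e4 : ∀ m, (qExpansion 1 E₄).coeff m = if m = 0 then 1 else 240 * (ArithmeticFunction.sigma 3 m : ℂ) := fun m => by
    rw [EisensteinSeries.E_qExpansion_coeff _ ⟨2, rfl⟩, show bernoulli 4 = -1 / 30 by decide +kernel]
    norm_num
  have e6 : ∀ m, (qExpansion 1 E₆).coeff m = if m = 0 then 1 else -504 * (ArithmeticFunction.sigma 5 m : ℂ) := fun m => by
    rw [EisensteinSeries.E_qExpansion_coeff _ ⟨3, rfl⟩, show bernoulli 6 = 1 / 42 by decide +kernel]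
    norm_num
  have a40 := e4 0
  have a41 := e4 1
  have a42 := e4 2
  have a43 := e4 3
  have a44 := e4 4
  have a60 := e6 0
  have a61 := e6 1
  have a62 := e6 2
  have a63 := e6 3
  have a64 := e6 4
  rw [if_neg (by norm_num), show ArithmeticFunction.sigma 3 1 = 1 by decide +kernel] at a41
  rw [if_neg (by norm_num), show ArithmeticFunction.sigma 3 2 = 9 by decide +kernel] at a42
  rw [if_neg (by norm_num), show ArithmeticFunction.sigma 3 3 = 28 by decide +kernel] at a43
  rw [if_neg (by norm_num), show ArithmeticFunction.sigma 3 4 = 73 by decide +kernel] at a44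
  rw [if_neg (by norm_num), show ArithmeticFunction.sigma 5 1 = 1 by decide +kernel] at a61
  rw [if_neg (by norm_num), show ArithmeticFunction.sigma 5 2 = 33 by decide +kernel] at a62
  rw [if_neg (by norm_num), show ArithmeticFunction.sigma 5 3 = 244 by decide +kernel] at a63
  rw [if_neg (by norm_num), show ArithmeticFunction.sigma 5 4 = 1057 by decide +kernel] at a64
  rw [if_pos rfl] at a40 a60
  have hDq : qExpansion 1 (F - ((7/12 : ℂ) • X + (5/12 : ℂ) • Y)) =
      qExpansion 1 F - ((7/12 : ℂ) • qExpansion 1 X + (5/12 : ℂ) • qExpansion 1 Y) := by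
    have h1 := ModularForm.qExpansion_sub one_pos one_mem_strictPeriods_SL F ((7/12 : ℂ) • X + (5/12 : ℂ) • Y)
    have h2 := ModularForm.qExpansion_add one_pos one_mem_strictPeriods_SL ((7/12 : ℂ) • X) ((5/12 : ℂ) • Y)
    have h3 := ModularForm.qExpansion_smul one_pos one_mem_strictPeriods_SL (7/12 : ℂ) X
    have h4 := ModularForm.qExpansion_smul one_pos one_mem_strictPeriods_SL (5/12 : ℂ) Y
    rw [← h3, ← h4]
    exact h1.trans (congrArg _ h2)
  have hD : F - ((7/12 : ℂ) • X + (5/12 : ℂ) • Y) = 0 := by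
    apply ModularForm.sturm_bound_levelOne
    have : (2 : ℕ∞) ≤ (qExpansion 1 (F - ((7/12 : ℂ) • X + (5/12 : ℂ) • Y) : ModularForm 𝒮ℒ 12)).order := by
      apply PowerSeries.le_order
      intro i hi
      have hi' : i < 2 := by exact_mod_cast hi
      change (PowerSeries.coeff i) (qExpansion 1 (⇑F - ((7/12 : ℂ) • ⇑X + (5/12 : ℂ) • ⇑Y))) = 0
      rw [hDq, hXq, hYq, map_sub, map_add, PowerSeries.coeff_smul, PowerSeries.coeff_smul, ← hq]
      interval_cases i
      · simp [Nn_zero hB, PowerSeries.coeff_mul, -PowerSeries.coeff_zero_eq_constantCoeff, a40, a60]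
        norm_num
      · simp [Nn_one hB, PowerSeries.coeff_mul, -PowerSeries.coeff_zero_eq_constantCoeff, a40, a60, a41, a61, Finset.Nat.antidiagonal_succ]
        norm_num
    refine lt_of_lt_of_le ?_ this
    rw [show ((12 : ℤ).toNat / 12 : ℕ) = 1 from rfl]
    exact_mod_cast (by norm_num : (1 : ℕ) < 2)
  have hf : ∀ n, (qExpansion 1 F).coeff n = (7/12 : ℂ) * (qExpansion 1 X).coeff n + (5/12 : ℂ) * (qExpansion 1 Y).coeff n := by
    intro n
    have h1 : qExpansion 1 (⇑F - ((7/12 : ℂ) • ⇑X + (5/12 : ℂ) • ⇑Y)) = 0 := by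
      change qExpansion 1 (⇑(F - ((7/12 : ℂ) • X + (5/12 : ℂ) • Y))) = 0
      rw [hD]; exact qExpansion_zero 1
    have h2 := hDq.symm.trans h1
    have h3 := congrArg (PowerSeries.coeff n) h2
    rw [map_sub, map_add, PowerSeries.coeff_smul, PowerSeries.coeff_smul, map_zero] at h3
    simp only [smul_eq_mul] at h3
    linear_combination h3
  have key : ∀ n, (Nn B n : ℂ) = (7/12 : ℂ) * (qExpansion 1 X).coeff n + (5/12 : ℂ) * (qExpansion 1 Y).coeff n := by
    intro n; rw [hq, hf]
  rw [hXq, hYq] at key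
  refine ⟨?_, ?_, ?_⟩ <;> [have := key 2; have := key 3; have := key 4] <;>
  · rw [PowerSeries.coeff_mul, PowerSeries.coeff_mul] at this
    simp only [Finset.Nat.antidiagonal_succ, PowerSeries.coeff_mul, Finset.Nat.antidiagonal_zero, Finset.map_singleton,
      Finset.sum_cons, Finset.sum_singleton, Finset.map_cons, Function.Embedding.prodMap, Function.Embedding.coeFn_mk,
      Prod.map, Function.Embedding.refl_apply, Nat.succ_eq_add_one, zero_add, Nat.reduceAdd, a40, a41, a42, a43, a44, a60, a61, a62, a63, a64] at this
    norm_num at this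
    exact_mod_cast this

end theta0

section count
variable {B : Matrix (Fin 24) (Fin 24) ℤ}

/-- class modulo 2 -/
def cl (v : LV) : Fin 24 → ZMod 2 := fun i => (v i : ZMod 2)

lemma cl_eq {v w : LV} (h : cl v = cl w) : ∃ x, v = w + (2 : ℤ) • x := by
  have : ∀ i, ∃ y, v i - w i = 2 * y := by
    intro i
    have h1 := congrFun h.symm i
    simp only [cl] at h1
    have := (ZMod.intCast_eq_intCast_iff_dvd_sub (w i) (v i) 2).1 h1
    obtain ⟨y, hy⟩ := this
    exact ⟨y, by simpa using hy⟩
  choose y hy using this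
  refine ⟨y, ?_⟩
  ext i
  have := hy i
  simp; linarith

lemma cl_add_two (w x : LV) : cl (w + (2 : ℤ) • x) = cl w := by
  ext i
  simp [cl]
  left; rfl

lemma cl_surj (c : Fin 24 → ZMod 2) : ∃ v, cl v = c := by
  refine ⟨fun i => (c i).val, ?_⟩
  ext i; simp [cl]

lemma orth_card (s : Finset LV) (h8 : ∀ v ∈ s, pairZ B v v = 8)
    (ho : ∀ v ∈ s, ∀ w ∈ s, v ≠ w → pairZ B v w = 0) : s.card ≤ 24 := by
  have hli : LinearIndependent ℤ (fun v : s => (v : LV)) := by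
    rw [Fintype.linearIndependent_iff]
    intro g hg i
    have h1 : pairZ B (∑ j, g j • (j : LV)) i = 0 := by rw [hg]; exact pz_zero_left _
    rw [pz_sum_left] at h1
    simp only [pz_smul_left] at h1
    rw [Finset.sum_eq_single i] at h1
    · rw [h8 i i.2] at h1; omega
    · intro j _ hj
      rw [ho j j.2 i i.2 (fun h => hj (Subtype.ext h))]; ring
    · simp
  have := hli.fintype_card_le_finrank
  simpa using this

/-- short vectors -/
lemma short_finite (hB : IsLeech B) : {ℓ : LV | pairZ B ℓ ℓ ≤ 8}.Finite := by
  refine Set.Finite.subset (Set.Finite.biUnion (Set.finite_Icc (0 : ℤ) 8) (fun m _ => shell_finite hB m)) ?_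
  intro ℓ hℓ
  simp only [Set.mem_iUnion]
  exact ⟨pairZ B ℓ ℓ, ⟨pz_nonneg hB ℓ, hℓ⟩, rfl⟩

def wtn (n : ℕ) : ℕ := if n = 0 then 48 else if n = 1 then 0 else if n = 4 then 1 else 24

lemma lt_eight_cases (hB : IsLeech B) (v : LV) (h : pairZ B v v < 8) : v = 0 ∨ (hn B v = 2 ∨ hn B v = 3) := by
  have h1 := hn_spec hB v
  have h2 := hB.2.2.2.2 v
  by_cases h3 : hn B v = 0
  · left; exact pz_eq_zero hB (by omega)
  · right; omega

/-- half -/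
def posv (s : Finset LV) : Finset LV := open Classical in s.filter fun v => Encodable.encode v < Encodable.encode (-v)

lemma posv_card (s : Finset LV) (hs : ∀ v ∈ s, -v ∈ s) (h0 : (0 : LV) ∉ s) : s.card = 2 * (posv s).card := by
  classical
  have h1 : s = posv s ∪ (posv s).image (fun v => -v) := by
    ext v
    simp only [posv, Finset.mem_union, Finset.mem_filter, Finset.mem_image]
    constructor
    · intro hv
      rcases lt_trichotomy (Encodable.encode v) (Encodable.encode (-v)) with h | h | h
      · exact Or.inl ⟨hv, h⟩
      · have := Encodable.encode_injective h
        have h2 : v = 0 := by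
          ext i; have := congrFun this i; simp at this; simp; omega
        exact absurd (h2 ▸ hv) h0
      · exact Or.inr ⟨-v, ⟨hs v hv, by simpa using h⟩, by simp⟩
    · rintro (h | ⟨w, hw, rfl⟩)
      · exact h.1
      · exact hs w hw.1
  have h2 : Disjoint (posv s) ((posv s).image (fun v => -v)) := by
    rw [Finset.disjoint_left]
    intro v hv hv'
    simp only [posv, Finset.mem_filter, Finset.mem_image] at hv hv'
    obtain ⟨w, hw, rfl⟩ := hv'
    have := hv.2
    simp at this
    exact lt_asymm this hw.2
  conv_lhs => rw [h1]
  rw [Finset.card_union_of_disjoint h2, Finset.card_image_of_injective _ neg_injective]; ring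

lemma posv_orth (hB : IsLeech B) (s : Finset LV) (h8 : ∀ v ∈ s, pairZ B v v = 8)
    (hc : ∀ v ∈ s, ∀ w ∈ s, ∃ x, v = w + (2 : ℤ) • x) :
    ∀ v ∈ posv s, ∀ w ∈ posv s, v ≠ w → pairZ B v w = 0 := by
  intro v hv w hw hne
  simp only [posv, Finset.mem_filter] at hv hw
  obtain ⟨x, hx⟩ := hc v hv.1 w hw.1
  rcases congr_short hB (h8 v hv.1).le (h8 w hw.1).le hx with h | h | h
  · exact absurd h hne
  · subst h; have := hv.2; simp at this; exact absurd this (lt_asymm hw.2)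
  · exact h.2.2


/-- short vectors in a class -/
def clsF (hB : IsLeech B) (c : Fin 24 → ZMod 2) : Finset LV :=
  open Classical in (short_finite hB).toFinset.filter fun v => cl v = c

lemma mem_clsF (hB : IsLeech B) (c : Fin 24 → ZMod 2) (v : LV) :
    v ∈ clsF hB c ↔ pairZ B v v ≤ 8 ∧ cl v = c := by
  simp [clsF]

lemma cl_neg (v : LV) : cl (-v) = cl v := by
  have : -v = v + (2 : ℤ) • (-v) := by ext i; simp; ring
  rw [this, cl_add_two]

lemma clsF_eight (hB : IsLeech B) (c : Fin 24 → ZMod 2) (h : ∀ v ∈ clsF hB c, pairZ B v v = 8) :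
    (clsF hB c).card = 2 * (posv (clsF hB c)).card ∧ (posv (clsF hB c)).card ≤ 24 ∧
    ∑ v ∈ clsF hB c, wtn (hn B v) = (clsF hB c).card := by
  refine ⟨posv_card _ ?_ ?_, ?_, ?_⟩
  · intro v hv
    rw [mem_clsF] at hv ⊢
    rw [cl_neg, pz_neg_left, pz_neg_right]
    simpa using hv
  · intro h0
    have := h 0 h0
    rw [pz_zero_left] at this; omega
  · refine orth_card (B := B) _ ?_ (posv_orth hB _ h ?_)
    · intro v hv
      simp only [posv, Finset.mem_filter] at hv
      exact h v hv.1
    · intro v hv w hw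
      rw [mem_clsF] at hv hw
      exact cl_eq (hv.2.trans hw.2.symm)
  · rw [Finset.card_eq_sum_ones]
    refine Finset.sum_congr rfl fun v hv => ?_
    have h1 := h v hv
    have h2 := hn_spec hB v
    have : hn B v = 4 := by omega
    rw [this]; rfl

lemma clsF_le (hB : IsLeech B) (c : Fin 24 → ZMod 2) : ∑ v ∈ clsF hB c, wtn (hn B v) ≤ 48 := by
  classical
  by_cases h : ∀ v ∈ clsF hB c, pairZ B v v = 8
  · obtain ⟨h1, h2, h3⟩ := clsF_eight hB c h
    omega
  · push Not at h
    obtain ⟨v, hv, hv8⟩ := h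
    rw [mem_clsF] at hv
    have hsub : clsF hB c ⊆ {v, -v} := by
      intro w hw
      rw [mem_clsF] at hw
      obtain ⟨x, hx⟩ := cl_eq (hw.2.trans hv.2.symm)
      rcases congr_short hB hw.1 hv.1 hx with h | h | h
      · simp [h]
      · simp [h]
      · exact absurd h.2.1 hv8
    refine (Finset.sum_le_sum_of_subset hsub).trans ?_
    rcases lt_eight_cases hB v (by omega) with h0 | h0
    · subst h0
      have : hn B 0 = 0 := by
        have := hn_spec hB 0
        rw [pz_zero_left] at this; omega
      simp [this, wtn]
    · have e : hn B (-v) = hn B v := by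
        have h1 := hn_spec hB (-v)
        have h2 := hn_spec hB v
        rw [pz_neg_left, pz_neg_right] at h1
        omega
      refine (Finset.sum_le_card_nsmul _ _ 24 ?_).trans ?_
      · intro w hw
        have : hn B w = hn B v := by
          simp only [Finset.mem_insert, Finset.mem_singleton] at hw
          rcases hw with rfl | rfl
          · rfl
          · exact e
        rw [this]
        rcases h0 with h0 | h0 <;> rw [h0] <;> decide
      · have := Finset.card_le_two (a := v) (b := -v)
        rw [smul_eq_mul]; omega

lemma cls_total (hB : IsLeech B) : ∑ c : Fin 24 → ZMod 2, ∑ v ∈ clsF hB c, wtn (hn B v) = ∑ _c : Fin 24 → ZMod 2, 48 := by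
  classical
  have h1 : ∑ c : Fin 24 → ZMod 2, ∑ v ∈ clsF hB c, wtn (hn B v) = ∑ v ∈ (short_finite hB).toFinset, wtn (hn B v) := by
    rw [← Finset.sum_fiberwise (short_finite hB).toFinset cl]
    refine Finset.sum_congr rfl fun c _ => Finset.sum_congr ?_ fun _ _ => rfl
    ext v; rw [mem_clsF]; simp
  have h2 : ∑ v ∈ (short_finite hB).toFinset, wtn (hn B v) = ∑ n ∈ Finset.range 5, Nn B n * wtn n := by
    rw [← Finset.sum_fiberwise_of_maps_to (t := Finset.range 5) (g := fun v => hn B v)]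
    · refine Finset.sum_congr rfl fun n hn' => ?_
      rw [Finset.sum_congr rfl (g := fun _ => wtn n)]
      · rw [Finset.sum_const, smul_eq_mul]
        refine congrArg (· * wtn n) ?_
        have e : shell B (2 * (n:ℤ)) = ((Finset.filter (fun v => hn B v = n) (short_finite hB).toFinset : Finset LV) : Set LV) := by
          ext v
          have h1 := hn_spec hB v
          have h2 := Finset.mem_range.1 hn'
          simp only [shell, Set.mem_ofPred_eq, Finset.coe_filter, Set.Finite.mem_toFinset]
          omega
        unfold Nn
        rw [e, Nat.card_eq_fintype_card]
        simp only [Finset.coe_sort_coe, Fintype.card_coe]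
      · intro v hv; rw [(Finset.mem_filter.1 hv).2]
    · intro v hv
      simp only [Set.Finite.mem_toFinset, Set.mem_ofPred_eq] at hv
      have := hn_spec hB v
      simp; omega
  rw [h1, h2]
  obtain ⟨h3, h4, h5⟩ := counts hB
  simp only [Finset.sum_range_succ, Finset.sum_range_zero, h3, h4, h5, Nn_zero hB, Nn_one hB, Finset.sum_const, Finset.card_univ, Fintype.card_fun, ZMod.card, Fintype.card_fin]
  norm_num [wtn]

lemma cls_eq (hB : IsLeech B) (c : Fin 24 → ZMod 2) : ∑ v ∈ clsF hB c, wtn (hn B v) = 48 :=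
  (Finset.sum_eq_sum_iff_of_le (fun c _ => clsF_le hB c)).1 (cls_total hB) c (Finset.mem_univ c)

lemma short_rep (hB : IsLeech B) (v : LV) : ∃ w x, v = w + (2 : ℤ) • x ∧ pairZ B w w ≤ 8 := by
  have h := cls_eq hB (cl v)
  have hne : (clsF hB (cl v)).Nonempty := by
    rw [Finset.nonempty_iff_ne_empty]; intro h0; rw [h0] at h; simp at h
  obtain ⟨w, hw⟩ := hne
  rw [mem_clsF] at hw
  obtain ⟨x, hx⟩ := cl_eq hw.2.symm
  exact ⟨w, x, hx, hw.1⟩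

lemma exists_norm8 (hB : IsLeech B) : ∃ g, pairZ B g g = 8 := by
  have h := (counts hB).2.2
  have : Nonempty (shell B (2 * (4:ℕ))) := by
    by_contra hne
    rw [not_nonempty_iff] at hne
    have h' : Nn B 4 = 0 := Nat.card_of_isEmpty
    rw [h'] at h
    norm_num at h
  obtain ⟨g, hg⟩ := this
  exact ⟨g, by simpa [shell] using hg⟩

lemma frames (hB : IsLeech B) : Frames B := by
  intro g hg
  have h8 : ∀ v ∈ clsF hB (cl g), pairZ B v v = 8 := by
    intro w hw
    rw [mem_clsF] at hw
    obtain ⟨x, hx⟩ := cl_eq hw.2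
    rcases congr_short hB hw.1 hg.le hx with h | h | h
    · rw [h, hg]
    · rw [h, pz_neg_left, pz_neg_right, hg]; rfl
    · exact h.1
  obtain ⟨h1, h2, h3⟩ := clsF_eight hB _ h8
  have h4 : (posv (clsF hB (cl g))).card = 24 := by
    have := cls_eq hB (cl g); omega
  have hmem : ∀ v ∈ posv (clsF hB (cl g)), v ∈ clsF hB (cl g) := by
    intro v hv
    simp only [posv, Finset.mem_filter] at hv
    exact hv.1
  have ho := posv_orth hB _ h8 (fun v hv w hw => by
      rw [mem_clsF] at hv hw
      exact cl_eq (hv.2.trans hw.2.symm))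
  have e := Finset.equivFinOfCardEq h4
  refine ⟨fun i => (e.symm i : LV), ⟨?_, ?_⟩, ?_⟩
  · intro i j
    by_cases hij : i = j
    · subst hij
      simp only [if_true]
      exact h8 _ (hmem _ (e.symm i).2)
    · simp only [hij, if_false]
      exact ho _ (e.symm i).2 _ (e.symm j).2 (fun h => hij (e.symm.injective (Subtype.ext h)))
  · intro i j
    have hi := hmem _ (e.symm i).2
    have hj := hmem _ (e.symm j).2
    rw [mem_clsF] at hi hj
    exact cl_eq (hi.2.trans hj.2.symm)
  · intro h x hh hx
    have hc : cl h = cl g := by rw [hx, cl_add_two]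
    have hs : h ∈ clsF hB (cl g) := (mem_clsF hB _ _).2 ⟨hh.le, hc⟩
    have hs' : -h ∈ clsF hB (cl g) := (mem_clsF hB _ _).2 ⟨by rw [pz_neg_left, pz_neg_right, hh]; norm_num, by rw [cl_neg, hc]⟩
    rcases lt_trichotomy (Encodable.encode h) (Encodable.encode (-h)) with hl | hl | hl
    · have : h ∈ posv (clsF hB (cl g)) := by
        simp only [posv, Finset.mem_filter]; exact ⟨hs, hl⟩
      exact ⟨e ⟨h, this⟩, 1, Or.inl rfl, by simp⟩
    · have h5 := Encodable.encode_injective hl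
      have h6 : h = 0 := by
        ext i; have := congrFun h5 i; simp at this; simp; omega
      rw [h6, pz_zero_left] at hh; omega
    · have : -h ∈ posv (clsF hB (cl g)) := by
        simp only [posv, Finset.mem_filter]; exact ⟨hs', by simpa using hl⟩
      exact ⟨e ⟨-h, this⟩, -1, Or.inr rfl, by simp⟩

end count

section slash
variable {B : Matrix (Fin 24) (Fin 24) ℤ}

/-- bounded even weight function -/
structure WF (w : LV → ℂ) : Prop where
  bdd : ∃ C, ∀ ℓ, ‖w ℓ‖ ≤ C
  even : ∀ ℓ, w (-ℓ) = w ℓ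

lemma WF.add {w w' : LV → ℂ} (h : WF w) (h' : WF w') : WF (fun ℓ => w ℓ + w' ℓ) := by
  obtain ⟨⟨C, hC⟩, he⟩ := h
  obtain ⟨⟨C', hC'⟩, he'⟩ := h'
  exact ⟨⟨C + C', fun ℓ => (norm_add_le _ _).trans (add_le_add (hC ℓ) (hC' ℓ))⟩, fun ℓ => by rw [he, he']⟩

lemma WF.mul {w w' : LV → ℂ} (h : WF w) (h' : WF w') : WF (fun ℓ => w ℓ * w' ℓ) := by
  obtain ⟨⟨C, hC⟩, he⟩ := h
  obtain ⟨⟨C', hC'⟩, he'⟩ := h'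
  exact ⟨⟨C * C', fun ℓ => by
    rw [norm_mul]; exact mul_le_mul (hC ℓ) (hC' ℓ) (norm_nonneg _) ((norm_nonneg _).trans (hC ℓ))⟩, fun ℓ => by rw [he, he']⟩

lemma WF.const (c : ℂ) : WF (fun _ => c) := ⟨⟨‖c‖, fun _ => le_rfl⟩, fun _ => rfl⟩

lemma WF.sum {ι : Type*} (s : Finset ι) (w : ι → LV → ℂ) (h : ∀ i ∈ s, WF (w i)) : WF (fun ℓ => ∑ i ∈ s, w i ℓ) := by
  classical
  induction s using Finset.induction_on with
  | empty => simp only [Finset.sum_empty]; exact WF.const 0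
  | insert a s ha ih =>
    simp only [Finset.sum_insert ha]
    exact (h a (by simp)).add (ih fun i hi => h i (by simp [hi]))

/-- half-argument theta -/
def Qh (B : Matrix (Fin 24) (Fin 24) ℤ) (w : LV → ℂ) (τ : ℂ) (z : CV) : ℂ := Th B w (τ / 2) z

lemma half_im {τ : ℂ} (hτ : 0 < τ.im) : 0 < (τ / 2).im := by
  have h : (τ / 2).im = τ.im / 2 := by
    simpa using Complex.div_ofNat_im τ 2
  rw [h]; linarith

lemma Qh_summable (hB : IsLeech B) {w : LV → ℂ} (hw : WF w) {τ : ℂ} (hτ : 0 < τ.im) (z : CV) :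
    Summable fun ℓ => w ℓ * tt B ℓ (τ / 2) z := by
  obtain ⟨C, hC⟩ := hw.bdd
  exact (Th_summable hB hC (half_im hτ) z).of_norm

lemma Qh_add (hB : IsLeech B) {w w' : LV → ℂ} (hw : WF w) (hw' : WF w') {τ : ℂ} (hτ : 0 < τ.im) (z : CV) :
    Qh B (fun ℓ => w ℓ + w' ℓ) τ z = Qh B w τ z + Qh B w' τ z := by
  simp only [Qh, Th, add_mul]
  exact (Qh_summable hB hw hτ z).tsum_add (Qh_summable hB hw' hτ z)

lemma Qh_smul (c : ℂ) (w : LV → ℂ) (τ : ℂ) (z : CV) :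
    Qh B (fun ℓ => c * w ℓ) τ z = c * Qh B w τ z := by
  simp only [Qh, Th, mul_assoc, tsum_mul_left]

lemma Qh_neg {w : LV → ℂ} (hw : WF w) (τ : ℂ) (z : CV) : Qh B w τ (-z) = Qh B w τ z := by
  simp only [Qh, Th]
  rw [← (Equiv.neg LV).tsum_eq]
  refine tsum_congr fun ℓ => ?_
  simp only [Equiv.neg_apply, hw.even, tt]
  rw [pz_neg_left, pz_neg_right, liftC_neg]
  have : pairC B (-liftC ℓ) (-z) = pairC B (liftC ℓ) z := by
    simp [pairC, Matrix.mulVec_neg]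
  rw [this, neg_neg]

/-- parity character -/
def chi (B : Matrix (Fin 24) (Fin 24) ℤ) (ℓ : LV) : ℂ := (-1) ^ (hn B ℓ)

lemma chi_sq (ℓ : LV) : chi B ℓ * chi B ℓ = 1 := by
  rw [chi, ← mul_pow]; simp

lemma hn_neg (ℓ : LV) : hn B (-ℓ) = hn B ℓ := by
  rw [hn, hn, pz_neg_left, pz_neg_right, neg_neg]

lemma chi_wf : WF (chi B) := ⟨⟨1, fun ℓ => by simp [chi]⟩, fun ℓ => by rw [chi, hn_neg, chi]⟩

lemma tt_T (hB : IsLeech B) (ℓ : LV) (τ : ℂ) (z : CV) : tt B ℓ ((τ + 1) / 2) z = chi B ℓ * tt B ℓ (τ / 2) z := by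
  rw [tt, tt, chi, hn_spec hB, ← Complex.exp_pi_mul_I, ← Complex.exp_nat_mul, ← Complex.exp_add]
  congr 1
  push_cast; ring

lemma Qh_T (hB : IsLeech B) (w : LV → ℂ) (τ : ℂ) (z : CV) : Qh B w (τ + 1) z = Qh B (fun ℓ => chi B ℓ * w ℓ) τ z := by
  simp only [Qh, Th]
  refine tsum_congr fun ℓ => ?_
  rw [tt_T hB]; ring

lemma Qh_T' (hB : IsLeech B) (w : LV → ℂ) (τ : ℂ) (z : CV) : Qh B (fun ℓ => chi B ℓ * w ℓ) (τ + 1) z = Qh B w τ z := by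
  rw [Qh_T hB]
  simp only [← mul_assoc, chi_sq, one_mul]

/-- S-relation -/
structure SRel (B : Matrix (Fin 24) (Fin 24) ℤ) (w w' : LV → ℂ) : Prop where
  wf : WF w
  wf' : WF w'
  eq : ∀ τ : ℂ, 0 < τ.im → ∀ z, Qh B w (-1 / τ) (τ⁻¹ • z) = τ ^ 12 * cexp (2 * π * Complex.I * pairC B z z / τ) * Qh B w' τ z

lemma S_im {τ : ℂ} (hτ : 0 < τ.im) : 0 < (-1 / τ).im := by
  have : τ ≠ 0 := by rintro rfl; simp at hτ
  have h : 0 < Complex.normSq τ := Complex.normSq_pos.2 this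
  rw [neg_div, one_div, Complex.neg_im, Complex.inv_im]
  rw [neg_div, neg_neg]; positivity

lemma SRel.symm (hB : IsLeech B) {w w' : LV → ℂ} (h : SRel B w w') : SRel B w' w := by
  refine ⟨h.wf', h.wf, fun τ hτ z => ?_⟩
  have hne : τ ≠ 0 := by rintro rfl; simp at hτ
  have := h.eq (-1 / τ) (S_im hτ) (τ⁻¹ • z)
  have e1 : -1 / (-1 / τ) = τ := by field_simp
  have e2 : (-1 / τ)⁻¹ • τ⁻¹ • z = -z := by
    rw [smul_smul, show (-1 / τ)⁻¹ * τ⁻¹ = -1 by field_simp]; simp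
  rw [e1, e2, Qh_neg h.wf, pc_smul_left, pc_smul_right] at this
  rw [this]
  have e3 : 2 * π * Complex.I * (τ⁻¹ * (τ⁻¹ * pairC B z z)) / (-1 / τ) = -(2 * π * Complex.I * pairC B z z / τ) := by
    field_simp
  rw [e3, Complex.exp_neg]
  have := Complex.exp_ne_zero (2 * π * Complex.I * pairC B z z / τ)
  field_simp

lemma SRel.add (hB : IsLeech B) {w w' v v' : LV → ℂ} (h : SRel B w w') (h' : SRel B v v') :
    SRel B (fun ℓ => w ℓ + v ℓ) (fun ℓ => w' ℓ + v' ℓ) := by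
  refine ⟨h.wf.add h'.wf, h.wf'.add h'.wf', fun τ hτ z => ?_⟩
  rw [Qh_add hB h.wf h'.wf (S_im hτ), Qh_add hB h.wf' h'.wf' hτ, h.eq τ hτ, h'.eq τ hτ]; ring

lemma SRel.smul {w w' : LV → ℂ} (c : ℂ) (h : SRel B w w') :
    SRel B (fun ℓ => c * w ℓ) (fun ℓ => c * w' ℓ) := by
  refine ⟨(WF.const c).mul h.wf, (WF.const c).mul h.wf', fun τ hτ z => ?_⟩
  rw [Qh_smul, Qh_smul, h.eq τ hτ]; ring

lemma SRel.sum (hB : IsLeech B) {ι : Type*} (s : Finset ι) (w w' : ι → LV → ℂ) (h : ∀ i ∈ s, SRel B (w i) (w' i)) :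
    SRel B (fun ℓ => ∑ i ∈ s, w i ℓ) (fun ℓ => ∑ i ∈ s, w' i ℓ) := by
  classical
  induction s using Finset.induction_on with
  | empty =>
    simp only [Finset.sum_empty]
    refine ⟨WF.const 0, WF.const 0, fun τ hτ z => by simp [Qh, Th]⟩
  | insert a s ha ih =>
    simp only [Finset.sum_insert ha]
    exact (h a (by simp)).add hB (ih fun i hi => h i (by simp [hi]))

lemma SRel.STS (hB : IsLeech B) {w a b : LV → ℂ} (h1 : SRel B w a) (h2 : SRel B (fun ℓ => chi B ℓ * a ℓ) b) :
    SRel B (fun ℓ => chi B ℓ * w ℓ) (fun ℓ => chi B ℓ * b ℓ) := by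
  refine ⟨chi_wf.mul h1.wf, chi_wf.mul h2.wf', fun τ hτ z => ?_⟩
  have hne : τ ≠ 0 := by rintro rfl; simp at hτ
  have hτ1 : 0 < (τ - 1).im := by simpa using hτ
  have hne1 : τ - 1 ≠ 0 := by intro h; rw [h] at hτ1; simp at hτ1
  obtain ⟨σ, hσ⟩ : ∃ σ, σ = -1 / (τ - 1) - 1 := ⟨_, rfl⟩
  have hσi : 0 < σ.im := by rw [hσ]; simpa using S_im hτ1
  have hσ' : σ = - τ / (τ - 1) := by rw [hσ]; field_simp; ring
  have hσ0 : σ ≠ 0 := by rw [hσ']; exact div_ne_zero (neg_ne_zero.2 hne) hne1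
  rw [← Qh_T hB]
  have e1 : -1 / τ + 1 = -1 / σ := by rw [hσ']; field_simp; ring
  have e2 : τ⁻¹ • z = σ⁻¹ • ((τ - 1)⁻¹ • (-z)) := by
    rw [smul_smul, smul_neg, ← _root_.neg_smul]; congr 1; rw [hσ']; field_simp
  rw [e1, e2, h1.eq σ hσi, ← Qh_T' hB a]
  have e3 : σ + 1 = -1 / (τ - 1) := by rw [hσ]; ring
  rw [e3, h2.eq _ hτ1, Qh_neg h2.wf', ← Qh_T' hB b, sub_add_cancel]
  rw [pc_smul_left, pc_smul_right]
  have e4 : pairC B (-z) (-z) = pairC B z z := by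
    rw [show -z = (-1 : ℂ) • z by simp, pc_smul_left, pc_smul_right]; ring
  rw [e4]
  have e5 : 2 * π * Complex.I * pairC B z z / τ = 2 * π * Complex.I * ((τ - 1)⁻¹ * ((τ - 1)⁻¹ * pairC B z z)) / σ + 2 * π * Complex.I * pairC B z z / (τ - 1) := by
    rw [hσ']; field_simp; ring
  rw [e5, Complex.exp_add]
  have e6 : τ ^ 12 = σ ^ 12 * (τ - 1) ^ 12 := by
    rw [← mul_pow, hσ', div_mul_cancel₀ _ hne1]; ring
  rw [e6]; ring

/-- indicator of a class mod 2 -/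
def ind (γ ℓ : LV) : ℂ := if cl ℓ = cl γ then 1 else 0

/-- sign character -/
def sgc (B : Matrix (Fin 24) (Fin 24) ℤ) (γ ℓ : LV) : ℂ := (-1) ^ (pairZ B γ ℓ)

lemma ind_wf (γ : LV) : WF (ind γ) := by
  refine ⟨⟨1, fun ℓ => ?_⟩, fun ℓ => by rw [ind, ind, cl_neg]⟩
  rw [ind]; split_ifs <;> simp

lemma sgc_wf (γ : LV) : WF (sgc B γ) := by
  refine ⟨⟨1, fun ℓ => ?_⟩, fun ℓ => ?_⟩
  · rw [sgc]; simp
  · rw [sgc, sgc, pz_neg_right, _root_.zpow_neg, ← _root_.inv_zpow]; norm_num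

lemma Qh_ind (hB : IsLeech B) (γ : LV) (τ : ℂ) (z : CV) :
    Qh B (ind γ) τ z = cexp (π * Complex.I * pairZ B γ γ * τ / 2 + 2 * π * Complex.I * pairC B (liftC γ) z) *
      Th B (fun _ => 1) (2 * τ) ((2 : ℂ) • z + τ • liftC γ) := by
  have hinj : Function.Injective (fun x : LV => γ + (2 : ℤ) • x) := by
    intro x y h
    ext i
    have := congrFun h i
    simpa using this
  have h1 : Function.support (fun ℓ => ind γ ℓ * tt B ℓ (τ / 2) z) ⊆ Set.range (fun x : LV => γ + (2 : ℤ) • x) := by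
    intro ℓ hℓ
    have : cl ℓ = cl γ := by
      by_contra h
      exact hℓ (by simp [ind, h])
    obtain ⟨x, hx⟩ := cl_eq this
    exact ⟨x, hx.symm⟩
  rw [Qh, Th, ← hinj.tsum_eq h1, Th, ← tsum_mul_left]
  refine tsum_congr fun x => ?_
  rw [ind, if_pos (cl_add_two γ x), one_mul, one_mul, tt, tt, ← Complex.exp_add]
  congr 1
  have e : liftC (γ + (2 : ℤ) • x) = liftC γ + (2 : ℂ) • liftC x := by
    ext i; simp [liftC]
  rw [e]
  simp only [pz_add_left, pz_add_right, pz_smul_left, pz_smul_right, pc_add_left, pc_add_right, pc_smul_left, pc_smul_right, pc_lift]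
  rw [pz_comm hB γ x]
  push_cast
  ring

lemma SRel_ind (hB : IsLeech B) (γ : LV) : SRel B (ind γ) (fun ℓ => (2 : ℂ)⁻¹ ^ 12 * sgc B γ ℓ) := by
  refine ⟨ind_wf γ, (WF.const _).mul (sgc_wf γ), fun τ hτ z => ?_⟩
  have hne : τ ≠ 0 := by rintro rfl; simp at hτ
  rw [Qh_smul, Qh_ind hB]
  have h := theta_S hB (half_im hτ) (z + (-(1/2 : ℂ)) • liftC γ)
  have e1 : -1 / (τ / 2) = 2 * (-1 / τ) := by field_simp
  have e2 : (τ / 2)⁻¹ • (z + (-(1/2 : ℂ)) • liftC γ) = (2 : ℂ) • τ⁻¹ • z + (-1 / τ) • liftC γ := by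
    rw [smul_add, smul_smul, smul_smul]
    congr 2
    · field_simp
    · field_simp
  rw [e1, e2] at h
  rw [h]
  have e3 : Th B (fun _ => 1) (τ / 2) (z + (-(1/2 : ℂ)) • liftC γ) = Qh B (sgc B γ) τ z := by
    rw [Qh, Th, Th]
    refine tsum_congr fun ℓ => ?_
    have : sgc B γ ℓ = cexp (-(π * Complex.I * pairZ B γ ℓ)) := by
      rw [sgc, Complex.exp_neg, mul_comm (π * Complex.I) _, Complex.exp_int_mul, Complex.exp_pi_mul_I, ← _root_.inv_zpow]; norm_num
    rw [this, tt, tt, one_mul, ← Complex.exp_add]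
    congr 1
    simp only [pc_add_right, pc_smul_right, pc_lift]
    rw [pz_comm hB γ ℓ]; ring
  rw [e3]
  have e4 : cexp (2 * π * Complex.I * pairC B z z / τ) = cexp (π * Complex.I * pairZ B γ γ * (-1 / τ) / 2 + 2 * π * Complex.I * pairC B (liftC γ) (τ⁻¹ • z)) * cexp (π * Complex.I * pairC B (z + (-(1/2 : ℂ)) • liftC γ) (z + (-(1/2 : ℂ)) • liftC γ) / (τ / 2)) := by
    rw [← Complex.exp_add]
    congr 1
    simp only [pc_add_left, pc_add_right, pc_smul_left, pc_smul_right, pc_lift]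
    rw [pc_comm hB z (liftC γ)]
    field_simp
    ring
  rw [e4]; ring

end slash

section slash2
variable {B : Matrix (Fin 24) (Fin 24) ℤ}

lemma Qh_unique (hB : IsLeech B) {w : LV → ℂ} (hw : WF w) {τ : ℂ} (hτ : 0 < τ.im)
    (h : ∀ z, Qh B w τ z = 0) (ℓ : LV) : w ℓ = 0 := by
  have e : ∀ ℓ z, w ℓ * tt B ℓ (τ / 2) z = (w ℓ * cexp (π * Complex.I * pairZ B ℓ ℓ * (τ / 2))) * cexp (2 * π * Complex.I * pairC B (liftC ℓ) z) := by
    intro ℓ z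
    rw [tt, Complex.exp_add]; ring
  have e0 : ∀ ℓ, w ℓ * tt B ℓ (τ / 2) 0 = w ℓ * cexp (π * Complex.I * pairZ B ℓ ℓ * (τ / 2)) := by
    intro ℓ; rw [e]; simp [pairC]
  have hs : Summable fun ℓ => ‖w ℓ * cexp (π * Complex.I * pairZ B ℓ ℓ * (τ / 2))‖ := by
    have := (Qh_summable hB hw hτ 0).norm
    simpa only [e0] using this
  have h2 : w ℓ * cexp (π * Complex.I * pairZ B ℓ ℓ * (τ / 2)) = 0 :=
    four_unique (a := fun ℓ => w ℓ * cexp (π * Complex.I * pairZ B ℓ ℓ * (τ / 2))) hB hs (fun z => by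
    have := h z
    simp only [Qh, Th, e] at this
    exact this) ℓ
  exact (mul_eq_zero.1 h2).resolve_right (Complex.exp_ne_zero _)

lemma hn_congr (hB : IsLeech B) {v w : LV} (h : cl v = cl w) : ∃ m : ℤ, (hn B v : ℤ) = hn B w + 2 * m := by
  obtain ⟨x, rfl⟩ := cl_eq h
  have h1 := hn_spec hB (w + (2 : ℤ) • x)
  have h2 := hn_spec hB w
  simp only [pz_add_left, pz_add_right, pz_smul_left, pz_smul_right] at h1
  rw [pz_comm hB x w] at h1
  exact ⟨pairZ B w x + pairZ B x x, by linarith⟩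

lemma chi_congr (hB : IsLeech B) {v w : LV} (h : cl v = cl w) : chi B v = chi B w := by
  obtain ⟨m, hm⟩ := hn_congr hB h
  rw [chi, chi, ← zpow_natCast, hm, zpow_add₀ (by norm_num), _root_.zpow_mul]
  simp

lemma sgc_congr {γ v w : LV} (h : cl v = cl w) : sgc B γ v = sgc B γ w := by
  obtain ⟨x, rfl⟩ := cl_eq h
  rw [sgc, sgc, pz_add_right, pz_smul_right, zpow_add₀ (by norm_num), _root_.zpow_mul]
  simp

open Classical in
/-- indicator of type 2 -/
def w2 (B : Matrix (Fin 24) (Fin 24) ℤ) (ℓ : LV) : ℂ := if ∃ γ, pairZ B γ γ = 4 ∧ cl ℓ = cl γ then 1 else 0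

lemma w2_of (ℓ γ : LV) (h : pairZ B γ γ = 4) (h' : cl ℓ = cl γ) : w2 B ℓ = 1 := by
  rw [w2, if_pos ⟨γ, h, h'⟩]

lemma w2_sum (hB : IsLeech B) (ℓ : LV) : w2 B ℓ = (1/2 : ℂ) * ∑ γ ∈ (shell_finite hB 4).toFinset, ind γ ℓ := by
  classical
  by_cases h : ∃ γ, pairZ B γ γ = 4 ∧ cl ℓ = cl γ
  · obtain ⟨γ, h1, h2⟩ := h
    rw [w2_of ℓ γ h1 h2]
    have hne : γ ≠ -γ := by
      intro h
      have : γ = 0 := by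
        ext i; have := congrFun h i; simp at this; simp; omega
      rw [this, pz_zero_left] at h1; omega
    rw [← Finset.sum_subset (s₁ := {γ, -γ})]
    · rw [Finset.sum_pair hne, ind, ind, cl_neg, if_pos h2]; norm_num
    · intro v hv
      simp only [Finset.mem_insert, Finset.mem_singleton] at hv
      simp only [Set.Finite.mem_toFinset, shell, Set.mem_ofPred_eq]
      rcases hv with rfl | rfl
      · exact h1
      · rw [pz_neg_left, pz_neg_right, h1]; rfl
    · intro v hv hv'
      simp only [Set.Finite.mem_toFinset, shell, Set.mem_ofPred_eq] at hv
      rw [ind, if_neg]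
      intro hc
      obtain ⟨x, hx⟩ := cl_eq (hc.symm.trans h2)
      rcases congr_short hB (by omega) (by omega) hx with h | h | h
      · exact hv' (by simp [h])
      · exact hv' (by simp [h])
      · omega
  · rw [w2, if_neg h, Finset.sum_eq_zero, mul_zero]
    intro γ hγ
    simp only [Set.Finite.mem_toFinset, shell, Set.mem_ofPred_eq] at hγ
    rw [ind, if_neg]
    intro hc
    exact h ⟨γ, hγ, hc⟩

lemma w2_zero (hB : IsLeech B) {ℓ : LV} (h8 : pairZ B ℓ ℓ ≤ 8) (h4 : pairZ B ℓ ℓ ≠ 4) : w2 B ℓ = 0 := by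
  rw [w2, if_neg]
  rintro ⟨γ, h1, h2⟩
  obtain ⟨x, hx⟩ := cl_eq h2
  rcases congr_short hB h8 (by omega) hx with h | h | h
  · rw [h] at h4; exact h4 h1
  · rw [h, pz_neg_left, pz_neg_right] at h4; omega
  · omega

lemma w2_congr {v w : LV} (h : cl v = cl w) : w2 B v = w2 B w := by
  rw [w2, w2, h]

lemma w2_wf : WF (w2 B) := by
  refine ⟨⟨1, fun ℓ => ?_⟩, fun ℓ => w2_congr (cl_neg ℓ)⟩
  rw [w2]; split_ifs <;> simp

lemma chi_w2 (hB : IsLeech B) (ℓ : LV) : chi B ℓ * w2 B ℓ = w2 B ℓ := by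
  rw [w2]
  split_ifs with h
  · obtain ⟨γ, h1, h2⟩ := h
    have h3 : hn B γ = 2 := by have := hn_spec hB γ; omega
    rw [chi_congr hB h2, chi, h3]; norm_num
  · simp

lemma chi_ind (hB : IsLeech B) (ℓ : LV) : chi B ℓ * ind 0 ℓ = ind 0 ℓ := by
  rw [ind]
  split_ifs with h
  · have h3 : hn B 0 = 0 := by have := hn_spec hB 0; rw [pz_zero_left] at this; omega
    rw [chi_congr hB h, chi, h3]; norm_num
  · simp

/-- character sum -/
def K2 (hB : IsLeech B) (ℓ : LV) : ℂ := (1/2 : ℂ) * ∑ γ ∈ (shell_finite hB 4).toFinset, sgc B γ ℓ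

lemma K2_conway (hB : IsLeech B) {σ : Matrix (Fin 24) (Fin 24) ℤ} (hσ : σ ∈ ConwayGroup B) (ℓ : LV) :
    K2 hB (σ.mulVec ℓ) = K2 hB ℓ := by
  rw [K2, K2]
  congr 1
  symm
  refine Finset.sum_nbij' (fun γ => σ.mulVec γ) (fun γ => σ⁻¹.mulVec γ) ?_ ?_ ?_ ?_ ?_
  · intro γ hγ
    simp only [Set.Finite.mem_toFinset, shell, Set.mem_ofPred_eq] at hγ ⊢
    rw [conway_pair hσ, hγ]
  · intro γ hγ
    simp only [Set.Finite.mem_toFinset, shell, Set.mem_ofPred_eq] at hγ ⊢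
    rw [conway_pair (conway_inv hσ), hγ]
  · intro γ _
    rw [mulVec_mulVec, Matrix.nonsing_inv_mul _ hσ.1, one_mulVec]
  · intro γ _
    rw [mulVec_mulVec, Matrix.mul_nonsing_inv _ hσ.1, one_mulVec]
  · intro γ _
    rw [sgc, sgc, conway_pair hσ]

lemma short_chi (hB : IsLeech B) {ℓ : LV} (h : chi B ℓ ≠ 1) : ∃ w, cl ℓ = cl w ∧ pairZ B w w = 6 := by
  obtain ⟨w, x, hx, h8⟩ := short_rep hB ℓ
  have hc : cl ℓ = cl w := by rw [hx, cl_add_two]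
  refine ⟨w, hc, ?_⟩
  rw [chi_congr hB hc, chi] at h
  have h1 := hn_spec hB w
  have h2 := hB.2.2.2.2 w
  have h3 := pz_nonneg hB w
  have : hn B w ≤ 4 := by omega
  have h4 : ¬ Even (hn B w) := fun he => h he.neg_one_pow
  rw [Nat.not_even_iff] at h4
  by_contra h6
  have h7 : hn B w = 1 := by omega
  exact h2 (by omega)

lemma chi_cases (ℓ : LV) : chi B ℓ = 1 ∨ chi B ℓ = -1 := neg_one_pow_eq_or ℂ _

lemma K2_six (hB : IsLeech B) : ∃ c : ℂ, ∀ ℓ, chi B ℓ * K2 hB ℓ = K2 hB ℓ + (-c) * (1 + (-1) * chi B ℓ) := by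
  obtain ⟨g, hg⟩ := exists_norm8 hB
  by_cases h : ∃ u, pairZ B u u = 6
  · obtain ⟨u, hu⟩ := h
    refine ⟨K2 hB u, fun ℓ => ?_⟩
    by_cases h1 : chi B ℓ = 1
    · rw [h1]; ring
    · have h2 := (chi_cases ℓ).resolve_left h1
      obtain ⟨w, hw, hw6⟩ := short_chi hB h1
      obtain ⟨σ, hσ, -, h3⟩ := trans3 hB (frames hB) hg hu hw6
      have : K2 hB ℓ = K2 hB u := by
        rw [← h3, K2_conway hB hσ, K2, K2]
        simp only [sgc_congr hw]
      rw [h2, this]; ring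
  · refine ⟨0, fun ℓ => ?_⟩
    by_cases h1 : chi B ℓ = 1
    · rw [h1]; ring
    · obtain ⟨w, hw, hw6⟩ := short_chi hB h1
      exact absurd ⟨w, hw6⟩ h

lemma SRel_congr {w w' v v' : LV → ℂ} (h : SRel B w w') (h1 : ∀ ℓ, v ℓ = w ℓ) (h2 : ∀ ℓ, v' ℓ = w' ℓ) : SRel B v v' := by
  rw [funext h1, funext h2]; exact h

lemma SRel_P1 (hB : IsLeech B) : SRel B (ind 0) (fun _ => (2 : ℂ)⁻¹ ^ 12) := by
  refine SRel_congr (SRel_ind hB 0) (fun _ => rfl) fun ℓ => ?_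
  rw [sgc, pz_zero_left]; simp

lemma SRel_P2 (hB : IsLeech B) : SRel B (fun _ => 1) (fun ℓ => 2 ^ 12 * ind 0 ℓ) := by
  refine SRel_congr (((SRel_P1 hB).smul (2 ^ 12)).symm hB) (fun _ => by norm_num) (fun _ => rfl)

lemma SRel_P3 (hB : IsLeech B) : SRel B (chi B) (chi B) := by
  have h2 : SRel B (fun ℓ => chi B ℓ * (2 ^ 12 * ind 0 ℓ)) (fun _ => 1) := by
    refine SRel_congr ((SRel_P2 hB).symm hB) (fun ℓ => ?_) (fun _ => rfl)
    rw [mul_left_comm, chi_ind hB]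
  exact SRel_congr ((SRel_P2 hB).STS hB h2) (fun _ => by simp) (fun _ => by simp)

lemma SRel_w2K (hB : IsLeech B) : SRel B (w2 B) (fun ℓ => (2 : ℂ)⁻¹ ^ 12 * K2 hB ℓ) := by
  refine SRel_congr ((SRel.sum hB (shell_finite hB 4).toFinset (fun γ => ind γ) _ (fun γ _ => SRel_ind hB γ)).smul (1/2))
    (fun ℓ => w2_sum hB ℓ) (fun ℓ => ?_)
  rw [K2, ← Finset.mul_sum]; ring

lemma SRel_W (hB : IsLeech B) : SRel B (w2 B) (fun ℓ => w2 B ℓ + 24 * ind 0 ℓ + (-24 * (2 : ℂ)⁻¹ ^ 12)) := by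
  obtain ⟨c, hc⟩ := K2_six hB
  have hK := (SRel_w2K hB).symm hB
  have h2 : SRel B (fun ℓ => chi B ℓ * ((2 : ℂ)⁻¹ ^ 12 * K2 hB ℓ))
      (fun ℓ => w2 B ℓ + ((-c * (2 : ℂ)⁻¹ ^ 12) * (2 ^ 12 * ind 0 ℓ) + (c * (2 : ℂ)⁻¹ ^ 12) * chi B ℓ)) := by
    refine SRel_congr (hK.add hB (((SRel_P2 hB).smul (-c * (2 : ℂ)⁻¹ ^ 12)).add hB ((SRel_P3 hB).smul (c * (2 : ℂ)⁻¹ ^ 12)))) (fun ℓ => ?_) (fun _ => rfl)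
    rw [mul_left_comm, hc]; ring
  have h3 := (SRel_w2K hB).STS hB h2
  have h4 : SRel B (w2 B) (fun ℓ => w2 B ℓ + (-c) * ind 0 ℓ + c * (2 : ℂ)⁻¹ ^ 12) := by
    refine SRel_congr h3 (fun ℓ => (chi_w2 hB ℓ).symm) (fun ℓ => ?_)
    have e1 := chi_w2 hB ℓ
    have e2 := chi_ind hB ℓ
    have e3 := chi_sq (B := B) ℓ
    linear_combination (-1 : ℂ) * e1 + c * e2 - c * (2 : ℂ)⁻¹ ^ 12 * e3
  have h5 : ∀ ℓ, (2 : ℂ)⁻¹ ^ 12 * K2 hB ℓ = w2 B ℓ + (-c) * ind 0 ℓ + c * (2 : ℂ)⁻¹ ^ 12 := by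
    intro ℓ
    have h6 := ((SRel_w2K hB).smul (-1)).add hB h4
    have hI : (0 : ℝ) < Complex.I.im := by simp
    have := Qh_unique hB h6.wf' hI (fun z => ?_) ℓ
    · linear_combination -this
    · have h7 := h6.eq Complex.I hI z
      have h8 : Qh B (fun ℓ => -1 * w2 B ℓ + w2 B ℓ) (-1 / Complex.I) (Complex.I⁻¹ • z) = 0 := by
        simp [Qh, Th]
      rw [h8] at h7
      have h9 := (mul_eq_zero.1 h7.symm).resolve_left (mul_ne_zero (pow_ne_zero _ Complex.I_ne_zero) (Complex.exp_ne_zero _))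
      exact h9
  have h6 := h5 0
  have e1 : K2 hB 0 = 98280 := by
    rw [K2]
    have : ∀ γ ∈ (shell_finite hB 4).toFinset, sgc B γ 0 = 1 := by
      intro γ _
      have : pairZ B γ 0 = 0 := by simp [pairZ]
      rw [sgc, this]; simp
    rw [Finset.sum_congr rfl this, Finset.sum_const]
    have h7 := (counts hB).1
    have h8 : (shell_finite hB 4).toFinset.card = 196560 := by
      rw [← h7, Nn]
      exact (Nat.card_eq_card_finite_toFinset (shell_finite hB 4)).symm
    rw [h8]; norm_num
  have e2 : w2 B 0 = 0 := w2_zero hB (by rw [pz_zero_left]; norm_num) (by rw [pz_zero_left]; norm_num)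
  have e3 : ind 0 0 = 1 := by simp [ind]
  rw [e1, e2, e3] at h6
  have e4 : c = -24 := by
    have : (4095 : ℂ) * c = 4095 * (-24) := by
      linear_combination (4096 : ℂ) * h6
    exact mul_left_cancel₀ (by norm_num) this
  rw [e4] at h4
  simpa using h4

end slash2

section types
variable {B : Matrix (Fin 24) (Fin 24) ℤ}

/-- the four weight functions -/
def wt (B : Matrix (Fin 24) (Fin 24) ℤ) : Fin 4 → LV → ℂ :=
  ![ind 0, w2 B, fun ℓ => 1/2 + (-1/2) * chi B ℓ, fun ℓ => 1/2 + (1/2) * chi B ℓ + (-1) * ind 0 ℓ + (-1) * w2 B ℓ]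

/-- half norms -/
def Nt : Fin 4 → ℕ := ![0, 2, 3, 4]

lemma wt_wf (i : Fin 4) : WF (wt B i) := by
  fin_cases i
  · exact ind_wf 0
  · exact w2_wf
  · exact (WF.const _).add ((WF.const _).mul chi_wf)
  · exact (((WF.const _).add ((WF.const _).mul chi_wf)).add ((WF.const _).mul (ind_wf 0))).add ((WF.const _).mul w2_wf)

lemma wt_congr (hB : IsLeech B) (i : Fin 4) {v w : LV} (h : cl v = cl w) : wt B i v = wt B i w := by
  have h1 := chi_congr hB h
  have h2 := w2_congr (B := B) h
  have h3 : ind 0 v = ind 0 w := by rw [ind, ind, h]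
  fin_cases i
  · exact h3
  · exact h2
  · simp [wt, h1]
  · simp [wt, h1, h2, h3]

lemma hn_conway {σ : Matrix (Fin 24) (Fin 24) ℤ} (hσ : σ ∈ ConwayGroup B) (v : LV) : hn B (σ.mulVec v) = hn B v := by
  rw [hn, hn, conway_pair hσ]

lemma cl_conway {σ : Matrix (Fin 24) (Fin 24) ℤ} {v w : LV} (h : cl v = cl w) : cl (σ.mulVec v) = cl (σ.mulVec w) := by
  obtain ⟨x, rfl⟩ := cl_eq h
  rw [mulVec_add, mulVec_smul, cl_add_two]

lemma hn_cases (hB : IsLeech B) (v : LV) (h : pairZ B v v ≤ 8) : ∃ i, hn B v = Nt i := by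
  have h1 := hn_spec hB v
  have h2 := hB.2.2.2.2 v
  have h4 : hn B v ≤ 4 := by omega
  have h5 : hn B v ≠ 1 := fun h => h2 (by omega)
  interval_cases h6 : hn B v
  · exact ⟨0, rfl⟩
  · exact absurd rfl h5
  · exact ⟨1, rfl⟩
  · exact ⟨2, rfl⟩
  · exact ⟨3, rfl⟩

lemma wt_val (hB : IsLeech B) (v : LV) (i j : Fin 4) (h : hn B v = Nt i) : wt B j v = if i = j then 1 else 0 := by
  have h1 := hn_spec hB v
  have h8 : pairZ B v v ≤ 8 := by
    rw [h1, h]; fin_cases i <;> simp [Nt]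
  have hi : ind 0 v = if i = 0 then 1 else 0 := by
    rw [ind]
    by_cases h0 : v = 0
    · have : i = 0 := by
        rw [h0, pz_zero_left, ← h0, h] at h1
        fin_cases i <;> simp [Nt] at h1 ⊢
      simp [h0, this]
    · have : i ≠ 0 := by
        rintro rfl
        exact h0 (pz_eq_zero hB (by rw [h1, h]; rfl))
      rw [if_neg, if_neg this]
      intro hc
      obtain ⟨x, hx⟩ := cl_eq hc
      rcases congr_short hB h8 (by rw [pz_zero_left]; norm_num) hx with h | h | h
      · exact h0 h
      · exact h0 (by simpa using h)
      · rw [pz_zero_left] at h; omega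
  have h2 : w2 B v = if i = 1 then 1 else 0 := by
    split_ifs with h3
    · subst h3
      exact w2_of v v (by rw [h1, h]; rfl) rfl
    · refine w2_zero hB h8 ?_
      rw [h1, h]
      fin_cases i <;> simp [Nt] at h3 ⊢
  have hc : chi B v = if i = 2 then -1 else 1 := by
    rw [chi, h]
    fin_cases i <;> norm_num [Nt, Fin.ext_iff]
  fin_cases j <;> simp only [wt] <;> simp <;> simp only [hi, h2, hc] <;> fin_cases i <;> norm_num [Fin.ext_iff]

lemma wt_conway (hB : IsLeech B) (i : Fin 4) {σ : Matrix (Fin 24) (Fin 24) ℤ} (hσ : σ ∈ ConwayGroup B) (v : LV) :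
    wt B i (σ.mulVec v) = wt B i v := by
  obtain ⟨w, x, hx, h8⟩ := short_rep hB v
  have hc : cl v = cl w := by rw [hx, cl_add_two]
  obtain ⟨j, hj⟩ := hn_cases hB w h8
  rw [wt_congr hB i hc, wt_congr hB i (cl_conway hc), wt_val hB w j i hj, wt_val hB _ j i (by rw [hn_conway hσ, hj])]

lemma wt_supp (hB : IsLeech B) (i : Fin 4) (v : LV) (h : wt B i v ≠ 0) : ∃ m, hn B v = Nt i + 2 * m := by
  obtain ⟨w, x, hx, h8⟩ := short_rep hB v
  have hc : cl v = cl w := by rw [hx, cl_add_two]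
  obtain ⟨j, hj⟩ := hn_cases hB w h8
  rw [wt_congr hB i hc, wt_val hB w j i hj] at h
  have hij : j = i := by by_contra h'; simp [h'] at h
  subst hij
  have hle : Nt j ≤ hn B v := by
    by_cases h9 : pairZ B v v ≤ 8
    · have h1 := hn_spec hB v
      have h2 := hn_spec hB w
      rcases congr_short hB h9 h8 hx with h | h | h
      · rw [h, hj]
      · rw [h, hn_neg, hj]
      · omega
    · have h1 := hn_spec hB v
      have : Nt j ≤ 4 := by fin_cases j <;> simp [Nt]
      omega
  obtain ⟨m, hm⟩ := hn_congr hB hc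
  exact ⟨m.toNat, by omega⟩

/-- linear combinations -/
def lc (B : Matrix (Fin 24) (Fin 24) ℤ) (a : Fin 4 → ℂ) (ℓ : LV) : ℂ := ∑ i, a i * wt B i ℓ

lemma lc_wf (a : Fin 4 → ℂ) : WF (lc B a) := WF.sum _ _ fun i _ => (WF.const (a i)).mul (wt_wf i)

lemma Qh_lc (hB : IsLeech B) (a : Fin 4 → ℂ) {τ : ℂ} (hτ : 0 < τ.im) (z : CV) :
    Qh B (lc B a) τ z = ∑ i, a i * Qh B (wt B i) τ z := by
  simp only [← Qh_smul]
  have h := fun i => (WF.const (a i)).mul (wt_wf (B := B) i)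
  simp only [Fin.sum_univ_four]
  rw [← Qh_add hB (h 0) (h 1) hτ, ← Qh_add hB ((h 0).add (h 1)) (h 2) hτ, ← Qh_add hB (((h 0).add (h 1)).add (h 2)) (h 3) hτ]
  congr 1
  ext ℓ
  simp [lc, Fin.sum_univ_four]

/-- coefficient vectors -/
def cv : Fin 4 → Fin 4 → ℂ := ![![-2025 * 4095, 2025, 0, -23], ![0, 0, -2025, -2048], ![0, 0, 2025, -2048], ![0, 675, 0, -8]]

lemma SRel_lin (hB : IsLeech B) (a b c d : ℂ) : SRel B (fun ℓ => a * ind 0 ℓ + b * w2 B ℓ + c * 1 + d * chi B ℓ)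
    (fun ℓ => a * (2 : ℂ)⁻¹ ^ 12 + b * (w2 B ℓ + 24 * ind 0 ℓ + (-24 * (2 : ℂ)⁻¹ ^ 12)) + c * (2 ^ 12 * ind 0 ℓ) + d * chi B ℓ) :=
  ((((SRel_P1 hB).smul a).add hB ((SRel_W hB).smul b)).add hB ((SRel_P2 hB).smul c)).add hB ((SRel_P3 hB).smul d)

lemma SRel_cv0 (hB : IsLeech B) : SRel B (lc B (cv 0)) (lc B (cv 1)) := by
  refine SRel_congr (SRel_lin hB (-2025 * 4095 + 23) 2048 (-23/2) (-23/2)) (fun ℓ => ?_) (fun ℓ => ?_) <;>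
  simp [lc, Fin.sum_univ_four, wt, cv] <;> ring

lemma SRel_cv2 (hB : IsLeech B) : SRel B (lc B (cv 2)) (lc B (cv 2)) := by
  refine SRel_congr (SRel_lin hB 2048 2048 (2025/2 - 1024) (-2025/2 - 1024)) (fun ℓ => ?_) (fun ℓ => ?_) <;>
  simp [lc, Fin.sum_univ_four, wt, cv] <;> ring

lemma SRel_cv3 (hB : IsLeech B) : SRel B (lc B (cv 3)) (lc B (cv 3)) := by
  refine SRel_congr (SRel_lin hB 8 683 (-4) (-4)) (fun ℓ => ?_) (fun ℓ => ?_) <;>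
  simp [lc, Fin.sum_univ_four, wt, cv] <;> ring

lemma SRel_cv1 (hB : IsLeech B) : SRel B (lc B (cv 1)) (lc B (cv 0)) := (SRel_cv0 hB).symm hB

end types

section thetas
open ModularGroup Filter

lemma hol_of {F : ℂ → ℂ} (h : ∀ τ : ℂ, 0 < τ.im → DifferentiableAt ℂ F τ) :
    MDifferentiable 𝓘(ℂ) 𝓘(ℂ) (fun τ : ℍ => F τ) := by
  rw [UpperHalfPlane.mdifferentiable_iff]
  intro τ hτ
  refine ((h τ hτ).differentiableWithinAt).congr_of_eventuallyEq_of_mem ?_ hτ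
  filter_upwards [self_mem_nhdsWithin] with y hy
  simp [ofComplex_apply_of_im_pos hy]

/-- nome -/
def rr (τ : ℍ) : ℂ := cexp (π * Complex.I * τ)
/-- theta constants -/
def tY (τ : ℍ) : ℂ := jacobiTheta₂ 0 τ ^ 4
/-- theta constants -/
def tZ (τ : ℍ) : ℂ := jacobiTheta₂ (1/2) τ ^ 4
/-- theta constants -/
def tV (τ : ℍ) : ℂ := jacobiTheta₂ (τ/2) τ ^ 4
/-- theta constants -/
def tX (τ : ℍ) : ℂ := rr τ * tV τ
/-- normalized discriminant -/
def tD (τ : ℍ) : ℂ := ModularForm.discriminant τ / rr τ ^ 2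

lemma rr_ne (τ : ℍ) : rr τ ≠ 0 := Complex.exp_ne_zero _

lemma rr_sq (τ : ℍ) : rr τ ^ 2 = Function.Periodic.qParam 1 τ := by
  rw [rr, Function.Periodic.qParam, ← Complex.exp_nat_mul]; congr 1; push_cast; ring

lemma rr_T (τ : ℍ) : rr (T • τ) = - rr τ := by
  rw [rr, rr, coe_Tmul, mul_add, Complex.exp_add, mul_one, Complex.exp_pi_mul_I]; ring

lemma rr_hol : MDifferentiable 𝓘(ℂ) 𝓘(ℂ) rr := hol_of (F := fun τ => cexp (π * Complex.I * τ)) fun τ _ => by fun_prop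

lemma tV_hol : MDifferentiable 𝓘(ℂ) 𝓘(ℂ) tV := hol_of (F := fun τ => jacobiTheta₂ (τ/2) τ ^ 4) fun τ h => by
  have h1 := (hasFDerivAt_jacobiTheta₂ (τ / 2) h).differentiableAt
  have h2 : DifferentiableAt ℂ (fun τ : ℂ => jacobiTheta₂ (τ / 2) τ) τ :=
    h1.comp (f := fun τ : ℂ => (τ / 2, τ)) τ (by fun_prop)
  exact h2.pow 4

lemma tY_hol : MDifferentiable 𝓘(ℂ) 𝓘(ℂ) tY := hol_of (F := fun τ => jacobiTheta₂ 0 τ ^ 4) fun τ h =>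
  (differentiableAt_jacobiTheta₂_snd 0 h).pow 4

lemma tZ_hol : MDifferentiable 𝓘(ℂ) 𝓘(ℂ) tZ := hol_of (F := fun τ => jacobiTheta₂ (1/2) τ ^ 4) fun τ h =>
  (differentiableAt_jacobiTheta₂_snd (1/2) h).pow 4

lemma tX_hol : MDifferentiable 𝓘(ℂ) 𝓘(ℂ) tX := rr_hol.mul tV_hol

lemma jt_T (z τ : ℂ) : jacobiTheta₂ z (τ + 1) = jacobiTheta₂ (z + 1/2) τ := by
  rw [jacobiTheta₂, jacobiTheta₂]
  refine tsum_congr fun n => ?_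
  rw [jacobiTheta₂_term, jacobiTheta₂_term]
  obtain ⟨m, hm⟩ := (Int.even_mul_succ_self (n - 1))
  have hm' : (n : ℂ) ^ 2 = n + 2 * m := by
    have : (n : ℤ) ^ 2 = n + 2 * m := by linarith
    exact_mod_cast this
  rw [Complex.exp_eq_exp_iff_exists_int]
  refine ⟨m, ?_⟩
  linear_combination (π * Complex.I : ℂ) * hm'

lemma tY_T (τ : ℍ) : tY (T • τ) = tZ τ := by
  rw [tY, tZ, coe_Tmul, jt_T, zero_add]

lemma tZ_T (τ : ℍ) : tZ (T • τ) = tY τ := by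
  rw [tY, tZ, coe_Tmul, jt_T, show (1/2 : ℂ) + 1/2 = 0 + 1 by norm_num, jacobiTheta₂_add_left]

lemma tX_T (τ : ℍ) : tX (T • τ) = - tX τ := by
  rw [tX, tX, rr_T, tV, tV, coe_Tmul, jt_T, show ((τ:ℂ) + 1) / 2 + 1/2 = τ / 2 + 1 by ring, jacobiTheta₂_add_left]; ring

lemma half_pow (τ : ℍ) : (1 / (-Complex.I * (τ:ℂ)) ^ (1 / 2 : ℂ)) ^ 4 = - 1 / (τ:ℂ) ^ 2 := by
  have h : ((-Complex.I * (τ:ℂ)) ^ (1 / 2 : ℂ)) ^ 2 = -Complex.I * τ := by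
    rw [← Complex.cpow_nat_mul]; norm_num
  rw [div_pow, one_pow, show 4 = 2 * 2 by norm_num, pow_mul, h, mul_pow, neg_sq, Complex.I_sq]
  have := ne_zero τ
  field_simp

lemma tY_S (τ : ℍ) : tY (S • τ) = - (τ:ℂ) ^ 2 * tY τ := by
  have h := jacobiTheta₂_functional_equation 0 τ
  have hne := ne_zero τ
  rw [tY, tY, coe_Smul, h, mul_pow, mul_pow, half_pow]
  simp
  field_simp

lemma tZ_S (τ : ℍ) : tZ (S • τ) = - (τ:ℂ) ^ 2 * tX τ := by
  have h := jacobiTheta₂_functional_equation ((τ:ℂ)/2) τ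
  have hne := ne_zero τ
  rw [tX, tV, tZ, coe_Smul, h, mul_pow, mul_pow, half_pow, show ((τ:ℂ)/2/τ) = 1/2 by field_simp, ← Complex.exp_nat_mul, rr]
  have : cexp (π * Complex.I * τ) * cexp ((4:ℕ) * (-π * Complex.I * (τ/2)^2 / τ)) = 1 := by
    rw [← Complex.exp_add, Complex.exp_eq_one_iff]
    refine ⟨0, ?_⟩
    push_cast; field_simp; ring
  calc _ = (cexp (π * Complex.I * τ) * cexp ((4:ℕ) * (-π * Complex.I * (τ/2)^2 / τ))) * jacobiTheta₂ (1/2) (-1/τ) ^ 4 := by rw [this, one_mul]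
    _ = _ := by field_simp

lemma tX_S (τ : ℍ) : tX (S • τ) = - (τ:ℂ) ^ 2 * tZ τ := by
  have h := tZ_S (S • τ)
  have hne := ne_zero τ
  rw [← mul_smul] at h
  have e : (S * S) • τ = τ := by
    ext; rw [mul_smul, coe_Smul, coe_Smul]; field_simp
  rw [e, coe_Smul] at h
  rw [h]; field_simp

lemma gen_tendsto (u : ℤ → ℂ) (m : ℤ → ℤ) (hu : ∀ n, ‖u n‖ ≤ 1) (hm : ∀ n, 0 ≤ m n)
    (hs : Summable fun n => Real.exp (-π * m n)) :
    Tendsto (fun τ : ℍ => ∑' n, u n * cexp (π * Complex.I * m n * τ)) atImInfty (𝓝 (∑' n, if m n = 0 then u n else 0)) := by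
  have hnorm : ∀ n (τ : ℍ), ‖cexp (π * Complex.I * m n * τ)‖ = Real.exp (-π * m n * τ.im) := by
    intro n τ
    rw [Complex.norm_exp]; congr 1
    simp [Complex.mul_re, Complex.mul_im]
  refine tendsto_tsum_of_dominated_convergence hs (fun n => ?_) ?_
  · by_cases h : m n = 0
    · simp [h]
    · simp only [h, if_false]
      rw [tendsto_zero_iff_norm_tendsto_zero]
      have hp : 0 < π * m n := mul_pos Real.pi_pos (by exact_mod_cast lt_of_le_of_ne (hm n) (Ne.symm h))
      have h1 : Tendsto (fun τ : ℍ => Real.exp (-π * m n * τ.im)) atImInfty (𝓝 0) := by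
        have : Tendsto (fun τ : ℍ => (π * m n) * τ.im) atImInfty atTop :=
          (Filter.tendsto_comap (f := UpperHalfPlane.im)).const_mul_atTop hp
        refine (Real.tendsto_exp_neg_atTop_nhds_zero.comp this).congr fun τ => ?_
        simp
      refine squeeze_zero (fun _ => norm_nonneg _) (fun τ => ?_) h1
      rw [norm_mul, hnorm]
      exact mul_le_of_le_one_left (Real.exp_nonneg _) (hu n)
  · have : ∀ᶠ τ : ℍ in atImInfty, 1 ≤ τ.im := by
      rw [Filter.Eventually, atImInfty_mem]; exact ⟨1, fun z hz => hz⟩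
    filter_upwards [this] with τ hτ n
    rw [norm_mul, hnorm]
    refine (mul_le_of_le_one_left (Real.exp_nonneg _) (hu n)).trans (Real.exp_le_exp.2 ?_)
    have : 0 ≤ π * m n := mul_nonneg Real.pi_pos.le (by exact_mod_cast hm n)
    nlinarith

lemma sq_summable : Summable fun n : ℤ => Real.exp (-π * (n ^ 2 : ℤ)) := by
  have h := ((summable_jacobiTheta₂_term_iff 0 Complex.I).2 (by simp)).norm
  refine h.congr fun n => ?_
  rw [norm_jacobiTheta₂_term]; simp

lemma sqn_summable : Summable fun n : ℤ => Real.exp (-π * (n ^ 2 + n : ℤ)) := by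
  have h := ((summable_jacobiTheta₂_term_iff (Complex.I / 2) Complex.I).2 (by simp)).norm
  refine h.congr fun n => ?_
  rw [norm_jacobiTheta₂_term]; simp; ring_nf

lemma tV_lim : Tendsto tV atImInfty (𝓝 16) := by
  have h := gen_tendsto (fun _ => 1) (fun n => n ^ 2 + n) (by simp) (fun n => by nlinarith [sq_nonneg n, Int.le_self_sq (-n), Int.le_self_sq n]) sqn_summable
  have e : (∑' n : ℤ, if n ^ 2 + n = 0 then (1:ℂ) else 0) = 2 := by
    rw [tsum_eq_sum (s := {0, -1})]
    · rw [Finset.sum_pair (by norm_num)]; norm_num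
    · intro n hn
      simp only [Finset.mem_insert, Finset.mem_singleton, not_or] at hn
      rw [if_neg]
      intro h
      have : n * (n + 1) = 0 := by linarith
      rcases mul_eq_zero.1 this with h | h
      · exact hn.1 h
      · exact hn.2 (by linarith)
  rw [e] at h
  have h4 := h.pow 4
  rw [show (2 : ℂ) ^ 4 = 16 by norm_num] at h4
  refine h4.congr fun τ => ?_
  rw [tV, jacobiTheta₂]
  congr 1
  refine tsum_congr fun n => ?_
  rw [jacobiTheta₂_term, one_mul]; congr 1; push_cast; ring

lemma sq_lim (u : ℤ → ℂ) (hu : ∀ n, ‖u n‖ ≤ 1) (h0 : u 0 = 1) : Tendsto (fun τ : ℍ => ∑' n : ℤ, u n * cexp (π * Complex.I * (n ^ 2 : ℤ) * τ)) atImInfty (𝓝 1) := by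
  have h := gen_tendsto u (fun n => n ^ 2) hu (fun n => by positivity) sq_summable
  have e : (∑' n : ℤ, if n ^ 2 = 0 then u n else 0) = 1 := by
    rw [tsum_eq_single 0]
    · simp [h0]
    · intro n hn; simp [hn]
  rwa [e] at h

lemma tY_lim : Tendsto tY atImInfty (𝓝 1) := by
  have h := (sq_lim (fun _ => 1) (by simp) rfl).pow 4
  rw [one_pow] at h
  refine h.congr fun τ => ?_
  rw [tY, jacobiTheta₂]
  congr 1
  refine tsum_congr fun n => ?_
  rw [jacobiTheta₂_term, one_mul]; congr 1; push_cast; ring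

lemma tZ_lim : Tendsto tZ atImInfty (𝓝 1) := by
  have h := (sq_lim (fun n => cexp (π * Complex.I * n)) (fun n => by
    rw [Complex.norm_exp]; simp) (by simp)).pow 4
  rw [one_pow] at h
  refine h.congr fun τ => ?_
  rw [tZ, jacobiTheta₂]
  congr 1
  refine tsum_congr fun n => ?_
  rw [jacobiTheta₂_term, ← Complex.exp_add]; congr 1; push_cast; ring

lemma rr_lim : Tendsto rr atImInfty (𝓝 0) := by
  have h := gen_tendsto (fun n => if n = 0 then 1 else 0) (fun n => n ^ 2 + 1) (fun n => by split_ifs <;> simp) (fun n => by positivity)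
    ((sq_summable.mul_right (Real.exp (-π))).congr fun n => by rw [← Real.exp_add]; congr 1; push_cast; ring)
  have e : (∑' n : ℤ, if n ^ 2 + 1 = 0 then (if n = 0 then (1:ℂ) else 0) else 0) = 0 := by
    have hh : ∀ n : ℤ, n ^ 2 + 1 ≠ 0 := fun n => by positivity
    simp [hh]
  rw [e] at h
  refine h.congr fun τ => ?_
  rw [tsum_eq_single 0]
  · simp [rr]
  · intro n hn; simp [hn]

lemma tX_lim : Tendsto tX atImInfty (𝓝 0) := by
  have := rr_lim.mul tV_lim
  rw [zero_mul] at this; exact this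

lemma tD_lim : Tendsto tD atImInfty (𝓝 1) := by
  refine ModularForm.tendsto_atImInfty_tprod_one_sub_eta_q_pow.congr fun τ => ?_
  rw [tD, rr_sq, ModularForm.discriminant_eq_q_prod, mul_div_cancel_left₀]
  rw [← rr_sq]; exact pow_ne_zero _ (rr_ne τ)

lemma dd_T (τ : ℍ) : ModularForm.discriminant (T • τ) = ModularForm.discriminant τ := by
  have h := congrFun ModularForm.discriminant_T_invariant τ
  rw [ModularForm.SL_slash_apply] at h
  rw [denom_apply] at h
  simpa [ModularGroup.T] using h

lemma dd_S (τ : ℍ) : ModularForm.discriminant (S • τ) = (τ:ℂ) ^ 12 * ModularForm.discriminant τ := by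
  have h := congrFun ModularForm.discriminant_S_invariant τ
  rw [ModularForm.SL_slash_apply, denom_S] at h
  rw [← h]
  have := ne_zero τ
  rw [_root_.zpow_neg]
  field_simp

lemma dd_hol : MDifferentiable 𝓘(ℂ) 𝓘(ℂ) (ModularForm.discriminant : ℍ → ℂ) := CuspForm.discriminant.holo'

lemma dd_eq (τ : ℍ) : ModularForm.discriminant τ = rr τ ^ 2 * tD τ := by
  rw [tD, mul_div_cancel₀]; exact pow_ne_zero _ (rr_ne τ)

lemma jacobi_id (τ : ℍ) : tY τ = tX τ + tZ τ := by
  obtain ⟨F, hF⟩ := mkMF (k := 4) (f := fun τ => (tX τ + tZ τ - tY τ) ^ 2)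
    (((tX_hol.add tZ_hol).sub tY_hol).pow 2)
    (fun τ => by rw [tX_S, tY_S, tZ_S]; push_cast; rw [show (4:ℤ) = (4:ℕ) by rfl, zpow_natCast]; ring)
    (fun τ => by rw [tX_T, tY_T, tZ_T]; ring)
    ((((tX_lim.add tZ_lim).sub tY_lim).pow 2).isBigO_one ℝ)
  have hz : IsZeroAtImInfty F := by
    have := ((tX_lim.add tZ_lim).sub tY_lim).pow 2
    rw [hF, IsZeroAtImInfty, Filter.ZeroAtFilter]
    simpa using this
  have h0 : F = 0 := by
    refine ModularForm.sturm_bound_levelOne_nat (k := 4) ?_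
    have h1 := qExpansion_coeff_zero (f := F) one_pos
      (ModularFormClass.analyticAt_cuspFunction_zero F one_pos one_mem_strictPeriods_SL)
      (SlashInvariantFormClass.periodic_comp_ofComplex F one_mem_strictPeriods_SL)
    rw [hz.valueAtInfty_eq_zero] at h1
    norm_num
    rw [← Order.one_le_iff_pos, PowerSeries.one_le_order_iff_constCoeff_eq_zero]
    simpa using h1
  have h2 : (tX τ + tZ τ - tY τ) ^ 2 = 0 := by
    have := congrFun hF τ
    rw [h0] at this
    exact this.symm
  have := pow_eq_zero_iff (two_ne_zero) |>.1 h2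
  linear_combination -this

lemma xyz_ne (τ : ℍ) : tX τ * tY τ * tZ τ ≠ 0 := by
  have hlim : Tendsto (fun τ => (tX τ * tY τ * tZ τ) ^ 2 / ModularForm.discriminant τ) atImInfty (𝓝 256) := by
    have := (((tV_lim.mul tY_lim).mul tZ_lim).pow 2).div tD_lim one_ne_zero
    norm_num at this
    refine this.congr fun τ => ?_
    rw [dd_eq, tX]
    have := rr_ne τ
    simp only [Pi.div_apply]
    field_simp
  obtain ⟨F, hF⟩ := mkMF (k := 0) (f := fun τ => (tX τ * tY τ * tZ τ) ^ 2 / ModularForm.discriminant τ)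
    (by
      have h1 := ((tX_hol.mul tY_hol).mul tZ_hol).pow 2
      rw [UpperHalfPlane.mdifferentiable_iff] at h1 ⊢
      have h2 := dd_hol
      rw [UpperHalfPlane.mdifferentiable_iff] at h2
      exact h1.div h2 fun x _ => ModularForm.discriminant_ne_zero _)
    (fun τ => by
      rw [tX_S, tY_S, tZ_S, dd_S]
      have := ne_zero τ
      rw [_root_.zpow_zero, one_mul]
      field_simp)
    (fun τ => by rw [tX_T, tY_T, tZ_T, dd_T]; ring)
    (hlim.isBigO_one ℝ)
  obtain ⟨c, hc⟩ := ModularFormClass.levelOne_weight_zero_const F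
  rw [hF] at hc
  rw [hc] at hlim
  have hc' : c = 256 := tendsto_nhds_unique (by
    refine (tendsto_const_nhds (x := c) (f := atImInfty)).congr fun _ => rfl) hlim
  intro h0
  have := congrFun hc τ
  simp [h0, hc'] at this

lemma tX_ne (τ : ℍ) : tX τ ≠ 0 := fun h => xyz_ne τ (by rw [h]; ring)
lemma tY_ne (τ : ℍ) : tY τ ≠ 0 := fun h => xyz_ne τ (by rw [h]; ring)
lemma tZ_ne (τ : ℍ) : tZ τ ≠ 0 := fun h => xyz_ne τ (by rw [h]; ring)
lemma tV_ne (τ : ℍ) : tV τ ≠ 0 := fun h => tX_ne τ (by rw [tX, h]; ring)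

end thetas

section modul
open ModularGroup
variable {B : Matrix (Fin 24) (Fin 24) ℤ}

lemma coe_smul_sl (A : SL(2, ℤ)) (τ : ℍ) : ((A • τ : ℍ) : ℂ) = ((A.1 0 0 : ℤ) * (τ:ℂ) + (A.1 0 1 : ℤ)) / jfactor A τ := by
  rw [coe_specialLinearGroup_apply]
  simp [jfactor, slc, sld]

lemma jf_ne (A : SL(2, ℤ)) (τ : ℍ) : jfactor A τ ≠ 0 := by
  have := denom_ne_zero (A : GL (Fin 2) ℝ) τ
  rw [denom_apply] at this
  simpa [jfactor, slc, sld] using this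

lemma jf_mul (A A' : SL(2, ℤ)) (τ : ℍ) : jfactor (A * A') τ = jfactor A (A' • τ) * jfactor A' τ := by
  have h := jf_ne A' τ
  rw [jfactor.eq_1 A, coe_smul_sl, add_mul, mul_assoc, div_mul_cancel₀ _ h]
  simp [jfactor, slc, sld, Matrix.mul_apply, Fin.sum_univ_two]
  ring

lemma je_mul (A A' : SL(2, ℤ)) (τ : ℍ) : slc (A * A') / jfactor (A * A') τ =
    slc A / jfactor A (A' • τ) / jfactor A' τ ^ 2 + slc A' / jfactor A' τ := by
  have h := jf_ne A' τ
  have h2 := jf_ne A (A' • τ)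
  have hj : jfactor A (A' • τ) * jfactor A' τ = (slc A * (A'.1 0 0 : ℤ) + sld A * slc A') * τ + (slc A * (A'.1 0 1 : ℤ) + sld A * sld A') := by
    rw [← jf_mul]
    simp [jfactor, slc, sld, Matrix.mul_apply, Fin.sum_univ_two]
  have hd : ((A'.1 0 0 : ℤ) : ℂ) * sld A' - (A'.1 0 1 : ℤ) * slc A' = 1 := by
    have := A'.2
    rw [Matrix.det_fin_two] at this
    simp only [slc, sld]
    exact_mod_cast this
  have hm : slc (A * A') = slc A * (A'.1 0 0 : ℤ) + sld A * slc A' := by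
    simp [slc, sld, Matrix.mul_apply, Fin.sum_univ_two]
  rw [jf_mul, hm]
  field_simp
  have hj' : jfactor A' τ = slc A' * τ + sld A' := rfl
  rw [mul_assoc (slc A'), hj, hj']
  linear_combination (slc A) * hd

/-- modularity under one matrix -/
def ModAt (B : Matrix (Fin 24) (Fin 24) ℤ) (k : ℤ) (φ : ℍ → CV → ℂ) (A : SL(2, ℤ)) : Prop :=
  ∀ (τ : ℍ) (z : CV), φ (A • τ) ((jfactor A τ)⁻¹ • z) =
      (jfactor A τ) ^ k * cexp (2 * π * Complex.I * (slc A / jfactor A τ) * pairC B z z) * φ τ z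

lemma ModAt.mul {k : ℤ} {φ : ℍ → CV → ℂ} {A A' : SL(2, ℤ)} (h : ModAt B k φ A) (h' : ModAt B k φ A') : ModAt B k φ (A * A') := by
  intro τ z
  have h1 := jf_ne A' τ
  have h2 := jf_ne A (A' • τ)
  rw [je_mul, jf_mul, mul_inv, mul_smul, ← smul_smul, h, h', pc_smul_left, pc_smul_right, mul_zpow]
  have : cexp (2 * π * Complex.I * (slc A / jfactor A (A' • τ)) * ((jfactor A' τ)⁻¹ * ((jfactor A' τ)⁻¹ * pairC B z z))) *
      cexp (2 * π * Complex.I * (slc A' / jfactor A' τ) * pairC B z z) =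
      cexp (2 * π * Complex.I * (slc A / jfactor A (A' • τ) / jfactor A' τ ^ 2 + slc A' / jfactor A' τ) * pairC B z z) := by
    rw [← Complex.exp_add]; congr 1; field_simp
  rw [← this]; ring

lemma ModAt.inv {k : ℤ} {φ : ℍ → CV → ℂ} {A : SL(2, ℤ)} (h : ModAt B k φ A) : ModAt B k φ A⁻¹ := by
  intro τ z
  have h1 := jf_ne A⁻¹ τ
  have h2 := jf_ne A (A⁻¹ • τ)
  have e1 := jf_mul A A⁻¹ τ
  have e2 := je_mul A A⁻¹ τ
  have := h (A⁻¹ • τ) ((jfactor A⁻¹ τ)⁻¹ • z)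
  rw [mul_inv_cancel] at e1 e2
  have j1 : jfactor 1 τ = 1 := by simp [jfactor, slc, sld]
  have s1 : slc 1 = 0 := by simp [slc]
  rw [j1] at e1
  rw [j1, s1, zero_div] at e2
  have e3 : (jfactor A (A⁻¹ • τ))⁻¹ = jfactor A⁻¹ τ := by field_simp; exact e1
  have e4 : jfactor A (A⁻¹ • τ) = (jfactor A⁻¹ τ)⁻¹ := by rw [← e3, inv_inv]
  rw [smul_inv_smul, e3, smul_inv_smul₀ h1, e4, pc_smul_left, pc_smul_right] at this
  rw [e4] at e2
  rw [this]
  have e5 : slc A⁻¹ / jfactor A⁻¹ τ = - (slc A / (jfactor A⁻¹ τ)⁻¹ / jfactor A⁻¹ τ ^ 2) := by linear_combination -e2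
  rw [e5]
  have e6 : cexp (2 * π * Complex.I * (-(slc A / (jfactor A⁻¹ τ)⁻¹ / jfactor A⁻¹ τ ^ 2)) * pairC B z z) *
      cexp (2 * π * Complex.I * (slc A / (jfactor A⁻¹ τ)⁻¹) * ((jfactor A⁻¹ τ)⁻¹ * ((jfactor A⁻¹ τ)⁻¹ * pairC B z z))) = 1 := by
    rw [← Complex.exp_add, Complex.exp_eq_one_iff]; refine ⟨0, ?_⟩; field_simp; ring
  have e7 : (jfactor A⁻¹ τ) ^ k * (jfactor A⁻¹ τ)⁻¹ ^ k = 1 := by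
    rw [← mul_zpow, mul_inv_cancel₀ h1, _root_.one_zpow]
  linear_combination (-φ (A⁻¹ • τ) ((jfactor A⁻¹ τ)⁻¹ • z)) * e6 - φ (A⁻¹ • τ) ((jfactor A⁻¹ τ)⁻¹ • z) * (cexp (2 * π * Complex.I * (-(slc A / (jfactor A⁻¹ τ)⁻¹ / jfactor A⁻¹ τ ^ 2)) * pairC B z z) *
      cexp (2 * π * Complex.I * (slc A / (jfactor A⁻¹ τ)⁻¹) * ((jfactor A⁻¹ τ)⁻¹ * ((jfactor A⁻¹ τ)⁻¹ * pairC B z z)))) * e7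

lemma modAt_all {k : ℤ} {φ : ℍ → CV → ℂ}
    (hS : ∀ (τ : ℍ) z, φ (S • τ) ((τ:ℂ)⁻¹ • z) = (τ:ℂ) ^ k * cexp (2 * π * Complex.I * pairC B z z / τ) * φ τ z)
    (hT : ∀ (τ : ℍ) z, φ (T • τ) z = φ τ z) (A : SL(2, ℤ)) : ModAt B k φ A := by
  have hA : A ∈ Subgroup.closure {S, T} := by rw [SpecialLinearGroup.SL2Z_generators]; trivial
  induction hA using Subgroup.closure_induction with
  | mem x hx =>
    rcases hx with rfl | hx
    · intro τ z
      have h1 : jfactor S τ = τ := by simp [jfactor, slc, sld, S]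
      have h2 : slc S = 1 := by simp [slc, S]
      rw [h1, h2, hS]
      congr 3; ring
    · obtain rfl := Set.mem_singleton_iff.1 hx
      intro τ z
      have h1 : jfactor T τ = 1 := by simp [jfactor, slc, sld, T]
      have h2 : slc T = 0 := by simp [slc, T]
      rw [h1, h2, hT]; simp
  | one =>
    intro τ z
    have h1 : jfactor 1 τ = 1 := by simp [jfactor, slc, sld]
    have h2 : slc 1 = 0 := by simp [slc]
    rw [h1, h2]; simp
  | mul x y _ _ hx hy => exact hx.mul hy
  | inv x _ hx => exact hx.inv

/-- vector valued data -/
def HF (B : Matrix (Fin 24) (Fin 24) ℤ) (h : Fin 4 → ℍ → ℂ) (τ : ℍ) (z : CV) : ℂ := ∑ m, h m τ * Qh B (wt B m) τ z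

/-- admissible coefficient functions -/
structure HOK (h : Fin 4 → ℍ → ℂ) : Prop where
  hol : ∀ m, MDifferentiable 𝓘(ℂ) 𝓘(ℂ) (h m)
  hT : ∀ m τ, h m (T • τ) = (-1) ^ Nt m * h m τ
  bd : ∀ m, IsBoundedAtImInfty fun τ => rr τ ^ Nt m * h m τ

lemma Qh_wt_T (hB : IsLeech B) (m : Fin 4) (τ : ℂ) (z : CV) : Qh B (wt B m) (τ + 1) z = (-1) ^ Nt m * Qh B (wt B m) τ z := by
  rw [Qh_T hB, ← Qh_smul]
  congr 1; ext ℓ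
  by_cases h : wt B m ℓ = 0
  · simp [h]
  · obtain ⟨j, hj⟩ := wt_supp hB m ℓ h
    rw [chi, hj, pow_add, pow_mul]; simp

lemma HF_T (hB : IsLeech B) {h : Fin 4 → ℍ → ℂ} (hk : HOK h) (τ : ℍ) (z : CV) : HF B h (T • τ) z = HF B h τ z := by
  rw [HF, HF]
  refine Finset.sum_congr rfl fun m _ => ?_
  rw [hk.hT, coe_Tmul, Qh_wt_T hB]
  have : ((-1 : ℂ) ^ Nt m) * (-1) ^ Nt m = 1 := by rw [← mul_pow]; simp
  linear_combination h m τ * Qh B (wt B m) τ z * this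

lemma HF_hol_tau (hB : IsLeech B) {h : Fin 4 → ℍ → ℂ} (hk : ∀ m, MDifferentiable 𝓘(ℂ) 𝓘(ℂ) (h m)) (z : CV) :
    MDifferentiable 𝓘(ℂ) 𝓘(ℂ) fun τ : ℍ => HF B h τ z := by
  have hq : ∀ m, MDifferentiable 𝓘(ℂ) 𝓘(ℂ) fun τ : ℍ => Qh B (wt B m) τ z := by
    intro m
    obtain ⟨C, hC⟩ := (wt_wf (B := B) m).bdd
    refine hol_of (F := fun τ => Qh B (wt B m) τ z) fun τ hτ => ?_
    exact (Th_differentiableAt hB hC (half_im hτ) z).comp (f := fun τ : ℂ => (τ / 2, z)) τ (by fun_prop)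
  have := (((hk 0).mul (hq 0)).add ((hk 1).mul (hq 1))).add (((hk 2).mul (hq 2)).add ((hk 3).mul (hq 3)))
  have e : (fun τ : ℍ => HF B h τ z) = ((h 0 * fun τ : ℍ => Qh B (wt B 0) τ z) + (h 1 * fun τ : ℍ => Qh B (wt B 1) τ z)) +
      ((h 2 * fun τ : ℍ => Qh B (wt B 2) τ z) + (h 3 * fun τ : ℍ => Qh B (wt B 3) τ z)) := by
    ext τ
    simp only [HF, Fin.sum_univ_four, Pi.add_apply, Pi.mul_apply]
    ring
  rw [e]; exact this

lemma HF_hol_z (hB : IsLeech B) (h : Fin 4 → ℍ → ℂ) (τ : ℍ) : Differentiable ℂ (HF B h τ) := by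
  unfold HF
  refine Differentiable.fun_sum fun m _ => ?_
  obtain ⟨C, hC⟩ := (wt_wf (B := B) m).bdd
  refine Differentiable.const_mul (fun z => ?_) _
  exact (Th_differentiableAt hB hC (half_im τ.im_pos) z).comp (f := fun z : CV => ((τ:ℂ) / 2, z)) z (by fun_prop)

lemma pc_conway {σ : Matrix (Fin 24) (Fin 24) ℤ} (hσ : σ ∈ ConwayGroup B) (x y : CV) :
    pairC B (actC σ x) (actC σ y) = pairC B x y := by
  have h : (σ.map (Int.cast : ℤ → ℂ))ᵀ * B.map (Int.cast : ℤ → ℂ) * σ.map (Int.cast : ℤ → ℂ) = B.map (Int.cast : ℤ → ℂ) := by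
    have := congrArg (fun M : Matrix (Fin 24) (Fin 24) ℤ => M.map (Int.castRingHom ℂ)) hσ.2
    rw [Matrix.map_mul, Matrix.map_mul] at this
    exact this
  rw [pairC, pairC, actC, actC]
  conv_rhs => rw [← h]
  rw [← mulVec_mulVec, ← mulVec_mulVec, dotProduct_mulVec x, vecMul_transpose]

lemma actC_lift (σ : Matrix (Fin 24) (Fin 24) ℤ) (v : LV) : actC σ (liftC v) = liftC (σ.mulVec v) := by
  ext i; simp [actC, liftC, mulVec, dotProduct]

lemma tt_conway {σ : Matrix (Fin 24) (Fin 24) ℤ} (hσ : σ ∈ ConwayGroup B) (ℓ : LV) (τ : ℂ) (z : CV) :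
    tt B (σ.mulVec ℓ) τ (actC σ z) = tt B ℓ τ z := by
  rw [tt, tt, ← actC_lift, pc_conway hσ, conway_pair hσ]

/-- permutation of the lattice -/
def conE {σ : Matrix (Fin 24) (Fin 24) ℤ} (hσ : IsUnit σ.det) : LV ≃ LV where
  toFun v := σ.mulVec v
  invFun v := σ⁻¹.mulVec v
  left_inv v := by simp [mulVec_mulVec, nonsing_inv_mul _ hσ]
  right_inv v := by simp [mulVec_mulVec, mul_nonsing_inv _ hσ]

lemma Qh_conway (hB : IsLeech B) {σ : Matrix (Fin 24) (Fin 24) ℤ} (hσ : σ ∈ ConwayGroup B) (m : Fin 4) (τ : ℂ) (z : CV) :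
    Qh B (wt B m) τ (actC σ z) = Qh B (wt B m) τ z := by
  simp only [Qh, Th]
  rw [← (conE hσ.1).tsum_eq]
  refine tsum_congr fun ℓ => ?_
  change wt B m (σ.mulVec ℓ) * tt B (σ.mulVec ℓ) _ _ = _
  rw [tt_conway hσ, wt_conway hB m hσ]

lemma eI (n : ℤ) (x : ℂ) : cexp (2 * π * Complex.I * (x + n)) = cexp (2 * π * Complex.I * x) := by
  rw [Complex.exp_eq_exp_iff_exists_int]; exact ⟨n, by ring⟩

lemma tt_shift (hB : IsLeech B) (ℓ x y : LV) (τ : ℂ) (z : CV) :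
    tt B ℓ (τ / 2) (z + τ • liftC x + liftC y) =
      cexp (-2 * π * Complex.I * pairZ B x x * τ - 4 * π * Complex.I * pairC B (liftC x) z) * tt B (ℓ + (2:ℤ) • x) (τ / 2) z := by
  have h2 : liftC (ℓ + (2:ℤ) • x) = liftC ℓ + (2:ℂ) • liftC x := by ext i; simp [liftC]
  rw [tt, tt, ← Complex.exp_add, Complex.exp_eq_exp_iff_exists_int]
  refine ⟨pairZ B ℓ y, ?_⟩
  simp only [h2, pc_add_left, pc_add_right, pc_smul_left, pc_smul_right, pz_add_left, pz_add_right, pz_smul_left, pz_smul_right, pc_lift, pz_comm hB x ℓ]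
  push_cast
  ring

lemma Qh_qp (hB : IsLeech B) (m : Fin 4) (x y : LV) (τ : ℂ) (z : CV) :
    Qh B (wt B m) τ (z + τ • liftC x + liftC y) =
      cexp (-2 * π * Complex.I * pairZ B x x * τ - 4 * π * Complex.I * pairC B (liftC x) z) * Qh B (wt B m) τ z := by
  simp only [Qh, Th]
  rw [← (Equiv.addRight ((2:ℤ) • x)).tsum_eq (fun ℓ => wt B m ℓ * tt B ℓ (τ / 2) z), ← tsum_mul_left]
  refine tsum_congr fun ℓ => ?_
  simp only [Equiv.coe_addRight]
  rw [tt_shift hB, wt_congr hB m (cl_add_two ℓ x)]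
  ring

end modul

section fwd
open ModularGroup
variable {B : Matrix (Fin 24) (Fin 24) ℤ}

lemma per_of_T {F : ℍ → ℂ} (h : ∀ τ, F (T • τ) = F τ) : Function.Periodic (F ∘ ofComplex) (1:ℝ) := by
  intro x
  by_cases hx : 0 < x.im
  · have hx' : 0 < (x + (1:ℝ)).im := by simpa using hx
    simp only [Function.comp, ofComplex_apply_of_im_pos hx, ofComplex_apply_of_im_pos hx']
    rw [← h ⟨x, hx⟩]
    congr 1
    ext
    rw [coe_Tmul]; simp
  · have hx' : ¬ 0 < (x + (1:ℝ)).im := by simpa using hx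
    simp only [Function.comp, ofComplex_apply_of_im_nonpos (not_lt.1 hx), ofComplex_apply_of_im_nonpos (not_lt.1 hx')]

lemma HOK.hasSum {h : Fin 4 → ℍ → ℂ} (hk : HOK h) (m : Fin 4) : ∃ a : ℕ → ℂ, ∀ τ, HasSum (fun n => a n * rr τ ^ (2 * n)) (rr τ ^ Nt m * h m τ) := by
  refine ⟨fun n => (qExpansion 1 fun τ => rr τ ^ Nt m * h m τ).coeff n, fun τ => ?_⟩
  have := hasSum_qExpansion (h := 1) (f := fun τ => rr τ ^ Nt m * h m τ) one_pos (per_of_T fun τ => ?_)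
    ((rr_hol.pow _).mul (hk.hol m)) (hk.bd m) τ
  · simp only [← rr_sq, ← pow_mul, smul_eq_mul] at this
    exact this
  · have : ((-1 : ℂ) ^ Nt m) * (-1) ^ Nt m = 1 := by rw [← mul_pow]; simp
    rw [rr_T, hk.hT, neg_pow]
    linear_combination rr τ ^ Nt m * h m τ * this

lemma tt_rr (hB : IsLeech B) (ℓ : LV) (τ : ℍ) (z : CV) : tt B ℓ (τ / 2) z = rr τ ^ hn B ℓ * cexp (2 * π * Complex.I * pairC B (liftC ℓ) z) := by
  rw [tt, rr, ← Complex.exp_nat_mul, ← Complex.exp_add, hn_spec hB]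
  congr 1; push_cast; ring

lemma fterm_rr (n : ℕ) (ℓ : LV) (τ : ℍ) (z : CV) : fterm B n ℓ τ z = rr τ ^ (2 * n) * cexp (2 * π * Complex.I * pairC B (liftC ℓ) z) := by
  rw [fterm, eC, eC, rr, ← Complex.exp_nat_mul]
  congr 2; push_cast; ring

lemma prodHS {f : ℕ → ℂ} {g : LV → ℂ} {s t : ℂ} (hf : HasSum f s) (hg : HasSum g t) :
    HasSum (fun x : ℕ × LV => f x.1 * g x.2) (s * t) :=
  HasSum.mul hf hg (summable_mul_of_summable_norm hf.summable.norm hg.summable.norm)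

lemma HF_exp1 (hB : IsLeech B) {h : Fin 4 → ℍ → ℂ} (hk : HOK h) (m : Fin 4) : ∃ f : ℕ → LV → ℂ, ∀ (τ : ℍ) z,
      HasSum (fun p : ℕ × LV => f p.1 p.2 * fterm B p.1 p.2 τ z) (h m τ * Qh B (wt B m) τ z) := by
  obtain ⟨a, ha⟩ := hk.hasSum m
  obtain ⟨J, hJ⟩ : ∃ J : LV → ℕ, J = fun ℓ => (hn B ℓ - Nt m) / 2 := ⟨_, rfl⟩
  refine ⟨fun n ℓ => if J ℓ ≤ n then wt B m ℓ * a (n - J ℓ) else 0, fun τ z => ?_⟩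
  have hr := rr_ne τ
  have h1 := ha τ
  have h2 := (Qh_summable hB (wt_wf (B := B) m) τ.im_pos z)
  have h3 := h2.hasSum.mul_left ((rr τ ^ Nt m)⁻¹)
  have h4 := prodHS h1 h3
  have e1 : rr τ ^ Nt m * h m τ * ((rr τ ^ Nt m)⁻¹ * ∑' ℓ, wt B m ℓ * tt B ℓ (τ / 2) z) = h m τ * Qh B (wt B m) τ z := by
    rw [Qh, Th]; field_simp
  rw [e1] at h4
  have inj : Function.Injective fun p : ℕ × LV => (p.1 + J p.2, p.2) := by
    rintro ⟨n, ℓ⟩ ⟨n', ℓ'⟩ he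
    simp only [Prod.mk.injEq] at he
    obtain ⟨h1, rfl⟩ := he
    simpa using h1
  rw [← inj.hasSum_iff]
  · refine h4.congr_fun ?_ 
    rintro ⟨n, ℓ⟩
    simp only [Function.comp, le_add_iff_nonneg_left, zero_le, if_true, Nat.add_sub_cancel]
    by_cases hw : wt B m ℓ = 0
    · simp [hw]
    · obtain ⟨j, hj⟩ := wt_supp hB m ℓ hw
      have hJ' : J ℓ = j := by rw [hJ]; simp only; omega
      rw [hJ', tt_rr hB, fterm_rr, hj, mul_add, pow_add, pow_add]
      field_simp
  · rintro ⟨n, ℓ⟩ hx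
    simp only
    rw [if_neg, zero_mul]
    intro hle
    exact hx ⟨(n - J ℓ, ℓ), by simp [Nat.sub_add_cancel hle]⟩

lemma HF_exp (hB : IsLeech B) {h : Fin 4 → ℍ → ℂ} (hk : HOK h) : ∃ f : ℕ → LV → ℂ, ∀ τ z,
    HasSum (fun p : ℕ × LV => f p.1 p.2 * fterm B p.1 p.2 τ z) (HF B h τ z) := by
  have key := HF_exp1 hB hk
  choose f hf using key
  refine ⟨fun n ℓ => ∑ m, f m n ℓ, fun τ z => ?_⟩
  simp only [Finset.sum_mul]
  exact hasSum_sum fun m _ => hf m τ z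

lemma forward (hB : IsLeech B) {k : ℤ} {h : Fin 4 → ℍ → ℂ} (hk : HOK h)
    (hS : ∀ (τ : ℍ) z, HF B h (S • τ) ((τ:ℂ)⁻¹ • z) = (τ:ℂ) ^ k * cexp (2 * π * Complex.I * pairC B z z / τ) * HF B h τ z) :
    IsWeakJacobiForm B k 2 (HF B h) := by
  obtain ⟨f, hf⟩ := HF_exp hB hk
  refine ⟨f, HF_hol_tau hB hk.hol, HF_hol_z hB h, ?_, ?_, ?_, hf⟩
  · intro σ hσ τ z
    simp only [HF, Qh_conway hB hσ]
  · intro x y τ z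
    simp only [HF, Qh_qp hB, Finset.mul_sum]
    refine Finset.sum_congr rfl fun m _ => ?_
    rw [mul_left_comm]
    congr 2
    push_cast; ring
  · intro A τ z
    have := modAt_all hS (HF_T hB hk) A τ z
    rw [this]
    congr 3
    push_cast; ring

end fwd

section hbsec
open ModularGroup Filter
variable {B : Matrix (Fin 24) (Fin 24) ℤ}

/-- holomorphic and bounded at infinity -/
def HB (f : ℍ → ℂ) : Prop := MDifferentiable 𝓘(ℂ) 𝓘(ℂ) f ∧ IsBoundedAtImInfty f

lemma HB.add {f g : ℍ → ℂ} (hf : HB f) (hg : HB g) : HB fun τ => f τ + g τ := ⟨hf.1.add hg.1, Filter.BoundedAtFilter.add hf.2 hg.2⟩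
lemma HB.mul {f g : ℍ → ℂ} (hf : HB f) (hg : HB g) : HB fun τ => f τ * g τ := ⟨hf.1.mul hg.1, Filter.BoundedAtFilter.mul hf.2 hg.2⟩
lemma HB.const (c : ℂ) : HB fun _ => c := ⟨mdifferentiable_const, Filter.const_boundedAtFilter _ c⟩
lemma HB.neg {f : ℍ → ℂ} (hf : HB f) : HB fun τ => - f τ := by
  have := (HB.const (-1)).mul hf
  simpa using this
lemma HB.sub {f g : ℍ → ℂ} (hf : HB f) (hg : HB g) : HB fun τ => f τ - g τ := by
  simpa [sub_eq_add_neg] using hf.add hg.neg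
lemma HB.pow {f : ℍ → ℂ} (hf : HB f) (n : ℕ) : HB fun τ => f τ ^ n := by
  induction n with
  | zero => simpa using HB.const 1
  | succ n ih => simpa [pow_succ] using ih.mul hf

lemma HB.of_lim {f : ℍ → ℂ} {c : ℂ} (hf : MDifferentiable 𝓘(ℂ) 𝓘(ℂ) f) (h : Tendsto f atImInfty (𝓝 c)) : HB f :=
  ⟨hf, h.isBigO_one ℝ⟩

lemma inv_hol {f : ℍ → ℂ} (hf : MDifferentiable 𝓘(ℂ) 𝓘(ℂ) f) (h0 : ∀ τ, f τ ≠ 0) : MDifferentiable 𝓘(ℂ) 𝓘(ℂ) fun τ => (f τ)⁻¹ := by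
  rw [UpperHalfPlane.mdifferentiable_iff] at hf ⊢
  exact hf.inv fun x _ => h0 _

lemma HB.inv_lim {f : ℍ → ℂ} {c : ℂ} (hf : MDifferentiable 𝓘(ℂ) 𝓘(ℂ) f) (h : Tendsto f atImInfty (𝓝 c)) (hc : c ≠ 0) (h0 : ∀ τ, f τ ≠ 0) :
    HB fun τ => (f τ)⁻¹ := HB.of_lim (inv_hol hf h0) (h.inv₀ hc)

lemma HB.div {f g : ℍ → ℂ} (hf : HB f) (hg : HB fun τ => (g τ)⁻¹) : HB fun τ => f τ / g τ := by
  simpa [div_eq_mul_inv] using hf.mul hg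

lemma tD_ne (τ : ℍ) : tD τ ≠ 0 := div_ne_zero (ModularForm.discriminant_ne_zero τ) (pow_ne_zero _ (rr_ne τ))
lemma tD_hol : MDifferentiable 𝓘(ℂ) 𝓘(ℂ) tD := by
  have := dd_hol.mul (inv_hol (rr_hol.pow 2) fun τ => pow_ne_zero _ (rr_ne τ))
  have e : tD = fun τ => ModularForm.discriminant τ * (rr τ ^ 2)⁻¹ := by ext τ; rw [tD, div_eq_mul_inv]
  rw [e]; exact this

lemma hbX : HB tX := .of_lim tX_hol tX_lim
lemma hbY : HB tY := .of_lim tY_hol tY_lim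
lemma hbZ : HB tZ := .of_lim tZ_hol tZ_lim
lemma hbV : HB tV := .of_lim tV_hol tV_lim
lemma hbr : HB rr := .of_lim rr_hol rr_lim
lemma hbD : HB tD := .of_lim tD_hol tD_lim
lemma hbYi : HB fun τ => (tY τ)⁻¹ := .inv_lim tY_hol tY_lim one_ne_zero tY_ne
lemma hbZi : HB fun τ => (tZ τ)⁻¹ := .inv_lim tZ_hol tZ_lim one_ne_zero tZ_ne
lemma hbVi : HB fun τ => (tV τ)⁻¹ := .inv_lim tV_hol tV_lim (by norm_num) tV_ne
lemma hbDi : HB fun τ => (tD τ)⁻¹ := .inv_lim tD_hol tD_lim one_ne_zero tD_ne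

lemma HOK_of {h u : Fin 4 → ℍ → ℂ} (hu : ∀ m, HB (u m)) (he : ∀ m τ, rr τ ^ Nt m * h m τ = u m τ)
    (hT : ∀ m τ, h m (T • τ) = (-1) ^ Nt m * h m τ) : HOK h := by
  refine ⟨fun m => ?_, hT, fun m => ?_⟩
  · have e : h m = fun τ => (rr τ ^ Nt m)⁻¹ * u m τ := by
      ext τ
      rw [← he, inv_mul_cancel_left₀ (pow_ne_zero _ (rr_ne τ))]
    rw [e]
    exact (inv_hol (rr_hol.pow _) fun τ => pow_ne_zero _ (rr_ne τ)).mul (hu m).1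
  · have e : (fun τ => rr τ ^ Nt m * h m τ) = u m := by ext τ; exact he m τ
    rw [e]; exact (hu m).2

/-- slopes -/
def tS : Fin 3 → ℍ → ℂ := ![fun τ => -(tX τ + 2 * tZ τ), fun τ => 2 * tX τ + tZ τ, fun τ => tZ τ - tX τ]
/-- weights -/
def tW : Fin 3 → ℍ → ℂ := ![fun τ => tX τ ^ 4, fun τ => tZ τ ^ 4, fun τ => tY τ ^ 4]

/-- coefficients of generators -/
def gH (j m : Fin 4) (τ : ℍ) : ℂ := if j = 3 then cv 3 m / ModularForm.discriminant τ else
  (∑ i : Fin 3, tS i τ ^ (j : ℕ) * tW i τ * cv i.castSucc m) / ModularForm.discriminant τ ^ 2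

lemma hbS (i : Fin 3) : HB (tS i) := by
  fin_cases i
  · exact (hbX.add ((HB.const 2).mul hbZ)).neg
  · exact ((HB.const 2).mul hbX).add hbZ
  · exact hbZ.sub hbX

/-- quotient polynomial -/
def Pq (j : ℕ) (τ : ℍ) : ℂ := tS 2 τ ^ j * ((tY τ + tZ τ) * (tY τ ^ 2 + tZ τ ^ 2)) - (if j = 0 then 0 else if j = 1 then 3 else 3 * (tS 1 τ + tS 2 τ)) * tZ τ ^ 4

lemma Pq_eq (j : Fin 4) (hj : j ≠ 3) (τ : ℍ) : tS 2 τ ^ (j:ℕ) * tY τ ^ 4 - tS 1 τ ^ (j:ℕ) * tZ τ ^ 4 = tX τ * Pq j τ := by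
  fin_cases j
  · simp [Pq, jacobi_id]; ring
  · simp [Pq, jacobi_id, tS]; ring
  · simp [Pq, jacobi_id, tS]; ring
  · exact absurd rfl hj

lemma hbP (j : ℕ) : HB (Pq j) := by
  have h1 : HB fun τ => if j = 0 then 0 else if j = 1 then 3 else 3 * (tS 1 τ + tS 2 τ) := by
    by_cases h0 : j = 0
    · simpa [h0] using HB.const 0
    · by_cases h1 : j = 1
      · simpa [h1] using HB.const 3
      · simpa [h1, h0] using (HB.const 3).mul ((hbS 1).add (hbS 2))
  exact (((hbS 2).pow j).mul ((hbY.add hbZ).mul ((hbY.pow 2).add (hbZ.pow 2)))).sub (h1.mul (hbZ.pow 4))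

/-- normalized generator coefficients -/
def gU (j m : Fin 4) : ℍ → ℂ := if j = 3 then ![fun _ => 0, fun τ => 675 * (tD τ)⁻¹, fun _ => 0, fun τ => -8 * rr τ ^ 2 * (tD τ)⁻¹] m
  else ![fun τ => (-2025 * 4095) * (tS 0 τ ^ (j:ℕ) * tV τ ^ 4 * (tD τ)⁻¹ ^ 2), fun τ => 2025 * (rr τ ^ 2 * (tS 0 τ ^ (j:ℕ) * tV τ ^ 4 * (tD τ)⁻¹ ^ 2)),
    fun τ => 2025 * (tV τ * Pq j τ * (tD τ)⁻¹ ^ 2),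
    fun τ => (-23 * (tS 0 τ ^ (j:ℕ) * tX τ ^ 4) - 2048 * (tS 1 τ ^ (j:ℕ) * tZ τ ^ 4 + tS 2 τ ^ (j:ℕ) * tY τ ^ 4)) * (tD τ)⁻¹ ^ 2] m

lemma hbU (j m : Fin 4) : HB (gU j m) := by
  unfold gU
  by_cases hj : j = 3
  · rw [if_pos hj]
    fin_cases m
    · exact HB.const 0
    · exact (HB.const 675).mul hbDi
    · exact HB.const 0
    · exact ((HB.const (-8)).mul (hbr.pow 2)).mul hbDi
  · rw [if_neg hj]
    have h0 := ((((hbS 0).pow j).mul (hbV.pow 4)).mul (hbDi.pow 2))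
    fin_cases m
    · exact (HB.const _).mul h0
    · exact (HB.const _).mul ((hbr.pow 2).mul h0)
    · exact (HB.const _).mul ((hbV.mul (hbP j)).mul (hbDi.pow 2))
    · exact (((HB.const _).mul (((hbS 0).pow j).mul (hbX.pow 4))).sub ((HB.const _).mul ((((hbS 1).pow j).mul (hbZ.pow 4)).add (((hbS 2).pow j).mul (hbY.pow 4))))).mul (hbDi.pow 2)

lemma gU_eq (j m : Fin 4) (τ : ℍ) : rr τ ^ Nt m * gH j m τ = gU j m τ := by
  have hr := rr_ne τ
  have hD := tD_ne τ
  by_cases hj : j = 3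
  · simp only [gH, gU, if_pos hj, dd_eq]
    fin_cases m <;> simp [Nt, cv] <;> field_simp
  · have hP := Pq_eq j hj τ
    have h0 : tW 0 τ = (rr τ * tV τ) ^ 4 := rfl
    have h1 : tW 1 τ = tZ τ ^ 4 := rfl
    have h2 : tW 2 τ = tY τ ^ 4 := rfl
    simp only [gH, gU, if_neg hj, dd_eq, Fin.sum_univ_three, h0, h1, h2]
    rw [tX] at hP
    fin_cases m
    · simp [Nt, cv]; field_simp
    · simp [Nt, cv]; field_simp
    · simp [Nt, cv]; field_simp
      linear_combination hP
    · simp [Nt, cv, tX]; field_simp; ring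

lemma gH_T (j m : Fin 4) (τ : ℍ) : gH j m (T • τ) = (-1) ^ Nt m * gH j m τ := by
  have s0 : tS 0 (T • τ) = tS 0 τ := by
    change -(tX (T • τ) + 2 * tZ (T • τ)) = -(tX τ + 2 * tZ τ)
    rw [tX_T, tZ_T, jacobi_id]; ring
  have s1 : tS 1 (T • τ) = tS 2 τ := by
    change 2 * tX (T • τ) + tZ (T • τ) = (tZ τ - tX τ)
    rw [tX_T, tZ_T, jacobi_id]; ring
  have s2 : tS 2 (T • τ) = tS 1 τ := by
    change tZ (T • τ) - tX (T • τ) = (2 * tX τ + tZ τ)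
    rw [tX_T, tZ_T, jacobi_id]; ring
  have w0 : tW 0 (T • τ) = tW 0 τ := by
    change tX (T • τ) ^ 4 = tX τ ^ 4
    rw [tX_T]; ring
  have w1 : tW 1 (T • τ) = tW 2 τ := by
    change tZ (T • τ) ^ 4 = tY τ ^ 4
    rw [tZ_T]
  have w2 : tW 2 (T • τ) = tW 1 τ := by
    change tY (T • τ) ^ 4 = tZ τ ^ 4
    rw [tY_T]
  by_cases hj : j = 3
  · simp only [gH, if_pos hj, dd_T]
    fin_cases m <;> simp [Nt, cv] <;> ring
  · simp only [gH, if_neg hj, dd_T, Fin.sum_univ_three, s0, s1, s2, w0, w1, w2]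
    fin_cases m <;> simp [Nt, cv] <;> ring

lemma gH_ok (j : Fin 4) : HOK (gH j) := HOK_of (hbU j) (gU_eq j) (gH_T j)

lemma HF_gH3 (hB : IsLeech B) (τ : ℍ) (z : CV) : HF B (gH 3) τ z = Qh B (lc B (cv 3)) τ z / ModularForm.discriminant τ := by
  simp only [HF, gH, if_true, Qh_lc hB _ τ.im_pos, Finset.sum_div]
  exact Finset.sum_congr rfl fun m _ => by ring

lemma HF_gH (hB : IsLeech B) (j : Fin 4) (hj : j ≠ 3) (τ : ℍ) (z : CV) : HF B (gH j) τ z =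
    (∑ i : Fin 3, tS i τ ^ (j : ℕ) * tW i τ * Qh B (lc B (cv i.castSucc)) τ z) / ModularForm.discriminant τ ^ 2 := by
  simp only [HF, gH, if_neg hj, Qh_lc hB _ τ.im_pos, Fin.sum_univ_three, Fin.sum_univ_four]
  ring

/-- weights of the generators -/
def gw : Fin 4 → ℤ := ![-4, -2, 0, 0]

lemma gH_S (hB : IsLeech B) (j : Fin 4) (τ : ℍ) (z : CV) : HF B (gH j) (S • τ) ((τ:ℂ)⁻¹ • z) =
    (τ:ℂ) ^ (gw j) * cexp (2 * π * Complex.I * pairC B z z / τ) * HF B (gH j) τ z := by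
  have h0 := (SRel_cv0 hB).eq τ τ.im_pos z
  have h1 := (SRel_cv1 hB).eq τ τ.im_pos z
  have h2 := (SRel_cv2 hB).eq τ τ.im_pos z
  have h3 := (SRel_cv3 hB).eq τ τ.im_pos z
  have hne := ne_zero τ
  have hD := ModularForm.discriminant_ne_zero τ
  have s0 : tS 0 (S • τ) = τ ^ 2 * tS 1 τ := by
    change -(tX (S • τ) + 2 * tZ (S • τ)) = (τ:ℂ) ^ 2 * (2 * tX τ + tZ τ)
    rw [tX_S, tZ_S]; ring
  have s1 : tS 1 (S • τ) = τ ^ 2 * tS 0 τ := by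
    change 2 * tX (S • τ) + tZ (S • τ) = (τ:ℂ) ^ 2 * -(tX τ + 2 * tZ τ)
    rw [tX_S, tZ_S]; ring
  have s2 : tS 2 (S • τ) = τ ^ 2 * tS 2 τ := by
    change tZ (S • τ) - tX (S • τ) = (τ:ℂ) ^ 2 * (tZ τ - tX τ)
    rw [tX_S, tZ_S]; ring
  have w0 : tW 0 (S • τ) = (τ:ℂ) ^ 8 * tW 1 τ := by
    change tX (S • τ) ^ 4 = (τ:ℂ) ^ 8 * tZ τ ^ 4
    rw [tX_S]; ring
  have w1 : tW 1 (S • τ) = (τ:ℂ) ^ 8 * tW 0 τ := by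
    change tZ (S • τ) ^ 4 = (τ:ℂ) ^ 8 * tX τ ^ 4
    rw [tZ_S]; ring
  have w2 : tW 2 (S • τ) = (τ:ℂ) ^ 8 * tW 2 τ := by
    change tY (S • τ) ^ 4 = (τ:ℂ) ^ 8 * tY τ ^ 4
    rw [tY_S]; ring
  by_cases hj : j = 3
  · subst hj
    rw [HF_gH3 hB, HF_gH3 hB, dd_S, coe_Smul, h3]
    simp only [gw]
    simp
    field_simp
  · rw [HF_gH hB j hj, HF_gH hB j hj, dd_S, coe_Smul]
    simp only [Fin.sum_univ_three, s0, s1, s2, w0, w1, w2]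
    have c0 : Fin.castSucc (0 : Fin 3) = 0 := rfl
    have c1 : Fin.castSucc (1 : Fin 3) = 1 := rfl
    have c2 : Fin.castSucc (2 : Fin 3) = 2 := rfl
    rw [c0, c1, c2, h0, h1, h2]
    have hw : (τ:ℂ) ^ (gw j) = ((τ:ℂ) ^ 2) ^ (j:ℕ) * (τ:ℂ)^20 / (τ:ℂ)^24 := by
      fin_cases j
      · simp [gw]; field_simp
      · simp [gw]; field_simp
      · simp [gw]; field_simp
      · exact absurd rfl hj
    rw [hw]
    simp only [mul_pow]
    field_simp
    ring

lemma gen_weak (hB : IsLeech B) (j : Fin 4) : IsWeakJacobiForm B (gw j) 2 (HF B (gH j)) := forward hB (gH_ok j) (gH_S hB j)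

end hbsec

section decomp
open ModularGroup Filter
variable {B : Matrix (Fin 24) (Fin 24) ℤ}

lemma HB.of_hasSum {f : ℍ → ℂ} {c : ℕ → ℂ} (hf : ∀ τ : ℍ, HasSum (fun m => c m * rr τ ^ (2 * m)) (f τ)) : HB f := by
  have hf' : ∀ τ : ℍ, HasSum (fun m => c m • Function.Periodic.qParam 1 τ ^ m) (f τ) := fun τ => by
    simpa only [smul_eq_mul, ← rr_sq, ← pow_mul] using hf τ
  refine ⟨?_, isBoundedAtImInfty_of_hasSum_qExpansion one_pos hf'⟩
  have hr : ∀ r : NNReal, (r : ENNReal) < 1 → (r : ENNReal) ≤ (FormalMultilinearSeries.ofScalars ℂ c).radius := by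
    intro r hr
    rcases eq_or_ne r 0 with rfl | h0
    · simp
    · have hr1 : ‖((r:ℝ):ℂ)‖ < 1 := by simpa using hr
      have hr0 : ((r:ℝ):ℂ) ≠ 0 := by simpa using h0
      have h1 := Function.Periodic.im_invQParam_pos_of_norm_lt_one (h := 1) one_pos hr1 hr0
      have h2 := (hf' ⟨_, h1⟩).summable.norm
      simp only [Function.Periodic.qParam_right_inv one_ne_zero hr0] at h2
      apply FormalMultilinearSeries.le_radius_of_summable
      simpa [norm_mul, mul_comm] using h2
  have hR : 1 ≤ (FormalMultilinearSeries.ofScalars ℂ c).radius := by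
    refine le_of_forall_lt_imp_le_of_dense fun r h => ?_
    lift r to NNReal using h.ne_top
    exact hr r h
  have hF := (FormalMultilinearSeries.ofScalars ℂ c).hasFPowerSeriesOnBall (one_pos.trans_le hR)
  have hin : ∀ x : ℂ, 0 < x.im → Function.Periodic.qParam 1 x ∈ Metric.eball (0:ℂ) (FormalMultilinearSeries.ofScalars ℂ c).radius := by
    intro x hx
    refine Metric.eball_subset_eball hR ?_
    rw [← ENNReal.coe_one, Metric.eball_coe, NNReal.coe_one, mem_ball_zero_iff]
    exact Function.Periodic.norm_qParam_lt_one one_pos hx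
  rw [UpperHalfPlane.mdifferentiable_iff]
  have e : ∀ x : ℂ, 0 < x.im → (f ∘ ofComplex) x = (FormalMultilinearSeries.ofScalars ℂ c).sum (Function.Periodic.qParam 1 x) := by
    intro x hx
    have h1 := hf' ⟨x, hx⟩
    have h2 := hF.hasSum (hin x hx)
    simp only [Function.comp, ofComplex_apply_of_im_pos hx]
    refine h1.unique ?_
    simpa [mul_comm] using h2
  refine DifferentiableOn.congr ?_ e
  exact hF.differentiableOn.comp (Function.Periodic.differentiable_qParam).differentiableOn hin

lemma exists_shell (hB : IsLeech B) (n : ℕ) (h : Nn B n ≠ 0) : ∃ g, hn B g = n := by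
  have : Nonempty (shell B (2 * n)) := by
    by_contra hne
    rw [not_nonempty_iff] at hne
    exact h (by simp [Nn])
  obtain ⟨g, hg⟩ := this
  refine ⟨g, ?_⟩
  have := hn_spec hB g
  have h2 : pairZ B g g = 2 * n := hg
  omega

lemma exists_reps (hB : IsLeech B) : ∃ r : Fin 4 → LV, ∀ i, hn B (r i) = Nt i := by
  obtain ⟨h2, h3, h4⟩ := counts hB
  have : ∀ i, ∃ g, hn B g = Nt i := by
    intro i
    apply exists_shell hB
    fin_cases i
    · simp [Nt, Nn_zero hB]
    · simp [Nt, h2]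
    · simp [Nt, h3]
    · simp [Nt, h4]
  choose r hr using this
  exact ⟨r, hr⟩

/-- the representatives -/
def rp (hB : IsLeech B) : Fin 4 → LV := (exists_reps hB).choose
lemma rp_hn (hB : IsLeech B) (i : Fin 4) : hn B (rp hB i) = Nt i := (exists_reps hB).choose_spec i

lemma rep_conj (hB : IsLeech B) (i : Fin 4) {v w : LV} (hv : hn B v = Nt i) (hw : hn B w = Nt i) :
    ∃ σ ∈ ConwayGroup B, σ.mulVec v = w := by
  obtain ⟨g, hg⟩ := exists_norm8 hB
  have h1 := hn_spec hB v
  have h2 := hn_spec hB w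
  rw [hv] at h1
  rw [hw] at h2
  have key : CJ B 0 v w := by
    fin_cases i
    · have e1 : v = 0 := pz_eq_zero hB (by simpa [Nt] using h1)
      have e2 : w = 0 := pz_eq_zero hB (by simpa [Nt] using h2)
      rw [e1, e2]
      exact ⟨1, ⟨by simp, by simp⟩, by simp, by simp⟩
    · exact trans2 hB (frames hB) hg (by simpa [Nt] using h1) (by simpa [Nt] using h2)
    · exact trans3 hB (frames hB) hg (by simpa [Nt] using h2) (by simpa [Nt] using h1)
    · exact trans4 hB (frames hB) (by simpa [Nt] using h2) (by simpa [Nt] using h1)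
  obtain ⟨σ, h, -, h'⟩ := key
  exact ⟨σ, h, h'⟩

/-- theta-like coefficients -/
def bb (B : Matrix (Fin 24) (Fin 24) ℤ) (f : ℕ → LV → ℂ) (ℓ : LV) (τ : ℍ) : ℂ := (∑' n, f n ℓ * rr τ ^ (2 * n)) / rr τ ^ hn B ℓ

variable {k : ℤ} {ψ : ℍ → CV → ℂ} {f : ℕ → LV → ℂ}

lemma bb_aHS (J : IsJacobiFormWith B k 2 ψ f) (τ : ℍ) (ℓ : LV) :
    HasSum (fun n => f n ℓ * rr τ ^ (2 * n)) (rr τ ^ hn B ℓ * bb B f ℓ τ) := by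
  have hs := (J.expansion τ 0).summable.comp_injective (i := fun n : ℕ => (n, ℓ)) (fun a b h => by simpa using h)
  have e : (fun p : ℕ × LV => f p.1 p.2 * fterm B p.1 p.2 τ 0) ∘ (fun n : ℕ => (n, ℓ)) = fun n => f n ℓ * rr τ ^ (2 * n) := by
    ext n
    simp [Function.comp, fterm_rr, pairC]
  rw [e] at hs
  rw [bb, mul_div_cancel₀ _ (pow_ne_zero _ (rr_ne τ))]
  exact hs.hasSum

lemma bb_HS (hB : IsLeech B) (J : IsJacobiFormWith B k 2 ψ f) (τ : ℍ) (z : CV) :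
    HasSum (fun ℓ => bb B f ℓ τ * tt B ℓ (τ / 2) z) (ψ τ z) := by
  have h := (Equiv.prodComm LV ℕ).hasSum_iff.2 (J.expansion τ z)
  refine h.prod_fiberwise fun ℓ => ?_
  have h1 := (bb_aHS J τ ℓ).mul_right (cexp (2 * π * Complex.I * pairC B (liftC ℓ) z))
  rw [tt_rr hB]
  rw [show bb B f ℓ τ * (rr τ ^ hn B ℓ * cexp (2 * π * Complex.I * pairC B (liftC ℓ) z)) =
    rr τ ^ hn B ℓ * bb B f ℓ τ * cexp (2 * π * Complex.I * pairC B (liftC ℓ) z) by ring]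
  refine h1.congr_fun fun n => ?_
  change f n ℓ * fterm B n ℓ τ z = _
  rw [fterm_rr, ← mul_assoc]

lemma tt_uniq (hB : IsLeech B) {a b : LV → ℂ} {s : CV → ℂ} (τ : ℍ) (ha : ∀ z, HasSum (fun ℓ => a ℓ * tt B ℓ (τ / 2) z) (s z))
    (hb : ∀ z, HasSum (fun ℓ => b ℓ * tt B ℓ (τ / 2) z) (s z)) (ℓ : LV) : a ℓ = b ℓ := by
  simp only [tt_rr hB, ← mul_assoc] at ha hb
  have n0 : ∀ c : LV → ℂ, (∀ z, HasSum (fun ℓ => c ℓ * rr τ ^ hn B ℓ * cexp (2 * π * Complex.I * pairC B (liftC ℓ) z)) (s z)) →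
      Summable fun ℓ => ‖c ℓ * rr τ ^ hn B ℓ‖ := by
    intro c hc
    simpa [pairC] using (hc 0).summable.norm
  have := four_unique2 hB (n0 a ha) (n0 b hb) (fun z => by rw [(ha z).tsum_eq, (hb z).tsum_eq]) ℓ (fun z => (ha z).summable) (fun z => (hb z).summable)
  exact mul_right_cancel₀ (pow_ne_zero _ (rr_ne τ)) this

lemma bb_conway (hB : IsLeech B) (J : IsJacobiFormWith B k 2 ψ f) (τ : ℍ) {σ} (hσ : σ ∈ ConwayGroup B) (ℓ : LV) :
    bb B f (σ.mulVec ℓ) τ = bb B f ℓ τ := by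
  refine tt_uniq hB (a := fun ℓ => bb B f (σ.mulVec ℓ) τ) (b := fun ℓ => bb B f ℓ τ) (s := ψ τ) τ (fun z => ?_) (bb_HS hB J τ) ℓ
  have h := (conE hσ.1).hasSum_iff.2 (bb_HS hB J τ (actC σ z))
  rw [J.conway_invar σ hσ] at h
  refine h.congr_fun fun ℓ => ?_
  simp only [Function.comp]
  change _ = bb B f (σ.mulVec ℓ) τ * tt B (σ.mulVec ℓ) _ _
  rw [tt_conway hσ]

lemma bb_shift (hB : IsLeech B) (J : IsJacobiFormWith B k 2 ψ f) (τ : ℍ) (x ℓ : LV) :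
    bb B f (ℓ + (2:ℤ) • x) τ = bb B f ℓ τ := by
  have key : ∀ z, HasSum (fun ℓ => bb B f (ℓ - (2:ℤ) • x) τ * tt B ℓ (τ / 2) z) (ψ τ z) := by
    intro z
    rw [← (Equiv.addRight ((2:ℤ) • x)).hasSum_iff]
    have h := bb_HS hB J τ (z + (τ:ℂ) • liftC x + liftC 0)
    rw [J.quasi_periodic] at h
    simp only [tt_shift hB] at h
    have e : -((2:ℕ):ℂ) * (Real.pi : ℂ) * Complex.I * (pairZ B x x : ℂ) * (τ : ℂ)
        - 2 * ((2:ℕ):ℂ) * (Real.pi : ℂ) * Complex.I * pairC B (liftC x) z = -2 * π * Complex.I * pairZ B x x * τ - 4 * π * Complex.I * pairC B (liftC x) z := by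
      push_cast; ring
    rw [e] at h
    have h2 := h.mul_left (cexp (-2 * π * Complex.I * pairZ B x x * τ - 4 * π * Complex.I * pairC B (liftC x) z))⁻¹
    rw [inv_mul_cancel_left₀ (Complex.exp_ne_zero _)] at h2
    refine h2.congr_fun fun ℓ => ?_
    simp only [Function.comp, Equiv.coe_addRight, add_sub_cancel_right]
    field_simp
  have := tt_uniq hB τ key (bb_HS hB J τ) (ℓ + (2:ℤ) • x)
  simpa using this.symm

lemma bb_lc (hB : IsLeech B) (J : IsJacobiFormWith B k 2 ψ f) (τ : ℍ) (v : LV) :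
    bb B f v τ = lc B (fun m => bb B f (rp hB m) τ) v := by
  obtain ⟨w, x, rfl, hw⟩ := short_rep hB v
  obtain ⟨i, hi⟩ := hn_cases hB w hw
  rw [bb_shift hB J, lc]
  simp only [wt_congr hB _ (cl_add_two w x), wt_val hB w i _ hi]
  simp
  obtain ⟨σ, hσ, e⟩ := rep_conj hB i hi (rp_hn hB i)
  rw [← e, bb_conway hB J τ hσ]

lemma psi_HF (hB : IsLeech B) (J : IsJacobiFormWith B k 2 ψ f) (τ : ℍ) (z : CV) :
    ψ τ z = HF B (fun m => bb B f (rp hB m)) τ z := by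
  rw [HF, ← Qh_lc hB (fun m => bb B f (rp hB m) τ) τ.im_pos, Qh, Th, ← (bb_HS hB J τ z).tsum_eq]
  exact tsum_congr fun ℓ => by rw [← bb_lc hB J τ]

lemma u_HB (hB : IsLeech B) (J : IsJacobiFormWith B k 2 ψ f) (m : Fin 4) : HB fun τ => rr τ ^ Nt m * bb B f (rp hB m) τ := by
  refine HB.of_hasSum (c := fun n => f n (rp hB m)) fun τ => ?_
  rw [← rp_hn hB m]
  exact bb_aHS J τ _

end decomp

section solve
open ModularGroup Filter
variable {B : Matrix (Fin 24) (Fin 24) ℤ}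

lemma sol (h : Fin 4 → ℍ → ℂ) (hu : ∀ m, HB fun τ => rr τ ^ Nt m * h m τ) :
    ∃ g : Fin 4 → ℍ → ℂ, (∀ j, HB (g j)) ∧ ∀ τ m, h m τ = ∑ j, g j τ * gH j m τ := by
  obtain ⟨u0, e0⟩ : ∃ u, u = fun τ => rr τ ^ 0 * h 0 τ := ⟨_, rfl⟩
  obtain ⟨u1, e1⟩ : ∃ u, u = fun τ => rr τ ^ 2 * h 1 τ := ⟨_, rfl⟩
  obtain ⟨u2, e2⟩ : ∃ u, u = fun τ => rr τ ^ 3 * h 2 τ := ⟨_, rfl⟩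
  obtain ⟨u3, e3⟩ : ∃ u, u = fun τ => rr τ ^ 4 * h 3 τ := ⟨_, rfl⟩
  have b0 : HB u0 := by rw [e0]; exact hu 0
  have b1 : HB u1 := by rw [e1]; exact hu 1
  have b2 : HB u2 := by rw [e2]; exact hu 2
  have b3 : HB u3 := by rw [e3]; exact hu 3
  obtain ⟨c0, ec0⟩ : ∃ c : ℍ → ℂ, c = fun τ => (-1 / (2025 * 4095)) * u0 τ := ⟨_, rfl⟩
  have bc0 : HB c0 := by rw [ec0]; exact (HB.const _).mul b0
  obtain ⟨d, ed⟩ : ∃ c : ℍ → ℂ, c = fun τ => (1 / 675) * (u1 τ - 2025 * (rr τ ^ 2 * c0 τ)) := ⟨_, rfl⟩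
  have bd : HB d := by rw [ed]; exact (HB.const _).mul (b1.sub ((HB.const _).mul ((hbr.pow 2).mul bc0)))
  obtain ⟨p, ep⟩ : ∃ c : ℍ → ℂ, c = fun τ => (-1 / 2048) * (u3 τ + 23 * (rr τ ^ 4 * c0 τ) + 8 * (rr τ ^ 2 * d τ)) := ⟨_, rfl⟩
  have bp : HB p := by
    rw [ep]; exact (HB.const _).mul ((b3.add ((HB.const _).mul ((hbr.pow 4).mul bc0))).add ((HB.const _).mul ((hbr.pow 2).mul bd)))
  obtain ⟨y0, ey0⟩ : ∃ c : ℍ → ℂ, c = fun τ => tD τ ^ 2 * c0 τ * (tV τ)⁻¹ ^ 4 := ⟨_, rfl⟩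
  have by0 : HB y0 := by rw [ey0]; exact ((hbD.pow 2).mul bc0).mul (hbVi.pow 4)
  obtain ⟨y1, ey1⟩ : ∃ c : ℍ → ℂ, c = fun τ => tD τ ^ 2 * ((1 / 2) * (p τ - (1 / 2025) * (rr τ * u2 τ))) * (tZ τ)⁻¹ ^ 4 := ⟨_, rfl⟩
  have by1 : HB y1 := by
    rw [ey1]; exact ((hbD.pow 2).mul ((HB.const _).mul (bp.sub ((HB.const _).mul (hbr.mul b2))))).mul (hbZi.pow 4)
  obtain ⟨q, eq⟩ : ∃ c : ℍ → ℂ, c = fun τ => tD τ ^ 2 * (1 / 3 * ((1 / 2) * (p τ * (tV τ * ((tY τ + tZ τ) * (tY τ ^ 2 + tZ τ ^ 2)))) -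
    (1 / 4050) * (u2 τ * (tY τ ^ 4 + tZ τ ^ 4)))) * ((tV τ)⁻¹ * ((tY τ)⁻¹ ^ 4 * (tZ τ)⁻¹ ^ 4)) := ⟨_, rfl⟩
  have bq : HB q := by
    rw [eq]
    exact ((hbD.pow 2).mul ((HB.const _).mul (((HB.const _).mul (bp.mul (hbV.mul ((hbY.add hbZ).mul ((hbY.pow 2).add (hbZ.pow 2)))))).sub
      ((HB.const _).mul (b2.mul ((hbY.pow 4).add (hbZ.pow 4))))))).mul (hbVi.mul ((hbYi.pow 4).mul (hbZi.pow 4)))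
  obtain ⟨g2, eg2⟩ : ∃ c : ℍ → ℂ, c = fun τ => (-1 / 3) * ((-1 / 3) * ((y0 τ - y1 τ) * (tY τ)⁻¹) - q τ) * (tZ τ)⁻¹ := ⟨_, rfl⟩
  have bg2 : HB g2 := by
    rw [eg2]; exact ((HB.const _).mul (((HB.const _).mul ((by0.sub by1).mul hbYi)).sub bq)).mul hbZi
  refine ⟨![fun τ => y1 τ - tS 1 τ * q τ + g2 τ * (tS 1 τ * tS 2 τ), fun τ => q τ - g2 τ * (tS 1 τ + tS 2 τ), g2, fun τ => tD τ * d τ], ?_, ?_⟩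
  · intro j
    fin_cases j
    · exact (by1.sub ((hbS 1).mul bq)).add (bg2.mul ((hbS 1).mul (hbS 2)))
    · exact bq.sub (bg2.mul ((hbS 1).add (hbS 2)))
    · exact bg2
    · exact hbD.mul bd
  · intro τ m
    have hr := rr_ne τ
    have hD := tD_ne τ
    have hV := tV_ne τ
    have hY := tY_ne τ
    have hZ := tZ_ne τ
    have s0 : tS 0 τ = -(tX τ + 2 * tZ τ) := rfl
    have s1 : tS 1 τ = 2 * tX τ + tZ τ := rfl
    have s2 : tS 2 τ = tZ τ - tX τ := rfl
    have jac := jacobi_id τ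
    have hX : tX τ = rr τ * tV τ := rfl
    have w0 : tW 0 τ = tX τ ^ 4 := rfl
    have w1 : tW 1 τ = tZ τ ^ 4 := rfl
    have w2 : tW 2 τ = tY τ ^ 4 := rfl
    have k0 : y0 τ * tV τ ^ 4 = tD τ ^ 2 * c0 τ := by rw [ey0]; field_simp
    have k1 : 2 * y1 τ * tZ τ ^ 4 = tD τ ^ 2 * (p τ - (1 / 2025) * (rr τ * u2 τ)) := by rw [ey1]; field_simp
    have kq : 3 * q τ * (tV τ * (tY τ ^ 4 * tZ τ ^ 4)) = tD τ ^ 2 * ((1 / 2) * (p τ * (tV τ * ((tY τ + tZ τ) * (tY τ ^ 2 + tZ τ ^ 2)))) -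
       (1 / 4050) * (u2 τ * (tY τ ^ 4 + tZ τ ^ 4))) := by rw [eq]; field_simp
    have k2 : 2 * (y1 τ - 3 * tX τ * q τ) * tY τ ^ 4 = tD τ ^ 2 * (p τ + (1 / 2025) * (rr τ * u2 τ)) := by
      have hZ4 := pow_ne_zero 4 hZ
      have hx : tX τ = tY τ - tZ τ := by rw [jac]; ring
      apply mul_right_cancel₀ hZ4
      have hx' : tY τ ^ 4 - tZ τ ^ 4 = rr τ * tV τ * ((tY τ + tZ τ) * (tY τ ^ 2 + tZ τ ^ 2)) := by rw [← hX, hx]; ring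
      rw [hX]
      linear_combination tY τ ^ 4 * k1 - 2 * rr τ * kq + tD τ ^ 2 * p τ * hx'
    have kg : 9 * g2 τ * tZ τ * tY τ = (y0 τ - y1 τ) + 3 * q τ * tY τ := by
      rw [eg2]; field_simp; ring
    clear ey0 ey1 eq eg2
    have v0 : y1 τ - tS 1 τ * q τ + g2 τ * (tS 1 τ * tS 2 τ) + (q τ - g2 τ * (tS 1 τ + tS 2 τ)) * tS 0 τ + g2 τ * tS 0 τ ^ 2 = y0 τ := by
      rw [s0, s1, s2]
      rw [jac] at kg
      linear_combination kg
    have v1 : y1 τ - tS 1 τ * q τ + g2 τ * (tS 1 τ * tS 2 τ) + (q τ - g2 τ * (tS 1 τ + tS 2 τ)) * tS 1 τ + g2 τ * tS 1 τ ^ 2 = y1 τ := by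
      ring
    have v2 : y1 τ - tS 1 τ * q τ + g2 τ * (tS 1 τ * tS 2 τ) + (q τ - g2 τ * (tS 1 τ + tS 2 τ)) * tS 2 τ + g2 τ * tS 2 τ ^ 2 = y1 τ - 3 * tX τ * q τ := by
      rw [s1, s2]; ring
    have hsum : ∀ G0 G1 G2 G3 : ℂ, G0 * gH 0 m τ + G1 * gH 1 m τ + G2 * gH 2 m τ + G3 * gH 3 m τ =
        ((G0 + G1 * tS 0 τ + G2 * tS 0 τ ^ 2) * tW 0 τ * cv 0 m + (G0 + G1 * tS 1 τ + G2 * tS 1 τ ^ 2) * tW 1 τ * cv 1 m +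
        (G0 + G1 * tS 2 τ + G2 * tS 2 τ ^ 2) * tW 2 τ * cv 2 m) / ModularForm.discriminant τ ^ 2 + G3 * cv 3 m / ModularForm.discriminant τ := by
      intro G0 G1 G2 G3
      have c0 : Fin.castSucc (0 : Fin 3) = 0 := rfl
      have c1 : Fin.castSucc (1 : Fin 3) = 1 := rfl
      have c2 : Fin.castSucc (2 : Fin 3) = 2 := rfl
      simp only [gH, Fin.sum_univ_three, c0, c1, c2]
      simp
      ring
    rw [Fin.sum_univ_four]
    refine Eq.trans ?_ (hsum _ _ _ _).symm
    change _ = ((y1 τ - tS 1 τ * q τ + g2 τ * (tS 1 τ * tS 2 τ) + (q τ - g2 τ * (tS 1 τ + tS 2 τ)) * tS 0 τ + g2 τ * tS 0 τ ^ 2) * _ * _ +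
      (y1 τ - tS 1 τ * q τ + g2 τ * (tS 1 τ * tS 2 τ) + (q τ - g2 τ * (tS 1 τ + tS 2 τ)) * tS 1 τ + g2 τ * tS 1 τ ^ 2) * _ * _ +
      (y1 τ - tS 1 τ * q τ + g2 τ * (tS 1 τ * tS 2 τ) + (q τ - g2 τ * (tS 1 τ + tS 2 τ)) * tS 2 τ + g2 τ * tS 2 τ ^ 2) * _ * _) / _ +
      tD τ * d τ * cv 3 m / _
    rw [v0, v1, v2, w0, w1, w2, hX, mul_pow, dd_eq]
    have k0' : y0 τ * (rr τ ^ 4 * tV τ ^ 4) = rr τ ^ 4 * (tD τ ^ 2 * c0 τ) := by rw [← k0]; ring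
    have k1' : y1 τ * tZ τ ^ 4 = (1 / 2) * (tD τ ^ 2 * (p τ - (1 / 2025) * (rr τ * u2 τ))) := by rw [← k1]; ring
    have k2' : (y1 τ - 3 * (rr τ * tV τ) * q τ) * tY τ ^ 4 = (1 / 2) * (tD τ ^ 2 * (p τ + (1 / 2025) * (rr τ * u2 τ))) := by rw [← k2, hX]; ring
    rw [k0', k1', k2']
    rw [ep, ed, ec0, e0, e1, e2, e3]
    simp only
    clear k0 k1 k2 k0' k1' k2' kq kg v0 v1 v2 hsum
    fin_cases m
    · simp [cv]; field_simp
    · simp [cv]; field_simp; ring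
    · simp [cv]; field_simp; ring
    · simp [cv]; field_simp; ring

lemma HF_sum {h : Fin 4 → ℍ → ℂ} {g : Fin 4 → ℂ} (τ : ℍ) (hg : ∀ m, h m τ = ∑ j, g j * gH j m τ) (z : CV) :
    HF B h τ z = ∑ j, g j * HF B (gH j) τ z := by
  simp only [HF, hg, Fin.sum_univ_four]
  ring

lemma indep (hB : IsLeech B) (τ : ℍ) (g : Fin 4 → ℂ) (hg : ∀ z, ∑ j, g j * HF B (gH j) τ z = 0) : g = 0 := by
  have h1 : ∀ z, Qh B (lc B fun m => ∑ j, g j * gH j m τ) τ z = 0 := by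
    intro z
    rw [Qh_lc hB _ τ.im_pos, ← hg z]
    simp only [HF, Fin.sum_univ_four]
    ring
  have h2 : ∀ m, ∑ j, g j * gH j m τ = 0 := by
    intro m
    have := Qh_unique hB (lc_wf _) τ.im_pos h1 (rp hB m)
    simpa [lc, wt_val hB _ m _ (rp_hn hB m)] using this
  have hD := ModularForm.discriminant_ne_zero τ
  have hX := tX_ne τ
  have hY := tY_ne τ
  have hZ := tZ_ne τ
  have jac := jacobi_id τ
  have s0 : tS 0 τ = -(tX τ + 2 * tZ τ) := rfl
  have s1 : tS 1 τ = 2 * tX τ + tZ τ := rfl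
  have s2 : tS 2 τ = tZ τ - tX τ := rfl
  have hsum : ∀ m, ((g 0 + g 1 * tS 0 τ + g 2 * tS 0 τ ^ 2) * tX τ ^ 4 * cv 0 m + (g 0 + g 1 * tS 1 τ + g 2 * tS 1 τ ^ 2) * tZ τ ^ 4 * cv 1 m +
      (g 0 + g 1 * tS 2 τ + g 2 * tS 2 τ ^ 2) * tY τ ^ 4 * cv 2 m) + g 3 * cv 3 m * ModularForm.discriminant τ = 0 := by
    intro m
    have hm := h2 m
    have c0 : Fin.castSucc (0 : Fin 3) = 0 := rfl
    have c1 : Fin.castSucc (1 : Fin 3) = 1 := rfl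
    have c2 : Fin.castSucc (2 : Fin 3) = 2 := rfl
    have w0 : tW 0 τ = tX τ ^ 4 := rfl
    have w1 : tW 1 τ = tZ τ ^ 4 := rfl
    have w2 : tW 2 τ = tY τ ^ 4 := rfl
    rw [Fin.sum_univ_four] at hm
    simp only [gH, Fin.sum_univ_three, c0, c1, c2, w0, w1, w2] at hm
    simp at hm
    field_simp at hm
    linear_combination hm
  have m0 := hsum 0
  have m1 := hsum 1
  have m2 := hsum 2
  have m3 := hsum 3
  simp [cv] at m0 m1 m2 m3
  have a0 : g 0 + g 1 * tS 0 τ + g 2 * tS 0 τ ^ 2 = 0 := by simpa [hX] using m0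
  have a3 : g 3 = 0 := by simpa [a0, hD] using m1
  rw [a0, a3] at m3
  have a1 : g 0 + g 1 * tS 1 τ + g 2 * tS 1 τ ^ 2 = 0 := by
    have : (g 0 + g 1 * tS 1 τ + g 2 * tS 1 τ ^ 2) * tZ τ ^ 4 = 0 := by linear_combination (-1/4050) * m2 + (-1/4096) * m3
    simpa [hZ] using this
  have a2 : g 0 + g 1 * tS 2 τ + g 2 * tS 2 τ ^ 2 = 0 := by
    have : (g 0 + g 1 * tS 2 τ + g 2 * tS 2 τ ^ 2) * tY τ ^ 4 = 0 := by linear_combination (1/4050) * m2 + (-1/4096) * m3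
    simpa [hY] using this
  rw [s0] at a0; rw [s1] at a1; rw [s2] at a2
  have b1 : g 1 + g 2 * (tX τ + 2 * tZ τ) = 0 := by
    have : 3 * tX τ * (g 1 + g 2 * (tX τ + 2 * tZ τ)) = 0 := by linear_combination a1 - a2
    simpa [hX] using this
  have b2 : g 1 + g 2 * (tX τ - tZ τ) = 0 := by
    have : -3 * tY τ * (g 1 + g 2 * (tX τ - tZ τ)) = 0 := by rw [jac]; linear_combination a0 - a1
    simpa [hY] using this
  have b3 : g 2 = 0 := by
    have : 3 * tZ τ * g 2 = 0 := by linear_combination b1 - b2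
    simpa [hZ] using this
  have b4 : g 1 = 0 := by simpa [b3] using b1
  have b5 : g 0 = 0 := by simpa [b3, b4] using a1
  ext j
  fin_cases j
  · exact b5
  · exact b4
  · exact b3
  · exact a3

end solve

section fin
open ModularGroup Filter
variable {B : Matrix (Fin 24) (Fin 24) ℤ}

lemma indep2 (hB : IsLeech B) (τ : ℍ) (g g' : Fin 4 → ℂ)
    (hg : ∀ z, ∑ j, g j * HF B (gH j) τ z = ∑ j, g' j * HF B (gH j) τ z) : g = g' := by
  refine sub_eq_zero.1 (indep hB τ (g - g') fun z => ?_)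
  simp only [Pi.sub_apply, sub_mul, Finset.sum_sub_distrib, hg z, sub_self]

lemma exists_g (hB : IsLeech B) {k : ℤ} {ψ : ℍ → CV → ℂ} (hψ : IsWeakJacobiForm B k 2 ψ) :
    ∃ g : Fin 4 → ℍ → ℂ, (∀ j, HB (g j)) ∧ (∀ j τ, g j (S • τ) = (τ:ℂ) ^ (k - gw j) * g j τ) ∧
      (∀ j τ, g j (T • τ) = g j τ) ∧ ∀ τ z, ψ τ z = ∑ j, g j τ * HF B (gH j) τ z := by
  obtain ⟨f, J⟩ := hψ
  obtain ⟨g, hb, hg⟩ := sol _ (u_HB hB J)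
  have hs : ∀ τ z, ψ τ z = ∑ j, g j τ * HF B (gH j) τ z := fun τ z => by
    rw [psi_HF hB J]
    exact HF_sum τ (hg τ) z
  refine ⟨g, hb, ?_, ?_, hs⟩
  · intro j τ
    have hne := ne_zero τ
    have key : (fun j => g j (S • τ) * (τ:ℂ) ^ (gw j)) = fun j => (τ:ℂ) ^ k * g j τ := by
      refine indep2 hB τ _ _ fun z => ?_
      have h1 := J.modular S τ z
      have hc : slc S = 1 := by simp [slc, S]
      have hj : jfactor S τ = τ := by simp [jfactor, slc, sld, S]
      rw [hj, hc, hs, hs] at h1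
      simp only [gH_S hB] at h1
      have ee : cexp (((2:ℕ):ℂ) * (Real.pi:ℂ) * Complex.I * 1 * pairC B z z / τ) = cexp (2 * π * Complex.I * pairC B z z / τ) := by
        congr 1; push_cast; ring
      rw [ee] at h1
      apply mul_left_cancel₀ (Complex.exp_ne_zero (2 * π * Complex.I * pairC B z z / τ))
      rw [Finset.mul_sum, Finset.mul_sum]
      rw [Finset.mul_sum] at h1
      refine Eq.trans (Finset.sum_congr rfl fun j _ => ?_) (h1.trans (Finset.sum_congr rfl fun j _ => ?_)) <;> ring
    have h2 := congrFun key j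
    rw [zpow_sub₀ hne, div_mul_eq_mul_div, eq_div_iff (zpow_ne_zero _ hne)]
    exact h2
  · intro j τ
    refine congrFun (indep2 hB τ (fun j => g j (T • τ)) (fun j => g j τ) fun z => ?_) j
    have h1 := J.modular T τ z
    have hc : slc T = 0 := by simp [slc, T]
    have hj : jfactor T τ = 1 := by simp [jfactor, slc, sld, T]
    rw [hj, hc, _root_.one_zpow, inv_one, one_smul, hs, hs] at h1
    simp only [HF_T hB (gH_ok _)] at h1
    rw [h1]
    simp

theorem main_free (B : Matrix (Fin 24) (Fin 24) ℤ) (hB : IsLeech B) :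
    ∃ φ : Fin 4 → UpperHalfPlane → CV → ℂ,
      FreelyGenerates (fun k ψ => IsWeakJacobiForm B k 2 ψ) ![(-4 : ℤ), -2, 0, 0] φ := by
  refine ⟨fun j => HF B (gH j), gen_weak hB, fun k ψ hψ => ?_⟩
  obtain ⟨g, hb, hS, hT, hs⟩ := exists_g hB hψ
  have hF : ∀ j, ∃ F : MForm (k - gw j), ⇑F = g j := by
    intro j
    obtain ⟨F, hF⟩ := mkMF (hb j).1 (hS j) (hT j) (hb j).2
    exact ⟨F.copy _ rfl CongruenceSubgroup.Gamma_one_coe_eq_SL, hF⟩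
  choose F hF using hF
  refine ⟨F, fun τ z => ?_, fun G hG => ?_⟩
  · rw [hs]
    exact Finset.sum_congr rfl fun j _ => by rw [← hF j]; rfl
  · funext j
    apply DFunLike.coe_injective
    funext τ
    have h := indep2 hB τ (fun j => G j τ) (fun j => g j τ) fun z => by rw [← hs, hG]
    have h2 := congrFun h j
    exact h2.trans (congrFun (hF j) τ).symm

end fin

/-- Theorem (Sun–Wang): The module `J^{w,Co₀}_{*,Λ,2}` of Conway invariant weak Jacobi forms
of integral weight and index 2 is a free module over `M_*(SL₂(ℤ)) = ℂ[E₄,E₆]`, generated by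
four forms of weights −4, −2, 0 and 0. -/
theorem conway_weak_jacobi_index_two_free
    (B : Matrix (Fin 24) (Fin 24) ℤ) (hB : IsLeech B) :
    ∃ φ : Fin 4 → UpperHalfPlane → CV → ℂ,
      FreelyGenerates (fun k ψ => IsWeakJacobiForm B k 2 ψ) ![(-4 : ℤ), -2, 0, 0] φ := by
  exact main_free B hB

end
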